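/- (Lemma 4.3.) Let c(x) = 1 + β(x) with c ∈ C^{15}(ℝ³), β ≥ 0 and β = 0 outside Ω₁, and for each k > 0 let u(·,k) ∈ C^{2+α}(ℝ³) be the (unique) solution of the scattering problem Δu + k²c(x)u = 0 in ℝ³, u = exp(−ikx₃) + u_sc, with the radiation condition ∂u_sc/∂r + ik u_sc = o(r⁻¹) as |x| → ∞. Then for every x ∈ Ω̄ and every k > 0 the function u(x,·) is infinitely differentiable with respect to k; for every n ≥ 0 the derivative ∂ₖⁿu(·,k) belongs to C^{2+α}(Ω̄); and for every n ≥ 0 and every k > 0, lim_{ω→0, ω∈ℝ} |∂ₖⁿu(·,k+ω) − ∂ₖⁿu(·,k)|_{2+α} = 0. -/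

import Mathlib

noncomputable section

open MeasureTheory Real Set Filter Bornology

/-- ℝ³ as Euclidean space. -/
abbrev E3 : Type := EuclideanSpace ℝ (Fin 3)

/-- the `j`-th standard basis vector of ℝ³. -/
def e3 (j : Fin 3) : E3 := EuclideanSpace.single j (1 : ℝ)

/-- partial derivative `∂_{x_j} f` of a complex-valued function on ℝ³. -/
def pder (j : Fin 3) (f : E3 → ℂ) (x : E3) : ℂ := fderiv ℝ f x (e3 j)

/-- iterated partial derivative along a list of coordinate directions. -/
def pderList (l : List (Fin 3)) (f : E3 → ℂ) : E3 → ℂ := l.foldr pder f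

/-- Laplacian `Δf = ∑_j ∂²_{x_j} f`. -/
def lap (f : E3 → ℂ) (x : E3) : ℂ := ∑ j : Fin 3, pder j (pder j f) x

/-- `∇f·∇g = ∑_j ∂_{x_j}f ∂_{x_j}g` (non-Hermitian dot product of complex gradients). -/
def gradDot (f g : E3 → ℂ) (x : E3) : ℂ := ∑ j : Fin 3, pder j f x * pder j g x

/-- the set of values `‖f x‖`, `x ∈ S`. -/
def supSet (f : E3 → ℂ) (S : Set E3) : Set ℝ := (fun x => ‖f x‖) '' S

/-- the set of Hölder difference quotients of `f` on `S`. -/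
def holderSet (α : ℝ) (f : E3 → ℂ) (S : Set E3) : Set ℝ :=
  {r | ∃ x ∈ S, ∃ y ∈ S, x ≠ y ∧ r = ‖f x - f y‖ / ‖x - y‖ ^ α}

/-- the Hölder norm `|f|_α = sup_S ‖f‖ + [f]_α` over `S`. -/
def hNorm (α : ℝ) (f : E3 → ℂ) (S : Set E3) : ℝ :=
  sSup (supSet f S) + sSup (holderSet α f S)

/-- the Hölder norm `|f|_{m+α}`: sum of `|D^γ f|_α` over all partial derivatives of order `≤ m`. -/
def cNorm (m : ℕ) (α : ℝ) (f : E3 → ℂ) (S : Set E3) : ℝ :=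
  ∑ k ∈ Finset.range (m + 1), ∑ γ : Fin k → Fin 3, hNorm α (pderList (List.ofFn γ) f) S

/-- membership in the Hölder space `C^{m+α}(S̄)`: continuity up to the boundary,
`m` continuous derivatives on `S`, and finite Hölder norms of all derivatives of order `≤ m`. -/
def InHolder (m : ℕ) (α : ℝ) (f : E3 → ℂ) (S : Set E3) : Prop :=
  ContinuousOn f (closure S) ∧ ContDiffOn ℝ m f S ∧
  ∀ k : ℕ, k ≤ m → ∀ γ : Fin k → Fin 3,
    BddAbove (supSet (pderList (List.ofFn γ) f) S) ∧
    BddAbove (holderSet α (pderList (List.ofFn γ) f) S)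

/-- a boundary function of class `C^{m+α}(∂Ω)`: one admitting a `C^{m+α}(Ω̄)` extension. -/
def InHolderBd (m : ℕ) (α : ℝ) (ψ : E3 → ℂ) (Ω : Set E3) : Prop :=
  ∃ Ψ : E3 → ℂ, InHolder m α Ψ Ω ∧ Set.EqOn Ψ ψ (frontier Ω)

/-- boundary Hölder norm `‖ψ‖_{C^{m+α}(∂Ω)}`: infimum of `|Ψ|_{m+α}` over extensions. -/
def bNorm (m : ℕ) (α : ℝ) (ψ : E3 → ℂ) (Ω : Set E3) : ℝ :=
  sInf { r | ∃ Ψ : E3 → ℂ, InHolder m α Ψ Ω ∧ Set.EqOn Ψ ψ (frontier Ω) ∧ r = cNorm m α Ψ Ω }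

/-- the fundamental solution `Φ(x,y) = exp(−ik|x−y|)/(4π|x−y|)`. -/
def Phi (k : ℝ) (x y : E3) : ℂ :=
  Complex.exp (-Complex.I * k * ‖x - y‖) / (4 * Real.pi * ‖x - y‖)

/-- the incident plane wave `exp(−ikx₃)`. -/
def planeWave (k : ℝ) (x : E3) : ℂ := Complex.exp (-Complex.I * k * (x 2))

/-- the Sommerfeld radiation condition `∂u_sc/∂r + ik u_sc = o(r⁻¹)`, `r = |x| → ∞`,
uniformly over directions. -/
def RadCond (k : ℝ) (usc : E3 → ℂ) : Prop :=
  ∀ ε > 0, ∃ R : ℝ, ∀ x : E3, R ≤ ‖x‖ →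
    ‖x‖ * ‖fderiv ℝ usc x ((‖x‖)⁻¹ • x) + Complex.I * k * usc x‖ ≤ ε

/-- `Ω` has boundary of class `C^{m+α}`: it is the sublevel set of a `C^m` defining function with
`α`-Hölder `m`-th derivatives and nonvanishing gradient on the boundary. -/
def HolderBoundary (m : ℕ) (α : ℝ) (Ω : Set E3) : Prop :=
  ∃ φ : E3 → ℝ, ContDiff ℝ m φ ∧
    (∃ C : ℝ, ∀ x y : E3, ‖iteratedFDeriv ℝ m φ x - iteratedFDeriv ℝ m φ y‖ ≤ C * ‖x - y‖ ^ α) ∧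
    Ω = {x | φ x < 0} ∧ frontier Ω = {x | φ x = 0} ∧
    ∀ x ∈ frontier Ω, fderiv ℝ φ x ≠ 0

/-- `∑_{j=0}^{n-1} q_j`. -/
def sumFun (q : ℕ → E3 → ℂ) (n : ℕ) : E3 → ℂ := fun x => ∑ j ∈ Finset.range n, q j x

theorem norm_sq_eq_sum (x : E3) : ‖x‖ ^ 2 = ∑ j, x j ^ 2 := by
  rw [EuclideanSpace.real_norm_sq_eq]

theorem contDiff_pder {n m : WithTop ℕ∞} {f : E3 → ℂ} (hf : ContDiff ℝ m f) (h : n + 1 ≤ m)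
    (j : Fin 3) : ContDiff ℝ n (pder j f) :=
  (hf.fderiv_right h).clm_apply contDiff_const

theorem hasCompactSupport_pder {f : E3 → ℂ} (hf : HasCompactSupport f) (j : Fin 3) :
    HasCompactSupport (pder j f) :=
  hf.fderiv_apply (𝕜 := ℝ) (e3 j)

theorem continuous_lap {f : E3 → ℂ} (hf : ContDiff ℝ 2 f) : Continuous (lap f) := by
  refine continuous_finsetSum _ fun j _ => ?_
  exact (contDiff_pder (n := 0) (contDiff_pder (n := 1) hf (by norm_num) j) (by norm_num) j).continuous

theorem pder_mul {f g : E3 → ℂ} {x : E3} (hf : DifferentiableAt ℝ f x)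
    (hg : DifferentiableAt ℝ g x) (j : Fin 3) :
    pder j (fun y => f y * g y) x = pder j f x * g x + f x * pder j g x := by
  simp only [pder]
  rw [fderiv_fun_mul hf hg]
  simp; ring

theorem pder_add {f g : E3 → ℂ} {x : E3} (hf : DifferentiableAt ℝ f x)
    (hg : DifferentiableAt ℝ g x) (j : Fin 3) :
    pder j (fun y => f y + g y) x = pder j f x + pder j g x := by
  simp only [pder]
  rw [fderiv_fun_add hf hg]
  simp

theorem pder_sub {f g : E3 → ℂ} {x : E3} (hf : DifferentiableAt ℝ f x)
    (hg : DifferentiableAt ℝ g x) (j : Fin 3) :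
    pder j (fun y => f y - g y) x = pder j f x - pder j g x := by
  simp only [pder]
  rw [fderiv_fun_sub hf hg]
  simp

theorem pder_const_mul {f : E3 → ℂ} {x : E3} (hf : DifferentiableAt ℝ f x) (c : ℂ)
    (j : Fin 3) : pder j (fun y => c * f y) x = c * pder j f x := by
  simp only [pder]
  rw [fderiv_const_mul hf]
  simp

theorem lap_sub {f g : E3 → ℂ} (hf : ContDiff ℝ 2 f) (hg : ContDiff ℝ 2 g) (x : E3) :
    lap (fun y => f y - g y) x = lap f x - lap g x := by
  simp only [lap, ← Finset.sum_sub_distrib]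
  refine Finset.sum_congr rfl fun j _ => ?_
  have : pder j (fun y => f y - g y) = fun y => pder j f y - pder j g y := by
    ext y
    exact pder_sub (hf.differentiable (by norm_num) y) (hg.differentiable (by norm_num) y) j
  rw [this]
  exact pder_sub ((contDiff_pder (n := 1) hf (by norm_num) j).differentiable (by norm_num) x)
    ((contDiff_pder (n := 1) hg (by norm_num) j).differentiable (by norm_num) x) j

theorem integral_mul_pder {f g : E3 → ℂ} (hf : ContDiff ℝ 1 f) (hg : ContDiff ℝ 1 g)
    (hgc : HasCompactSupport g) (j : Fin 3) :
    ∫ x, f x * pder j g x = -∫ x, pder j f x * g x := by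
  have hf' := (contDiff_pder (n := 0) hf (by norm_num) j).continuous
  have hg' := (contDiff_pder (n := 0) hg (by norm_num) j).continuous
  refine integral_mul_fderiv_eq_neg_fderiv_mul_of_integrable ?_ ?_ ?_
    (fun x _ => hf.differentiable (by norm_num) x) (fun x _ => hg.differentiable (by norm_num) x)
  · exact (hf'.mul hg.continuous).integrable_of_hasCompactSupport hgc.mul_left
  · exact (hf.continuous.mul hg').integrable_of_hasCompactSupport
      (hasCompactSupport_pder hgc j).mul_left
  · exact (hf.continuous.mul hg.continuous).integrable_of_hasCompactSupport hgc.mul_left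

theorem integral_mul_lap {f g : E3 → ℂ} (hf : ContDiff ℝ 2 f) (hg : ContDiff ℝ 2 g)
    (hgc : HasCompactSupport g) :
    ∫ x, f x * lap g x = ∫ x, lap f x * g x := by
  have h1 : ∀ j, ContDiff ℝ 1 (pder j f) := fun j => contDiff_pder hf (by norm_num) j
  have h2 : ∀ j, ContDiff ℝ 1 (pder j g) := fun j => contDiff_pder hg (by norm_num) j
  have h3 : ∀ j, Continuous (pder j (pder j f)) := fun j =>
    (contDiff_pder (n := 0) (h1 j) (by norm_num) j).continuous
  have h4 : ∀ j, Continuous (pder j (pder j g)) := fun j =>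
    (contDiff_pder (n := 0) (h2 j) (by norm_num) j).continuous
  simp only [lap, Finset.mul_sum, Finset.sum_mul]
  rw [integral_finsetSum, integral_finsetSum]
  · refine Finset.sum_congr rfl fun j _ => ?_
    rw [integral_mul_pder (hf.of_le (by norm_num)) (h2 j) (hasCompactSupport_pder hgc j),
      integral_mul_pder (h1 j) (hg.of_le (by norm_num)) hgc, neg_neg]
  · exact fun j _ => ((h3 j).mul hg.continuous).integrable_of_hasCompactSupport hgc.mul_left
  · exact fun j _ => (hf.continuous.mul (h4 j)).integrable_of_hasCompactSupport
      (hasCompactSupport_pder (hasCompactSupport_pder hgc j) j).mul_left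

theorem hasFDerivAt_comp_norm_sq {G : ℝ → ℂ} {G' : ℂ} {x : E3}
    (h : HasDerivAt G G' (‖x‖ ^ 2)) :
    HasFDerivAt (fun y : E3 => G (‖y‖ ^ 2))
      ((2 * G') • (Complex.ofRealCLM.comp (innerSL ℝ x))) x := by
  have := h.hasFDerivAt.comp x (HasStrictFDerivAt.hasFDerivAt (hasStrictFDerivAt_norm_sq x))
  refine this.congr_fderiv ?_
  ext v
  simp
  ring

theorem pder_comp_norm_sq {G : ℝ → ℂ} {G' : ℂ} {x : E3}
    (h : HasDerivAt G G' (‖x‖ ^ 2)) (j : Fin 3) :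
    pder j (fun y : E3 => G (‖y‖ ^ 2)) x = 2 * x j * G' := by
  simp only [pder, (hasFDerivAt_comp_norm_sq h).fderiv]
  simp [e3, EuclideanSpace.inner_single_right]
  ring

theorem pder_coord (i j : Fin 3) (x : E3) :
    pder j (fun y : E3 => ((y i : ℝ) : ℂ)) x = if i = j then 1 else 0 := by
  have : HasFDerivAt (fun y : E3 => ((y i : ℝ) : ℂ))
      (Complex.ofRealCLM.comp (EuclideanSpace.proj (𝕜 := ℝ) i)) x :=
    (Complex.ofRealCLM.comp (EuclideanSpace.proj (𝕜 := ℝ) i)).hasFDerivAt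
  simp only [pder, this.fderiv]
  simp [e3, apply_ite (Complex.ofReal)]

theorem contDiff_coord (i : Fin 3) {n : WithTop ℕ∞} : ContDiff ℝ n (fun y : E3 => ((y i : ℝ) : ℂ)) :=
  (Complex.ofRealCLM.comp (EuclideanSpace.proj (𝕜 := ℝ) i)).contDiff

/-- The linear form `x ↦ a · x`, complex-valued. -/
def linForm (a x : E3) : ℂ := ∑ i, (a i : ℂ) * (x i : ℂ)

theorem contDiff_linForm (a : E3) {n : WithTop ℕ∞} : ContDiff ℝ n (linForm a) :=
  ContDiff.sum fun i _ => contDiff_const.mul (contDiff_coord i)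

theorem pder_linForm (a : E3) (j : Fin 3) (x : E3) : pder j (linForm a) x = a j := by
  have : HasFDerivAt (linForm a) (∑ i, (a i : ℂ) • Complex.ofRealCLM.comp
      (EuclideanSpace.proj (𝕜 := ℝ) i)) x :=
    HasFDerivAt.fun_sum fun i _ => (Complex.ofRealCLM.comp
      (EuclideanSpace.proj (𝕜 := ℝ) i)).hasFDerivAt.const_mul (a i : ℂ)
  simp only [pder, this.fderiv]
  simp [e3, apply_ite (Complex.ofReal)]

theorem pder_linForm_pow (a : E3) (l : ℕ) (j : Fin 3) (x : E3) :
    pder j (fun y => linForm a y ^ l) x = l * linForm a x ^ (l - 1) * a j := by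
  have h := (contDiff_linForm a (n := 1)).differentiable (by norm_num) x
  rw [← pder_linForm a j x]
  simp only [pder]
  rw [fderiv_fun_pow l h]
  simp

/-- The Laplacian of `G(|x|²) (a·x)^l`. -/
theorem lap_radial_mul_pow {G G₁ G₂ : ℝ → ℂ} (h1 : ∀ s, 0 ≤ s → HasDerivAt G (G₁ s) s)
    (h2 : ∀ s, 0 ≤ s → HasDerivAt G₁ (G₂ s) s) (a : E3) (l : ℕ) (x : E3) :
    lap (fun y => G (‖y‖ ^ 2) * linForm a y ^ l) x =
      (4 * (‖x‖ ^ 2 : ℝ) * G₂ (‖x‖ ^ 2) + (6 + 4 * l) * G₁ (‖x‖ ^ 2)) * linForm a x ^ l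
      + l * ((l - 1 : ℕ) : ℂ) * (‖a‖ ^ 2 : ℝ) * G (‖x‖ ^ 2) * linForm a x ^ (l - 2) := by
  have hG : ∀ y : E3, DifferentiableAt ℝ (fun y : E3 => G (‖y‖ ^ 2)) y := fun y =>
    (hasFDerivAt_comp_norm_sq (h1 _ (sq_nonneg ‖y‖))).differentiableAt
  have hG₁ : ∀ y : E3, DifferentiableAt ℝ (fun y : E3 => G₁ (‖y‖ ^ 2)) y := fun y =>
    (hasFDerivAt_comp_norm_sq (h2 _ (sq_nonneg ‖y‖))).differentiableAt
  have hl : ∀ (m : ℕ) (y : E3), DifferentiableAt ℝ (fun y => linForm a y ^ m) y := fun m y =>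
    ((contDiff_linForm a (n := 1)).pow m).differentiable (by norm_num) y
  have hc : ∀ (j : Fin 3) (y : E3), DifferentiableAt ℝ (fun y : E3 => 2 * ((y j : ℝ) : ℂ)) y :=
    fun j y => ((contDiff_coord j (n := 1)).differentiable (by norm_num) y).const_mul 2
  have hp : ∀ j, pder j (fun y => G (‖y‖ ^ 2) * linForm a y ^ l) =
      fun y => 2 * ((y j : ℝ) : ℂ) * G₁ (‖y‖ ^ 2) * linForm a y ^ l
        + (l * a j : ℂ) * (G (‖y‖ ^ 2) * linForm a y ^ (l - 1)) := by
    intro j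
    ext y
    rw [pder_mul (hG y) (hl l y), pder_comp_norm_sq (h1 _ (sq_nonneg ‖y‖)), pder_linForm_pow]
    ring
  have hpp : ∀ j, pder j (pder j (fun y => G (‖y‖ ^ 2) * linForm a y ^ l)) x =
      2 * G₁ (‖x‖ ^ 2) * linForm a x ^ l + 4 * (x j : ℂ) ^ 2 * G₂ (‖x‖ ^ 2) * linForm a x ^ l
      + 4 * l * G₁ (‖x‖ ^ 2) * linForm a x ^ (l - 1) * (a j * x j)
      + l * ((l - 1 : ℕ) : ℂ) * G (‖x‖ ^ 2) * linForm a x ^ (l - 2) * (a j : ℂ) ^ 2 := by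
    intro j
    rw [hp j, pder_add (((hc j x).fun_mul (hG₁ x)).fun_mul (hl l x))
      (((hG x).fun_mul (hl (l - 1) x)).const_mul _), pder_const_mul ((hG x).fun_mul (hl (l - 1) x)),
      pder_mul ((hc j x).fun_mul (hG₁ x)) (hl l x), pder_mul (hc j x) (hG₁ x),
      pder_const_mul ((contDiff_coord j (n := 1)).differentiable (by norm_num) x),
      pder_mul (hG x) (hl (l - 1) x), pder_comp_norm_sq (h1 _ (sq_nonneg ‖x‖)),
      pder_comp_norm_sq (h2 _ (sq_nonneg ‖x‖)), pder_linForm_pow, pder_linForm_pow, pder_coord,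
      if_pos rfl]
    rw [show l - 1 - 1 = l - 2 by omega]
    ring
  have hx : ((‖x‖ ^ 2 : ℝ) : ℂ) = ∑ j, (x j : ℂ) ^ 2 := by
    rw [norm_sq_eq_sum]; push_cast; rfl
  have ha : ((‖a‖ ^ 2 : ℝ) : ℂ) = ∑ j, (a j : ℂ) ^ 2 := by
    rw [norm_sq_eq_sum]; push_cast; rfl
  have ht : (l : ℂ) * linForm a x ^ (l - 1) * linForm a x = l * linForm a x ^ l := by
    rcases l with _ | l
    · simp
    · simp [pow_succ, mul_assoc]
  simp only [lap, hpp]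
  rw [hx, ha]
  have hlin : linForm a x = a 0 * x 0 + a 1 * x 1 + a 2 * x 2 := by
    simp [linForm, Fin.sum_univ_three]
  simp only [Fin.sum_univ_three]
  have : (4 * l * G₁ (‖x‖ ^ 2) * linForm a x ^ (l - 1)) *
      (a 0 * x 0 + a 1 * x 1 + a 2 * x 2) = 4 * G₁ (‖x‖ ^ 2) * (l * linForm a x ^ l) := by
    rw [← hlin, ← ht]; ring
  linear_combination this

/-- The `l`-th derivative in `s` of `exp(iκ√s)/√s`, defined through its three-term recurrence. -/
def radialSol (κ : ℝ) : ℕ → ℝ → ℂ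
  | 0, s => Complex.exp (Complex.I * κ * (√s : ℝ)) / (√s : ℝ)
  | 1, s => Complex.exp (Complex.I * κ * (√s : ℝ)) *
      (Complex.I * κ / (2 * s) - 1 / (2 * s * (√s : ℝ)))
  | l + 2, s => -((6 + 4 * l) * radialSol κ (l + 1) s + κ ^ 2 * radialSol κ l s) / (4 * s)

theorem radialSol_ode (κ : ℝ) (l : ℕ) {s : ℝ} (hs : s ≠ 0) :
    4 * s * radialSol κ (l + 2) s + (6 + 4 * l) * radialSol κ (l + 1) s
      + κ ^ 2 * radialSol κ l s = 0 := by
  have : (s : ℂ) ≠ 0 := by exact_mod_cast hs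
  rw [radialSol]
  field_simp
  ring

theorem hasDerivAt_exp_sqrt (κ : ℝ) {s : ℝ} (hs : 0 < s) :
    HasDerivAt (fun s : ℝ => Complex.exp (Complex.I * κ * (√s : ℝ)))
      (Complex.exp (Complex.I * κ * (√s : ℝ)) * (Complex.I * κ / (2 * (√s : ℝ)))) s := by
  have h := ((Real.hasDerivAt_sqrt hs.ne').ofReal_comp.const_mul (Complex.I * κ)).cexp
  refine h.congr_deriv ?_
  push_cast
  ring

theorem hasDerivAt_radialSol (κ : ℝ) (l : ℕ) {s : ℝ} (hs : 0 < s) :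
    HasDerivAt (radialSol κ l) (radialSol κ (l + 1) s) s := by
  have hs' : (s : ℂ) ≠ 0 := by exact_mod_cast hs.ne'
  have hr : ((√s : ℝ) : ℂ) ≠ 0 := by exact_mod_cast (Real.sqrt_pos.2 hs).ne'
  have hsr : (s : ℂ) = ((√s : ℝ) : ℂ) ^ 2 := by
    exact_mod_cast (Real.sq_sqrt hs.le).symm
  have hE := hasDerivAt_exp_sqrt κ hs
  have hR := (Real.hasDerivAt_sqrt hs.ne').ofReal_comp
  have hS : HasDerivAt (fun s : ℝ => (s : ℂ)) 1 s := Complex.ofRealCLM.hasDerivAt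
  suffices H : ∀ l, HasDerivAt (radialSol κ l) (radialSol κ (l + 1) s) s ∧
      HasDerivAt (radialSol κ (l + 1)) (radialSol κ (l + 2) s) s from (H l).1
  intro l
  induction l with
  | zero =>
    constructor
    · have : HasDerivAt (fun s : ℝ => Complex.exp (Complex.I * κ * (√s : ℝ)) / ((√s : ℝ) : ℂ)) _ s :=
        hE.div hR hr
      have e : radialSol κ 0 = fun s : ℝ =>
          Complex.exp (Complex.I * κ * (√s : ℝ)) / ((√s : ℝ) : ℂ) := by
        ext s; rw [radialSol]
      rw [e]
      refine this.congr_deriv ?_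
      rw [radialSol, hsr]
      push_cast
      field_simp
    · have : HasDerivAt (fun s : ℝ => Complex.exp (Complex.I * κ * (√s : ℝ)) *
          (Complex.I * κ / (2 * s) - 1 / (2 * s * ((√s : ℝ) : ℂ)))) _ s :=
        hE.mul (((hasDerivAt_const s (Complex.I * κ)).div (hS.const_mul 2) (by simpa using hs')).sub
          ((hasDerivAt_const s (1 : ℂ)).div ((hS.const_mul 2).mul hR)
            (mul_ne_zero (by simpa using hs') hr)))
      have e : radialSol κ (0 + 1) = fun s : ℝ => Complex.exp (Complex.I * κ * (√s : ℝ)) *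
          (Complex.I * κ / (2 * s) - 1 / (2 * s * ((√s : ℝ) : ℂ))) := by
        ext s; rw [radialSol]
      rw [e]
      refine this.congr_deriv ?_
      simp only [radialSol]
      rw [hsr]
      push_cast
      field_simp
      ring_nf
      simp only [Complex.I_sq]
      ring
  | succ l ih =>
    refine ⟨ih.2, ?_⟩
    have e : radialSol κ (l + 2) = fun s : ℝ =>
        -((6 + 4 * l) * radialSol κ (l + 1) s + κ ^ 2 * radialSol κ l s) / (4 * s) := by
      ext s; rw [radialSol]
    have : HasDerivAt (fun s : ℝ =>
        -((6 + 4 * l) * radialSol κ (l + 1) s + κ ^ 2 * radialSol κ l s) / (4 * s)) _ s :=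
      ((ih.2.const_mul (6 + 4 * (l : ℂ))).add (ih.1.const_mul ((κ : ℂ) ^ 2))).neg.div
        (hS.const_mul 4) (by simpa using hs')
    rw [show l + 1 + 1 = l + 2 by ring, e]
    refine this.congr_deriv ?_
    have h1 := radialSol_ode κ l hs.ne'
    have h2 := radialSol_ode κ (l + 1) hs.ne'
    simp only [Pi.neg_apply, Pi.add_apply]
    rw [show l + 1 + 1 = l + 2 by ring] at h2
    push_cast at h2
    field_simp
    linear_combination (-(s : ℂ)) * h2 + h1

theorem contDiffAt_radialSol (κ : ℝ) (l : ℕ) {s : ℝ} (hs : 0 < s) {n : WithTop ℕ∞} :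
    ContDiffAt ℝ n (radialSol κ l) s := by
  have hs' : (s : ℂ) ≠ 0 := by exact_mod_cast hs.ne'
  have hr : ((√s : ℝ) : ℂ) ≠ 0 := by exact_mod_cast (Real.sqrt_pos.2 hs).ne'
  have hR : ContDiffAt ℝ n (fun s : ℝ => ((√s : ℝ) : ℂ)) s :=
    Complex.ofRealCLM.contDiff.contDiffAt.comp s (Real.contDiffAt_sqrt hs.ne')
  have hS : ContDiffAt ℝ n (fun s : ℝ => (s : ℂ)) s := Complex.ofRealCLM.contDiff.contDiffAt
  have hE : ContDiffAt ℝ n (fun s : ℝ => Complex.exp (Complex.I * κ * (√s : ℝ))) s :=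
    (contDiffAt_const.mul hR).cexp
  suffices H : ∀ l, ContDiffAt ℝ n (radialSol κ l) s ∧ ContDiffAt ℝ n (radialSol κ (l + 1)) s from
    (H l).1
  intro l
  induction l with
  | zero =>
    constructor
    · have e : radialSol κ 0 = fun s : ℝ =>
          Complex.exp (Complex.I * κ * (√s : ℝ)) / ((√s : ℝ) : ℂ) := by
        ext s; rw [radialSol]
      rw [e]
      simp only [div_eq_mul_inv]
      exact hE.mul (hR.inv hr)
    · have e : radialSol κ (0 + 1) = fun s : ℝ => Complex.exp (Complex.I * κ * (√s : ℝ)) *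
          (Complex.I * κ / (2 * s) - 1 / (2 * s * ((√s : ℝ) : ℂ))) := by
        ext s; rw [radialSol]
      rw [e]
      simp only [div_eq_mul_inv]
      exact hE.mul ((contDiffAt_const.mul ((contDiffAt_const.mul hS).inv (by simpa using hs'))).sub
        (contDiffAt_const.mul (((contDiffAt_const.mul hS).mul hR).inv
          (mul_ne_zero (by simpa using hs') hr))))
  | succ l ih =>
    refine ⟨ih.2, ?_⟩
    have e : radialSol κ (l + 1 + 1) = fun s : ℝ =>
        -((6 + 4 * l) * radialSol κ (l + 1) s + κ ^ 2 * radialSol κ l s) / (4 * s) := by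
      ext s; rw [radialSol]
    rw [e]
    simp only [div_eq_mul_inv]
    exact ((contDiffAt_const.mul ih.2).add (contDiffAt_const.mul ih.1)).neg.mul
        ((contDiffAt_const.mul hS).inv (by simpa using hs'))

theorem norm_exp_I_mul_mul (a b : ℝ) : ‖Complex.exp (Complex.I * a * b)‖ = 1 := by
  rw [show Complex.I * a * b = ((a * b : ℝ) : ℂ) * Complex.I by push_cast; ring]
  exact Complex.norm_exp_ofReal_mul_I _

theorem norm_radialSol_one_le (κ : ℝ) {s : ℝ} (hs : 0 < s) :
    ‖radialSol κ 1 s‖ ≤ |κ| / (2 * s) + 1 / (2 * s * √s) := by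
  rw [radialSol, norm_mul, norm_exp_I_mul_mul, one_mul]
  refine (norm_sub_le _ _).trans ?_
  simp [abs_of_pos hs, abs_of_nonneg (Real.sqrt_nonneg s)]

theorem exists_norm_radialSol_le (κ : ℝ) {s₀ : ℝ} (hs₀ : 0 < s₀) (l : ℕ) :
    ∃ C, ∀ s, s₀ ≤ s → ‖radialSol κ l s‖ * √s ^ (l + 1) ≤ C := by
  suffices H : ∀ l, (∃ C, ∀ s, s₀ ≤ s → ‖radialSol κ l s‖ * √s ^ (l + 1) ≤ C) ∧
      ∃ C, ∀ s, s₀ ≤ s → ‖radialSol κ (l + 1) s‖ * √s ^ (l + 2) ≤ C from (H l).1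
  have hq : ∀ s, s₀ ≤ s → √s₀ ≤ √s := fun s h => Real.sqrt_le_sqrt h
  have hq0 : 0 < √s₀ := Real.sqrt_pos.2 hs₀
  have hinv : ∀ s, s₀ ≤ s → 1 / √s ≤ 1 / √s₀ := fun s h =>
    one_div_le_one_div_of_le hq0 (hq s h)
  intro l
  induction l with
  | zero =>
    constructor
    · refine ⟨1, fun s hs => ?_⟩
      have h0 := hq0.trans_le (hq s hs)
      rw [radialSol, norm_div, norm_exp_I_mul_mul, Complex.norm_real, Real.norm_of_nonneg h0.le]
      field_simp
      simp
    · refine ⟨|κ| / 2 + 1 / 2 * (1 / √s₀), fun s hs => ?_⟩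
      have h0 := hq0.trans_le (hq s hs)
      have hsp := hs₀.trans_le hs
      calc _ ≤ (|κ| / (2 * s) + 1 / (2 * s * √s)) * √s ^ 2 := by
            gcongr; exact norm_radialSol_one_le κ hsp
        _ = |κ| / 2 + 1 / 2 * (1 / √s) := by
            rw [Real.sq_sqrt hsp.le]; field_simp
        _ ≤ _ := by gcongr
  | succ l ih =>
    refine ⟨ih.2, ?_⟩
    obtain ⟨⟨C, hC⟩, D, hD⟩ := ih
    refine ⟨((6 + 4 * l) * D * (1 / √s₀) + κ ^ 2 * C) / 4, fun s hs => ?_⟩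
    have h0 := hq0.trans_le (hq s hs)
    have hsp := hs₀.trans_le hs
    have hD0 : 0 ≤ D := le_trans (by positivity) (hD s hs)
    rw [radialSol]
    calc _ ≤ ((6 + 4 * l) * ‖radialSol κ (l + 1) s‖ + κ ^ 2 * ‖radialSol κ l s‖) / (4 * s)
            * √s ^ (l + 1 + 2) := by
          gcongr
          rw [norm_div, norm_neg]
          have e1 : ‖(4 * s : ℂ)‖ = 4 * s := by simp [abs_of_pos hsp]
          rw [e1]
          gcongr
          refine (norm_add_le _ _).trans ?_
          rw [norm_mul, norm_mul]
          gcongr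
          · rw [show (6 + 4 * l : ℂ) = ((6 + 4 * l : ℝ) : ℂ) by push_cast; ring, Complex.norm_real,
              Real.norm_of_nonneg (by positivity)]
          · simp
      _ = ((6 + 4 * l) * (‖radialSol κ (l + 1) s‖ * √s ^ (l + 2)) * (1 / √s)
            + κ ^ 2 * (‖radialSol κ l s‖ * √s ^ (l + 1))) / 4 := by
          have : s = √s ^ 2 := (Real.sq_sqrt hsp.le).symm
          field_simp
          rw [this, Real.sqrt_sq h0.le]
          ring
      _ ≤ _ := by
          gcongr <;> first | exact hD s hs | exact hinv s hs | exact hC s hs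

/-- The Wronskian of `radialSol κ l` and its complex conjugate. -/
def radialWronskian (κ : ℝ) (l : ℕ) (s : ℝ) : ℂ :=
  radialSol κ l s * (starRingEnd ℂ) (radialSol κ (l + 1) s)
    - (starRingEnd ℂ) (radialSol κ l s) * radialSol κ (l + 1) s

theorem radialWronskian_ne_zero {κ : ℝ} (hκ : κ ≠ 0) (l : ℕ) {s : ℝ} (hs : 0 < s) :
    radialWronskian κ l s ≠ 0 := by
  have hs' : (s : ℂ) ≠ 0 := by exact_mod_cast hs.ne'
  have hr : ((√s : ℝ) : ℂ) ≠ 0 := by exact_mod_cast (Real.sqrt_pos.2 hs).ne'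
  have hk : (κ : ℂ) ≠ 0 := by exact_mod_cast hκ
  induction l with
  | zero =>
    have : radialWronskian κ 0 s = -(Complex.I * κ) / (s * (√s : ℝ)) := by
      simp only [radialWronskian, radialSol, map_mul, map_sub, map_div₀, Complex.conj_ofReal,
        map_ofNat, map_one, Complex.conj_I]
      have hE : Complex.exp (Complex.I * κ * (√s : ℝ)) *
          (starRingEnd ℂ) (Complex.exp (Complex.I * κ * (√s : ℝ))) = 1 := by
        rw [Complex.mul_conj, Complex.normSq_eq_norm_sq, norm_exp_I_mul_mul]; simp
      field_simp
      linear_combination (-2 * Complex.I * κ * (√s : ℝ) : ℂ) * hE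
    rw [this]
    exact div_ne_zero (neg_ne_zero.2 (mul_ne_zero Complex.I_ne_zero hk)) (mul_ne_zero hs' hr)
  | succ l ih =>
    have h1 := radialSol_ode κ l hs.ne'
    have h2 := congrArg (starRingEnd ℂ) h1
    simp only [map_add, map_mul, map_pow, Complex.conj_ofReal, map_ofNat, map_zero,
      map_natCast] at h2
    have : 4 * s * radialWronskian κ (l + 1) s = κ ^ 2 * radialWronskian κ l s := by
      simp only [radialWronskian, show l + 1 + 1 = l + 2 by ring]
      linear_combination (radialSol κ (l + 1) s) * h2
        - (starRingEnd ℂ) (radialSol κ (l + 1) s) * h1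
    intro h0
    rw [h0, mul_zero] at this
    exact mul_ne_zero (pow_ne_zero 2 hk) ih this.symm

theorem fderiv_apply_eq_sum (f : E3 → ℂ) (x y : E3) :
    fderiv ℝ f x y = ∑ j, (y j : ℂ) * pder j f x := by
  have : y = ∑ j, y j • e3 j := by
    ext i
    simp [e3, Fin.sum_univ_three]
    fin_cases i <;> simp
  conv_lhs => rw [this, map_sum]
  simp [pder]

theorem pder_conj {f : E3 → ℂ} {x : E3} (hf : DifferentiableAt ℝ f x) (j : Fin 3) :
    pder j (fun y => (starRingEnd ℂ) (f y)) x = (starRingEnd ℂ) (pder j f x) := by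
  have := (Complex.conjCLE.toContinuousLinearMap.hasFDerivAt.comp x hf.hasFDerivAt).fderiv
  have e : (fun y => (starRingEnd ℂ) (f y)) = Complex.conjCLE.toContinuousLinearMap ∘ f := rfl
  rw [pder, e, this]
  simp [pder]

theorem contDiff_comp_norm_sq {G : ℝ → ℂ} {n : WithTop ℕ∞} (hG : ContDiff ℝ n G) :
    ContDiff ℝ n (fun x : E3 => G (‖x‖ ^ 2)) := hG.comp (contDiff_norm_sq ℝ)

theorem hasCompactSupport_of_norm_sq {f : E3 → ℂ} {S : ℝ} (h : ∀ x, S ≤ ‖x‖ ^ 2 → f x = 0) :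
    HasCompactSupport f := by
  refine HasCompactSupport.intro (isCompact_closedBall 0 (√(max S 0))) fun x hx => h x ?_
  rw [mem_closedBall_zero_iff, not_le] at hx
  have := Real.lt_sq_of_sqrt_lt hx
  exact (le_max_left _ _).trans this.le

theorem integral_flux_eq_zero {k : ℝ} {v : E3 → ℂ} (hv : ContDiff ℝ 2 v) {β : E3 → ℝ}
    (hv2 : ∀ x, lap v x + (k : ℂ) ^ 2 * (1 + β x) * v x = 0)
    {χ χ' : ℝ → ℝ} (hχ : ∀ s, HasDerivAt χ (χ' s) s) (hχ' : Continuous χ') {S : ℝ}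
    (hS : ∀ s, S ≤ s → χ s = 0) :
    ∫ x, χ' (‖x‖ ^ 2) * (fderiv ℝ v x x * (starRingEnd ℂ) (v x)).im = 0 := by
  have hχ1 : ContDiff ℝ 1 (fun s => (χ s : ℂ)) := by
    refine Complex.ofRealCLM.contDiff.comp ?_
    rw [contDiff_one_iff_deriv]
    exact ⟨fun s => (hχ s).differentiableAt, by
      rwa [show deriv χ = χ' from funext fun s => (hχ s).deriv]⟩
  set g : E3 → ℂ := fun x => (χ (‖x‖ ^ 2) : ℂ) * (starRingEnd ℂ) (v x) with hg
  have hv1 : ContDiff ℝ 1 v := hv.of_le (by norm_num)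
  have hvc : ContDiff ℝ 1 (fun x => (starRingEnd ℂ) (v x)) :=
    Complex.conjCLE.toContinuousLinearMap.contDiff.comp hv1
  have hχn := contDiff_comp_norm_sq hχ1
  have hg1 : ContDiff ℝ 1 g := hχn.mul hvc
  have hgS : HasCompactSupport g := by
    refine hasCompactSupport_of_norm_sq (S := S) fun x hx => ?_
    simp [hg, hS _ hx]
  have hd : ∀ j, ContDiff ℝ 1 (pder j v) := fun j => contDiff_pder hv (by norm_num) j
  have hpg : ∀ j x, pder j g x = 2 * x j * χ' (‖x‖ ^ 2) * (starRingEnd ℂ) (v x) +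
      χ (‖x‖ ^ 2) * (starRingEnd ℂ) (pder j v x) := by
    intro j x
    rw [hg, pder_mul (hχn.differentiable one_ne_zero x) (hvc.differentiable one_ne_zero x),
      pder_conj (hv1.differentiable one_ne_zero x),
      pder_comp_norm_sq (G := fun s => (χ s : ℂ)) (hχ (‖x‖ ^ 2)).ofReal_comp]
  have hpgc : ∀ j, Continuous (pder j g) := fun j => (contDiff_pder (n := 0) hg1 (by norm_num) j).continuous
  have hI1 : ∀ j, Integrable (fun x => pder j v x * pder j g x) := fun j =>
    ((hd j).continuous.mul (hpgc j)).integrable_of_hasCompactSupport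
      (hasCompactSupport_pder hgS j).mul_left
  have hI2 : ∀ j, Integrable (fun x => pder j (pder j v) x * g x) := fun j =>
    ((contDiff_pder (n := 0) (hd j) (by norm_num) j).continuous.mul
      hg1.continuous).integrable_of_hasCompactSupport hgS.mul_left
  have key : ∫ x, (∑ j, pder j v x * pder j g x + lap v x * g x) = 0 := by
    have : ∀ x, (∑ j, pder j v x * pder j g x + lap v x * g x)
        = ∑ j, (pder j v x * pder j g x + pder j (pder j v) x * g x) := by
      intro x; rw [Finset.sum_add_distrib, lap, Finset.sum_mul]
    simp_rw [this]
    rw [integral_finsetSum]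
    swap
    · exact fun j _ => (hI1 j).add (hI2 j)
    refine Finset.sum_eq_zero fun j _ => ?_
    rw [integral_add (hI1 j) (hI2 j), integral_mul_pder (hd j) hg1 hgS]
    simp
  have hint : Integrable (fun x => ∑ j, pder j v x * pder j g x + lap v x * g x) := by
    refine Integrable.add (integrable_finsetSum _ fun j _ => hI1 j) ?_
    exact ((continuous_lap hv).mul hg1.continuous).integrable_of_hasCompactSupport hgS.mul_left
  have h2 := Complex.imCLM.integral_comp_comm hint
  rw [key] at h2
  simp only [Complex.imCLM_apply, Complex.zero_im] at h2
  have h3 : ∀ x, (∑ j, pder j v x * pder j g x + lap v x * g x).im =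
      2 * (χ' (‖x‖ ^ 2) * (fderiv ℝ v x x * (starRingEnd ℂ) (v x)).im) := by
    intro x
    have hl : lap v x = -((k : ℂ) ^ 2 * (1 + β x) * v x) := eq_neg_of_add_eq_zero_left (hv2 x)
    rw [hl, fderiv_apply_eq_sum]
    have e : (∑ j, pder j v x * pder j g x + -((k : ℂ) ^ 2 * (1 + β x) * v x) * g x) =
      ((2 * χ' (‖x‖ ^ 2) : ℝ) : ℂ) * ((∑ j, (x j : ℂ) * pder j v x) * (starRingEnd ℂ) (v x)) +
       ((χ (‖x‖ ^ 2) * ∑ j, ‖pder j v x‖ ^ 2 -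
        k ^ 2 * (1 + β x) * χ (‖x‖ ^ 2) * ‖v x‖ ^ 2 : ℝ) : ℂ) := by
      push_cast
      simp_rw [hpg, hg, Fin.sum_univ_three, ← Complex.mul_conj']
      ring
    rw [e, Complex.add_im, Complex.im_ofReal_mul, Complex.ofReal_im]
    ring
  simp_rw [h3, integral_const_mul] at h2
  linarith

theorem exists_bump_tail : ∃ η w : ℝ → ℝ, (∀ s, HasDerivAt η (-w s) s) ∧ Continuous w ∧
    (∀ s, 5 ≤ s → η s = 0) ∧ (∀ s, 0 ≤ w s) ∧ (∀ s, w s ≤ 1) ∧ (∀ s ∈ Icc 1 4, w s = 1) ∧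
    (∀ s, w s ≠ 0 → s ∈ Ioo (1 / 2) 5) := by
  let b : ContDiffBump (5 / 2 : ℝ) := ⟨3 / 2, 2, by norm_num, by norm_num⟩
  have hb0 : ∀ s, b s ≠ 0 → s ∈ Ioo (1 / 2) 5 := by
    intro s hs
    have : s ∈ Function.support b := hs
    rw [b.support_eq, Metric.mem_ball, Real.dist_eq, abs_lt] at this
    change -2 < _ ∧ _ < (2 : ℝ) at this
    constructor <;> linarith
  refine ⟨fun s => ∫ t in s..5, b t, b, fun s => ?_, b.continuous, fun s hs => ?_,
    fun s => b.nonneg, fun s => b.le_one, fun s hs => ?_, hb0⟩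
  · exact intervalIntegral.integral_hasDerivAt_left (b.continuous.intervalIntegrable _ _)
      (b.continuous.stronglyMeasurableAtFilter _ _) b.continuous.continuousAt
  · refine (intervalIntegral.integral_congr (g := fun _ => 0) fun t ht => ?_).trans (by simp)
    rw [uIcc_of_ge hs] at ht
    by_contra h
    linarith [(hb0 t h).2, ht.1]
  · refine b.one_of_mem_closedBall ?_
    rw [Metric.mem_closedBall, Real.dist_eq, abs_le]
    change -(3 / 2) ≤ _ ∧ _ ≤ (3 / 2 : ℝ)
    constructor <;> linarith [hs.1, hs.2]

theorem fderiv_apply_self_eq {v : E3 → ℂ} {x : E3} (hx : x ≠ 0) :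
    fderiv ℝ v x x = ‖x‖ * fderiv ℝ v x (‖x‖⁻¹ • x) := by
  have : ((‖x‖ : ℝ) : ℂ) ≠ 0 := by simpa using hx
  rw [map_smul, Complex.real_smul]
  push_cast
  field_simp

theorem exists_shell_integral_le {k : ℝ} (hk : 0 < k) {v : E3 → ℂ} (hv : ContDiff ℝ 2 v)
    {β : E3 → ℝ} (hv2 : ∀ x, lap v x + (k : ℂ) ^ 2 * (1 + β x) * v x = 0)
    (hrad : RadCond k v) {ε : ℝ} (hε : 0 < ε) :
    ∃ ρ₀ : ℝ, 0 < ρ₀ ∧ ∀ ρ, ρ₀ ≤ ρ →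
      ∫ x in {x : E3 | ρ ≤ ‖x‖ ∧ ‖x‖ ≤ 2 * ρ}, ‖v x‖ ≤ ε * ρ ^ 2 := by
  obtain ⟨η, w, hη, hw, hη0, hw0, hw1, hwI, hwS⟩ := exists_bump_tail
  set V : ℝ := volume.real (Metric.closedBall (0 : E3) 3) with hV
  have hV0 : 0 ≤ V := measureReal_nonneg
  set μ := ε / (V + 1) with hμ
  have hμ0 : 0 < μ := by positivity
  obtain ⟨R, hR⟩ := hrad (k * μ / 2) (by positivity)
  refine ⟨max (2 * R) 1, by positivity, fun ρ hρ => ?_⟩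
  have hρ1 : 1 ≤ ρ := (le_max_right _ _).trans hρ
  have hρR : 2 * R ≤ ρ := (le_max_left _ _).trans hρ
  have hρ0 : 0 < ρ := by linarith
  set W : E3 → ℝ := fun x => w (‖x‖ ^ 2 / ρ ^ 2) with hW
  have hWc : Continuous W := by fun_prop
  have hW0 : ∀ x, 0 ≤ W x := fun x => hw0 _
  have hW1 : ∀ x, W x ≤ 1 := fun x => hw1 _
  have hWS : ∀ x, W x ≠ 0 → ρ / 2 ≤ ‖x‖ ∧ ‖x‖ ≤ 3 * ρ := by
    intro x hx
    have h := hwS _ hx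
    rw [mem_Ioo, lt_div_iff₀ (by positivity), div_lt_iff₀ (by positivity)] at h
    constructor <;> refine le_of_sq_le_sq ?_ (by positivity) <;> nlinarith
  have hWcs : HasCompactSupport W := by
    refine HasCompactSupport.intro (isCompact_closedBall 0 (3 * ρ)) fun x hx => ?_
    by_contra h
    exact hx (mem_closedBall_zero_iff.2 (hWS x h).2)
  have hflux := integral_flux_eq_zero hv hv2 (χ := fun s => ρ ^ 2 * η (s / ρ ^ 2))
    (χ' := fun s => -w (s / ρ ^ 2)) (S := 5 * ρ ^ 2) (fun s => by
      have := ((hη (s / ρ ^ 2)).comp s ((hasDerivAt_id s).div_const (ρ ^ 2))).const_mul (ρ ^ 2)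
      refine this.congr_deriv ?_
      field_simp) (by fun_prop) (fun s hs => by
      rw [hη0 _ (by rwa [le_div_iff₀ (by positivity)]), mul_zero])
  have hvc := hv.continuous
  have hWi : Integrable W := hWc.integrable_of_hasCompactSupport hWcs
  have hI1 : Integrable (fun x => W x * ‖v x‖) :=
    (hWc.mul hvc.norm).integrable_of_hasCompactSupport hWcs.mul_right
  have hI2 : Integrable (fun x => W x * ‖v x‖ ^ 2) :=
    (hWc.mul (hvc.norm.pow 2)).integrable_of_hasCompactSupport hWcs.mul_right
  have hfd : Continuous fun x => fderiv ℝ v x x :=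
    (hv.continuous_fderiv (by norm_num)).clm_apply continuous_id
  have hI3 : Integrable (fun x => W x * (fderiv ℝ v x x * (starRingEnd ℂ) (v x)).im) :=
    (hWc.mul (Complex.continuous_im.comp (hfd.mul
      (Complex.continuous_conj.comp hvc)))).integrable_of_hasCompactSupport hWcs.mul_right
  have hpt : ∀ x, W x * ‖v x‖ ^ 2 * (k * ρ / 2) ≤ (k * μ / 2) * (W x * ‖v x‖)
      - W x * (fderiv ℝ v x x * (starRingEnd ℂ) (v x)).im := by
    intro x
    by_cases hx : W x = 0
    · simp [hx]
    obtain ⟨hx1, hx2⟩ := hWS x hx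
    have hxn : x ≠ 0 := by rintro rfl; simp at hx1; linarith
    have hE := hR x (by linarith)
    set E := fderiv ℝ v x (‖x‖⁻¹ • x) + Complex.I * k * v x with hEdef
    have e1 : (fderiv ℝ v x x * (starRingEnd ℂ) (v x)).im =
        ‖x‖ * (E * (starRingEnd ℂ) (v x)).im - ‖x‖ * k * ‖v x‖ ^ 2 := by
      have : fderiv ℝ v x x * (starRingEnd ℂ) (v x) = (‖x‖ : ℝ) * (E * (starRingEnd ℂ) (v x)) -
          ((‖x‖ * k * ‖v x‖ ^ 2 : ℝ) : ℂ) * Complex.I := by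
        rw [fderiv_apply_self_eq hxn]
        push_cast
        rw [← Complex.mul_conj', hEdef]
        ring
      rw [this, Complex.sub_im, Complex.im_ofReal_mul, Complex.im_ofReal_mul, Complex.I_im, mul_one]
    have e2 : ‖x‖ * (E * (starRingEnd ℂ) (v x)).im ≤ k * μ / 2 * ‖v x‖ := by
      calc _ ≤ ‖x‖ * (‖E‖ * ‖v x‖) := by
            gcongr
            refine (Complex.im_le_norm _).trans ?_
            rw [norm_mul, RCLike.norm_conj]
        _ = (‖x‖ * ‖E‖) * ‖v x‖ := by ring
        _ ≤ _ := by gcongr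
    have e3 : ‖v x‖ ^ 2 * (k * ρ / 2) ≤ ‖x‖ * k * ‖v x‖ ^ 2 := by
      have : k * ρ / 2 ≤ ‖x‖ * k := by nlinarith
      nlinarith [sq_nonneg ‖v x‖]
    rw [e1]
    nlinarith [hW0 x]
  have hmain : (∫ x, W x * ‖v x‖ ^ 2) * (k * ρ / 2) ≤ (k * μ / 2) * ∫ x, W x * ‖v x‖ := by
    have := integral_mono (hI2.mul_const _) ((hI1.const_mul (k * μ / 2)).sub hI3) hpt
    rw [integral_mul_const, integral_sub' (hI1.const_mul _) hI3, integral_const_mul] at this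
    have h0 : ∫ x, W x * (fderiv ℝ v x x * (starRingEnd ℂ) (v x)).im = 0 := by
      simp_rw [neg_mul] at hflux
      rw [integral_neg, neg_eq_zero] at hflux
      exact hflux
    rw [h0, sub_zero] at this
    exact this
  have hWV : ∫ x, W x ≤ V * ρ ^ 3 := by
    calc ∫ x, W x ≤ ∫ x, (Metric.closedBall (0 : E3) (3 * ρ)).indicator 1 x := by
          refine integral_mono hWi ?_ fun x => ?_
          · exact (integrable_indicator_iff Metric.isClosed_closedBall.measurableSet).2
              (integrableOn_const measure_closedBall_lt_top.ne)
          · by_cases hx : W x = 0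
            · rw [hx]; exact indicator_nonneg (fun _ _ => zero_le_one) _
            · rw [indicator_of_mem (mem_closedBall_zero_iff.2 (hWS x hx).2)]; exact hW1 x
      _ = V * ρ ^ 3 := by
          rw [integral_indicator_one Metric.isClosed_closedBall.measurableSet, mul_comm 3 ρ,
            Measure.real, Measure.addHaar_closedBall_mul _ _ hρ0.le (by norm_num : (0 : ℝ) ≤ 3),
            ENNReal.toReal_mul, ENNReal.toReal_ofReal (by positivity)]
          simp [V, Measure.real, mul_comm]
  have hAG : ∫ x, W x * ‖v x‖ ≤ (μ / (2 * ρ)) * (∫ x, W x) + (ρ / (2 * μ)) * ∫ x, W x * ‖v x‖ ^ 2 := by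
    rw [← integral_const_mul, ← integral_const_mul, ← integral_add (hWi.const_mul _) (hI2.const_mul _)]
    refine integral_mono hI1 ((hWi.const_mul _).add (hI2.const_mul _)) fun x => ?_
    have : ‖v x‖ ≤ μ / (2 * ρ) + ρ / (2 * μ) * ‖v x‖ ^ 2 := by
      rw [← sub_nonneg]
      have : μ / (2 * ρ) + ρ / (2 * μ) * ‖v x‖ ^ 2 - ‖v x‖ =
          (μ - ρ * ‖v x‖) ^ 2 / (2 * ρ * μ) := by field_simp; ring
      rw [this]; positivity
    simp only
    nlinarith [hW0 x]
  set A := ∫ x, W x * ‖v x‖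
  have hA : A ≤ μ * V * ρ ^ 2 := by
    set B := ∫ x, W x * ‖v x‖ ^ 2
    have h1 : B ≤ μ / ρ * A := by
      rw [div_mul_eq_mul_div, le_div_iff₀ hρ0]
      nlinarith
    have h2 : ρ / (2 * μ) * B ≤ A / 2 := by
      calc _ ≤ ρ / (2 * μ) * (μ / ρ * A) := by gcongr
        _ = A / 2 := by field_simp
    have h3 : μ / (2 * ρ) * (∫ x, W x) ≤ μ * V * ρ ^ 2 / 2 := by
      calc _ ≤ μ / (2 * ρ) * (V * ρ ^ 3) := by gcongr
        _ = _ := by field_simp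
    linarith
  have hS : MeasurableSet {x : E3 | ρ ≤ ‖x‖ ∧ ‖x‖ ≤ 2 * ρ} :=
    ((isClosed_le continuous_const continuous_norm).inter
      (isClosed_le continuous_norm continuous_const)).measurableSet
  calc _ = ∫ x in {x : E3 | ρ ≤ ‖x‖ ∧ ‖x‖ ≤ 2 * ρ}, W x * ‖v x‖ := by
        refine setIntegral_congr_fun hS fun x hx => ?_
        have : W x = 1 := by
          refine hwI _ ⟨?_, ?_⟩
          · rw [le_div_iff₀ (by positivity)]; nlinarith [hx.1]
          · rw [div_le_iff₀ (by positivity)]; nlinarith [hx.2, norm_nonneg x]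
        simp [this]
    _ ≤ A := setIntegral_le_integral hI1 (Eventually.of_forall fun x =>
          mul_nonneg (hW0 x) (norm_nonneg _))
    _ ≤ μ * V * ρ ^ 2 := hA
    _ ≤ ε * ρ ^ 2 := by
        gcongr
        rw [hμ, div_mul_eq_mul_div, div_le_iff₀ (by positivity)]
        nlinarith

/-- `G` is a `C²` function on the line, supported in a compact subset of `(c₀, ∞)`. -/
structure IsTail (c₀ : ℝ) (G : ℝ → ℂ) : Prop where
  contDiff : ContDiff ℝ 2 G
  left : ∃ c, c₀ < c ∧ ∀ s < c, G s = 0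
  right : ∃ S, ∀ s, S ≤ s → G s = 0

/-- `v` is `o(ρ⁻¹)` on average over the shells `ρ ≤ |x| ≤ 2ρ`. -/
def ShellDecay (v : E3 → ℂ) : Prop :=
  ∀ ε > 0, ∃ ρ₀ : ℝ, 0 < ρ₀ ∧ ∀ ρ, ρ₀ ≤ ρ →
      ∫ x in {x : E3 | ρ ≤ ‖x‖ ∧ ‖x‖ ≤ 2 * ρ}, ‖v x‖ ≤ ε * ρ ^ 2

theorem contDiff_mul_of_eq_zero {n : WithTop ℕ∞} {Y m : ℝ → ℂ} {c : ℝ}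
    (hY : ∀ s, c ≤ s → ContDiffAt ℝ n Y s) (hm : ContDiff ℝ n m) (h0 : ∀ s < c, m s = 0) :
    ContDiff ℝ n (fun s => Y s * m s) := by
  rw [contDiff_iff_contDiffAt]
  intro s
  rcases lt_or_ge s c with h | h
  · refine (contDiffAt_const (c := (0 : ℂ))).congr_of_eventuallyEq ?_
    filter_upwards [Iio_mem_nhds h] with t ht
    simp [h0 t ht]
  · exact (hY s h).mul hm.contDiffAt

theorem norm_linForm_le (a x : E3) : ‖linForm a x‖ ≤ ‖a‖ * ‖x‖ := by
  have : linForm a x = ((inner ℝ a x : ℝ) : ℂ) := by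
    simp [linForm, PiLp.inner_apply, mul_comm]
  rw [this, Complex.norm_real]
  exact norm_inner_le_norm _ _

theorem exists_cutoff : ∃ χ χ₁ χ₂ : ℝ → ℂ, ContDiff ℝ 2 χ ∧ (∀ s, HasDerivAt χ (χ₁ s) s) ∧
    (∀ s, HasDerivAt χ₁ (χ₂ s) s) ∧ (∃ M, ∀ s, ‖χ₁ s‖ ≤ M ∧ ‖χ₂ s‖ ≤ M) ∧
    (∀ s, 0 ≤ s → s < 1 → χ s = 1 ∧ χ₁ s = 0 ∧ χ₂ s = 0) ∧
    (∀ s, 4 < s → χ s = 0 ∧ χ₁ s = 0 ∧ χ₂ s = 0) := by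
  let b : ContDiffBump (0 : ℝ) := ⟨1, 4, by norm_num, by norm_num⟩
  have hb : ContDiff ℝ 2 (fun s => (b s : ℂ)) := Complex.ofRealCLM.contDiff.comp b.contDiff
  have hb1 : ContDiff ℝ 1 (deriv fun s => (b s : ℂ)) := hb.deriv' (n := 1)
  have hb2 : Continuous (deriv (deriv fun s => (b s : ℂ))) := hb1.continuous_deriv le_rfl
  have hbc : HasCompactSupport (fun s => (b s : ℂ)) :=
    b.hasCompactSupport.comp_left Complex.ofReal_zero
  obtain ⟨M₁, hM₁⟩ := hb1.continuous.bounded_above_of_compact_support hbc.deriv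
  obtain ⟨M₂, hM₂⟩ := hb2.bounded_above_of_compact_support hbc.deriv.deriv
  have hev : ∀ {s : ℝ} {c : ℂ}, (fun s => (b s : ℂ)) =ᶠ[nhds s] (fun _ => c) →
      (b s : ℂ) = c ∧ deriv (fun s => (b s : ℂ)) s = 0 ∧
        deriv (deriv fun s => (b s : ℂ)) s = 0 := by
    intro s c h
    refine ⟨h.eq_of_nhds, ?_, ?_⟩
    · rw [h.deriv_eq]; simp
    · rw [h.deriv.deriv_eq]; simp
  refine ⟨_, _, _, hb, fun s => (hb.differentiable two_ne_zero s).hasDerivAt,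
    fun s => (hb1.differentiable one_ne_zero s).hasDerivAt,
    ⟨max M₁ M₂, fun s => ⟨(hM₁ s).trans (le_max_left _ _), (hM₂ s).trans (le_max_right _ _)⟩⟩,
    fun s h0 h1 => hev ?_, fun s h => hev ?_⟩
  · filter_upwards [Ioo_mem_nhds (show -1 < s by linarith) h1] with t ht
    rw [b.one_of_mem_closedBall]
    · simp
    · rw [Metric.mem_closedBall, Real.dist_eq, sub_zero, abs_le]
      exact ⟨ht.1.le, ht.2.le⟩
  · filter_upwards [Ioi_mem_nhds h] with t ht
    have : b t = 0 := by
      by_contra h'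
      have : t ∈ Function.support b := h'
      rw [b.support_eq, Metric.mem_ball, Real.dist_eq, sub_zero, abs_lt] at this
      exact absurd this.2 (not_lt.2 (le_of_lt ht))
    simp [this]

theorem IsTail.hasCompactSupport_mul {c₀ : ℝ} {G : ℝ → ℂ} (hG : IsTail c₀ G) (f : E3 → ℂ) :
    HasCompactSupport (fun x : E3 => G (‖x‖ ^ 2) * f x) := by
  obtain ⟨S, hS⟩ := hG.right
  exact hasCompactSupport_of_norm_sq (S := S) fun x hx => by simp [hS _ hx]

theorem IsTail.eq_zero {c₀ : ℝ} {G : ℝ → ℂ} (hG : IsTail c₀ G) {s : ℝ} (hs : s ≤ c₀) : G s = 0 := by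
  obtain ⟨c, hc, h⟩ := hG.left
  exact h s (hs.trans_lt hc)

theorem IsTail.integrable {c₀ : ℝ} {G : ℝ → ℂ} (hG : IsTail c₀ G) {v : E3 → ℂ} (hv : Continuous v)
    {f : E3 → ℂ} (hf : Continuous f) : Integrable (fun x : E3 => v x * (G (‖x‖ ^ 2) * f x)) :=
  (hv.mul ((hG.contDiff.continuous.comp (continuous_norm.pow 2)).mul
    hf)).integrable_of_hasCompactSupport (hG.hasCompactSupport_mul f).mul_left

theorem integral_helmholtz_radial {k R : ℝ} {v : E3 → ℂ} (hv : ContDiff ℝ 2 v)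
    (hH : ∀ x, R < ‖x‖ → lap v x + (k : ℂ) ^ 2 * v x = 0) (a : E3) (l : ℕ)
    (IH : ∀ i < l, ∀ G, IsTail (R ^ 2) G → ∫ x, v x * (G (‖x‖ ^ 2) * linForm a x ^ i) = 0)
    {F F₁ F₂ : ℝ → ℂ} (hF : IsTail (R ^ 2) F) (h1 : ∀ s, 0 ≤ s → HasDerivAt F (F₁ s) s)
    (h2 : ∀ s, 0 ≤ s → HasDerivAt F₁ (F₂ s) s) :
    Integrable (fun x => v x * ((4 * (‖x‖ ^ 2 : ℝ) * F₂ (‖x‖ ^ 2) + (6 + 4 * l) * F₁ (‖x‖ ^ 2)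
        + k ^ 2 * F (‖x‖ ^ 2)) * linForm a x ^ l)) ∧
    ∫ x, v x * ((4 * (‖x‖ ^ 2 : ℝ) * F₂ (‖x‖ ^ 2) + (6 + 4 * l) * F₁ (‖x‖ ^ 2)
        + k ^ 2 * F (‖x‖ ^ 2)) * linForm a x ^ l) = 0 := by
  set ψ : E3 → ℂ := fun x => F (‖x‖ ^ 2) * linForm a x ^ l with hψ
  have hψ2 : ContDiff ℝ 2 ψ :=
    (contDiff_comp_norm_sq hF.contDiff).mul ((contDiff_linForm a).pow l)
  have hψc : HasCompactSupport ψ := hF.hasCompactSupport_mul _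
  have hlapc : HasCompactSupport (lap ψ) := by
    have : lap ψ = ∑ j, pder j (pder j ψ) := by ext x; simp [lap]
    rw [this]
    simp only [Fin.sum_univ_three]
    have h := fun j => hasCompactSupport_pder (hasCompactSupport_pder hψc j) j
    exact ((h 0).add (h 1)).add (h 2)
  have hI1 : Integrable (fun x => v x * lap ψ x) :=
    (hv.continuous.mul (continuous_lap hψ2)).integrable_of_hasCompactSupport hlapc.mul_left
  have hI2 : Integrable (fun x => lap v x * ψ x) :=
    ((continuous_lap hv).mul hψ2.continuous).integrable_of_hasCompactSupport hψc.mul_left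
  set c : ℂ := l * ((l - 1 : ℕ) : ℂ) * (‖a‖ ^ 2 : ℝ) with hc
  have hI3 : Integrable (fun x => c * (v x * (F (‖x‖ ^ 2) * linForm a x ^ (l - 2)))) :=
    (hF.integrable hv.continuous
      ((contDiff_linForm a (n := 0)).continuous.pow (l - 2))).const_mul c
  have hpt : (fun x => v x * ((4 * (‖x‖ ^ 2 : ℝ) * F₂ (‖x‖ ^ 2) + (6 + 4 * l) * F₁ (‖x‖ ^ 2)
        + k ^ 2 * F (‖x‖ ^ 2)) * linForm a x ^ l)) = fun x => v x * lap ψ x - lap v x * ψ x -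
        c * (v x * (F (‖x‖ ^ 2) * linForm a x ^ (l - 2))) := by
    ext x
    rw [hψ, lap_radial_mul_pow h1 h2]
    have : lap v x * F (‖x‖ ^ 2) = -(k ^ 2 * v x) * F (‖x‖ ^ 2) := by
      by_cases hx : R < ‖x‖
      · rw [eq_neg_of_add_eq_zero_left (hH x hx)]
      · rw [hF.eq_zero (by gcongr; exact not_lt.1 hx)]; simp
    linear_combination (linForm a x ^ l) * this
  rw [hpt]
  refine ⟨(hI1.sub hI2).sub hI3, ?_⟩
  have h4 : ∫ x, c * (v x * (F (‖x‖ ^ 2) * linForm a x ^ (l - 2))) = 0 := by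
    rw [integral_const_mul]
    by_cases hl : 2 ≤ l
    · rw [IH (l - 2) (by omega) F hF, mul_zero]
    · have : c = 0 := by
        rw [hc]
        interval_cases l <;> simp
      rw [this, zero_mul]
  have h5 := integral_sub (hI1.sub hI2) hI3
  have h6 := integral_sub hI1 hI2
  simp only [Pi.sub_apply] at h5 h6
  rw [h5, h6, h4, integral_mul_lap hv hψ2 hψc]
  simp

/-- A solution of the radial equation of degree `l` with the decay of an outgoing or incoming
wave. -/
structure IsRadialWave (k c₀ : ℝ) (l : ℕ) (Y Y₁ Y₂ : ℝ → ℂ) : Prop where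
  hasDerivAt : ∀ s, 0 < s → HasDerivAt Y (Y₁ s) s
  hasDerivAt₁ : ∀ s, 0 < s → HasDerivAt Y₁ (Y₂ s) s
  contDiffAt : ∀ s, 0 < s → ContDiffAt ℝ 2 Y s
  ode : ∀ s, 0 < s → 4 * s * Y₂ s + (6 + 4 * l) * Y₁ s + k ^ 2 * Y s = 0
  bound : ∃ C, ∀ s, c₀ ≤ s → ‖Y s‖ * √s ^ (l + 1) ≤ C ∧ ‖Y₁ s‖ * √s ^ (l + 2) ≤ C

theorem IsTail.exists_primitive {c₀ : ℝ} {m : ℝ → ℂ} (hm : IsTail c₀ m) :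
    ∃ η : ℝ → ℂ, ContDiff ℝ 2 η ∧ (∀ s, HasDerivAt η (m s) s) ∧ (∃ c, c₀ < c ∧ ∀ s < c, η s = 0) ∧
      ∃ M, ∀ s, ‖η s‖ ≤ M := by
  obtain ⟨c, hc, h0⟩ := hm.left
  obtain ⟨S, hS⟩ := hm.right
  have hmc := hm.contDiff.continuous
  have hmcs : HasCompactSupport m := by
    refine HasCompactSupport.intro (isCompact_Icc (a := c) (b := S)) fun s hs => ?_
    rw [mem_Icc, not_and_or, not_le, not_le] at hs
    exact hs.elim (h0 s) fun h => hS s h.le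
  have hd : ∀ s, HasDerivAt (fun s => ∫ t in c..s, m t) (m s) s := fun s =>
    intervalIntegral.integral_hasDerivAt_right (hmc.intervalIntegrable _ _)
      (hmc.stronglyMeasurableAtFilter _ _) hmc.continuousAt
  refine ⟨fun s => ∫ t in c..s, m t, ?_, hd, ⟨c, hc, fun s hs => ?_⟩, ∫ t, ‖m t‖, fun s => ?_⟩
  · rw [show (2 : WithTop ℕ∞) = 1 + 1 by norm_num, contDiff_succ_iff_deriv]
    refine ⟨fun s => (hd s).differentiableAt, by simp, ?_⟩
    rw [show deriv (fun s => ∫ t in c..s, m t) = m from funext fun s => (hd s).deriv]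
    exact hm.contDiff.of_le (by norm_num)
  · change ∫ t in c..s, m t = 0
    rw [intervalIntegral.integral_symm, intervalIntegral.integral_of_le hs.le,
      setIntegral_congr_ae (g := fun _ => (0 : ℂ)) measurableSet_Ioc]
    · simp
    · have : ∀ᵐ t : ℝ, t ≠ c := by simp [ae_iff]
      filter_upwards [this] with t ht h
      exact h0 t (lt_of_le_of_ne h.2 ht)
  · rw [intervalIntegral.norm_intervalIntegral_eq]
    refine (norm_integral_le_integral_norm _).trans ?_
    exact setIntegral_le_integral (hmc.norm.integrable_of_hasCompactSupport hmcs.norm)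
      (Eventually.of_forall fun t => norm_nonneg _)

theorem norm_radial_error_le {C M Mχ A r ρ : ℝ} {l : ℕ} {Y Y₁ η χ₁ χ₂ t v : ℂ}
    (hρ : 1 ≤ ρ) (hr : ρ ≤ r) (hr2 : r ≤ 2 * ρ) (hY : ‖Y‖ * r ^ (l + 1) ≤ C)
    (hY₁ : ‖Y₁‖ * r ^ (l + 2) ≤ C) (hη : ‖η‖ ≤ M) (hχ₁ : ‖χ₁‖ ≤ Mχ) (hχ₂ : ‖χ₂‖ ≤ Mχ)
    (hA : 0 ≤ A) (ht : ‖t‖ ≤ A * r) :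
    ‖v * (η * (4 * (r ^ 2 : ℝ) * (2 * Y₁ * (χ₁ / (ρ ^ 2 : ℝ)) + Y * (χ₂ / (ρ ^ 4 : ℝ)))
      + (6 + 4 * l) * Y * (χ₁ / (ρ ^ 2 : ℝ))) * t ^ l)‖ ≤
      M * Mχ * C * A ^ l * (22 + 4 * l) / ρ ^ 2 * ‖v‖ := by
  have hr0 : 0 < r := by linarith
  have hρ0 : 0 < ρ := by linarith
  have hC : 0 ≤ C := le_trans (by positivity) hY
  have hM : 0 ≤ M := (norm_nonneg _).trans hη
  have hMχ : 0 ≤ Mχ := (norm_nonneg _).trans hχ₁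
  have e0 : ‖(6 + 4 * l : ℂ)‖ = 6 + 4 * l := by
    rw [show (6 + 4 * l : ℂ) = ((6 + 4 * l : ℝ) : ℂ) by push_cast; ring, Complex.norm_real,
      Real.norm_of_nonneg (by positivity)]
  have e1 : ‖(4 * (r ^ 2 : ℝ) * (2 * Y₁ * (χ₁ / (ρ ^ 2 : ℝ)) + Y * (χ₂ / (ρ ^ 4 : ℝ)))
      + (6 + 4 * l) * Y * (χ₁ / (ρ ^ 2 : ℝ)) : ℂ)‖ ≤
      4 * r ^ 2 * (2 * ‖Y₁‖ * (Mχ / ρ ^ 2) + ‖Y‖ * (Mχ / ρ ^ 4)) +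
        (6 + 4 * l) * ‖Y‖ * (Mχ / ρ ^ 2) := by
    refine (norm_add_le _ _).trans (add_le_add ?_ ?_)
    · rw [norm_mul, norm_mul, Complex.norm_real, Real.norm_of_nonneg (by positivity)]
      norm_num
      gcongr
      refine (norm_add_le _ _).trans ?_
      simp only [norm_mul, norm_div, norm_pow, Complex.norm_real, Real.norm_of_nonneg hρ0.le]
      norm_num
      gcongr
    · rw [norm_mul, norm_mul, e0, norm_div, Complex.norm_real, Real.norm_of_nonneg (by positivity)]
      gcongr
  have e2 : (4 * r ^ 2 * (2 * ‖Y₁‖ * (Mχ / ρ ^ 2) + ‖Y‖ * (Mχ / ρ ^ 4)) +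
        (6 + 4 * l) * ‖Y‖ * (Mχ / ρ ^ 2)) * r ^ l ≤ Mχ * C * (22 + 4 * l) / ρ ^ 2 := by
    have hYl : ‖Y‖ * r ^ l ≤ C := by
      refine le_trans ?_ hY
      gcongr 1
      exact pow_le_pow_right₀ (by linarith) (by omega)
    calc _ = (8 * (‖Y₁‖ * r ^ (l + 2)) + (r / ρ ^ 2) * (4 * (‖Y‖ * r ^ (l + 1))) +
          (6 + 4 * l) * (‖Y‖ * r ^ l)) * (Mχ / ρ ^ 2) := by
          field_simp
          ring
      _ ≤ (8 * C + 2 * (4 * C) + (6 + 4 * l) * C) * (Mχ / ρ ^ 2) := by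
          gcongr
          rw [div_le_iff₀ (by positivity)]
          nlinarith
      _ = _ := by ring
  rw [norm_mul, norm_mul, norm_mul, norm_pow]
  calc _ ≤ ‖v‖ * (M * (4 * r ^ 2 * (2 * ‖Y₁‖ * (Mχ / ρ ^ 2) + ‖Y‖ * (Mχ / ρ ^ 4)) +
        (6 + 4 * l) * ‖Y‖ * (Mχ / ρ ^ 2)) * (A * r) ^ l) := by gcongr
    _ = ‖v‖ * (M * ((4 * r ^ 2 * (2 * ‖Y₁‖ * (Mχ / ρ ^ 2) + ‖Y‖ * (Mχ / ρ ^ 4)) +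
        (6 + 4 * l) * ‖Y‖ * (Mχ / ρ ^ 2)) * r ^ l) * A ^ l) := by rw [mul_pow]; ring
    _ ≤ ‖v‖ * (M * (Mχ * C * (22 + 4 * l) / ρ ^ 2) * A ^ l) := by gcongr
    _ = _ := by ring

theorem hasDerivAt_zero_of_lt {f : ℝ → ℂ} {c s : ℝ} (h : ∀ t < c, f t = 0) (hs : s < c) :
    HasDerivAt f 0 s := by
  refine (hasDerivAt_const s (0 : ℂ)).congr_of_eventuallyEq ?_
  filter_upwards [Iio_mem_nhds hs] with t ht
  exact h t ht

theorem integral_radial_step {k R : ℝ} (hR : 0 < R) {v : E3 → ℂ} (hv : ContDiff ℝ 2 v)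
    (hH : ∀ x, R < ‖x‖ → lap v x + (k : ℂ) ^ 2 * v x = 0) (hdec : ShellDecay v) (a : E3) (l : ℕ)
    (IH : ∀ i < l, ∀ G, IsTail (R ^ 2) G → ∫ x, v x * (G (‖x‖ ^ 2) * linForm a x ^ i) = 0)
    {Y Y₁ Y₂ : ℝ → ℂ} (hY : IsRadialWave k (R ^ 2) l Y Y₁ Y₂) {m : ℝ → ℂ}
    (hm : IsTail (R ^ 2) m) :
    Integrable (fun x => v x * ((4 * (‖x‖ ^ 2 : ℝ) * (2 * (Y₁ (‖x‖ ^ 2) * m (‖x‖ ^ 2)) +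
      Y (‖x‖ ^ 2) * deriv m (‖x‖ ^ 2)) + (6 + 4 * l) * (Y (‖x‖ ^ 2) * m (‖x‖ ^ 2))) *
      linForm a x ^ l)) ∧
    ∫ x, v x * ((4 * (‖x‖ ^ 2 : ℝ) * (2 * (Y₁ (‖x‖ ^ 2) * m (‖x‖ ^ 2)) +
      Y (‖x‖ ^ 2) * deriv m (‖x‖ ^ 2)) + (6 + 4 * l) * (Y (‖x‖ ^ 2) * m (‖x‖ ^ 2))) *
      linForm a x ^ l) = 0 := by
  obtain ⟨η, hη2, hη, ⟨c₁, hc₁, hηc⟩, M, hM⟩ := hm.exists_primitive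
  obtain ⟨χ, χ₁, χ₂, hχ2, hχ, hχ', ⟨Mχ, hMχ⟩, hχl, hχr⟩ := exists_cutoff
  obtain ⟨c₂, hc₂, hmc⟩ := hm.left
  obtain ⟨S, hS⟩ := hm.right
  obtain ⟨C, hC⟩ := hY.bound
  set c := min c₁ c₂ with hc
  have hRc : R ^ 2 < c := lt_min hc₁ hc₂
  have hc0 : 0 < c := (by positivity : 0 < R ^ 2).trans hRc
  replace hηc : ∀ s < c, η s = 0 := fun s hs => hηc s (hs.trans_le (min_le_left _ _))
  replace hmc : ∀ s < c, m s = 0 := fun s hs => hmc s (hs.trans_le (min_le_right _ _))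
  have hm'c : ∀ s < c, deriv m s = 0 := fun s hs => (hasDerivAt_zero_of_lt hmc hs).deriv
  have hm1 : ContDiff ℝ 1 (deriv m) := hm.contDiff.deriv' (n := 1)
  have hmd : ∀ s, HasDerivAt m (deriv m s) s := fun s =>
    (hm.contDiff.differentiable two_ne_zero s).hasDerivAt
  have hcc : Continuous (fun s => Y₁ s * m s) ∧ Continuous (fun s => Y s * m s) ∧
      Continuous (fun s => Y s * deriv m s) := by
    simp only [← contDiff_zero (𝕜 := ℝ)]
    have hY0 : ∀ s, c ≤ s → ContDiffAt ℝ 0 Y s := fun s hs =>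
      (hY.contDiffAt s (hc0.trans_le hs)).of_le (by norm_num)
    refine ⟨contDiff_mul_of_eq_zero (fun s hs => ?_) (hm.contDiff.of_le (by norm_num)) hmc,
      contDiff_mul_of_eq_zero hY0 (hm.contDiff.of_le (by norm_num)) hmc,
      contDiff_mul_of_eq_zero hY0 (hm1.of_le (by norm_num)) hm'c⟩
    refine contDiffAt_zero.2 ⟨Ioi 0, Ioi_mem_nhds (hc0.trans_le hs), fun t ht => ?_⟩
    exact (hY.hasDerivAt₁ t ht).continuousAt.continuousWithinAt
  obtain ⟨hcc1, hcc2, hcc3⟩ := hcc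
  set Mn : E3 → ℂ := fun x => v x * ((4 * (‖x‖ ^ 2 : ℝ) * (2 * (Y₁ (‖x‖ ^ 2) * m (‖x‖ ^ 2)) +
      Y (‖x‖ ^ 2) * deriv m (‖x‖ ^ 2)) + (6 + 4 * l) * (Y (‖x‖ ^ 2) * m (‖x‖ ^ 2))) *
      linForm a x ^ l) with hMn
  have hm'S : ∀ s, S < s → deriv m s = 0 := fun s hs => by
    have : m =ᶠ[nhds s] fun _ => 0 := by
      filter_upwards [Ioi_mem_nhds hs] with t ht
      exact hS t (le_of_lt ht)
    rw [this.deriv_eq]; simp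
  have hMni : Integrable Mn := by
    refine Continuous.integrable_of_hasCompactSupport ?_ ?_
    · have hn : Continuous fun x : E3 => ‖x‖ ^ 2 := continuous_norm.pow 2
      have h1 := hcc1.comp hn
      have h2 := hcc2.comp hn
      have h3 := hcc3.comp hn
      have h4 := (contDiff_linForm a (n := 0)).continuous
      simp only [Function.comp_def] at h1 h2 h3
      have h5 := hv.continuous
      fun_prop
    · refine hasCompactSupport_of_norm_sq (S := S + 1) fun x hx => ?_
      simp [hMn, hS _ (by linarith : S ≤ ‖x‖ ^ 2), hm'S _ (by linarith : S < ‖x‖ ^ 2)]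
  refine ⟨hMni, ?_⟩
  set K := M * Mχ * C * ‖a‖ ^ l * (22 + 4 * l) with hK
  have hM0 : 0 ≤ M := (norm_nonneg _).trans (hM 0)
  have hMχ0 : 0 ≤ Mχ := (norm_nonneg _).trans (hMχ 0).1
  have hC0 : 0 ≤ C := le_trans (by positivity) (hC _ le_rfl).1
  have hK0 : 0 ≤ K := by positivity
  have hmain : ∀ ρ : ℝ, 1 ≤ ρ → max S 0 + 1 ≤ ρ → ‖∫ x, Mn x‖ ≤
      K / ρ ^ 2 * ∫ x in {x : E3 | ρ ≤ ‖x‖ ∧ ‖x‖ ≤ 2 * ρ}, ‖v x‖ := by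
    intro ρ hρ1 hρS
    have hρ0 : 0 < ρ := by linarith
    have hSρ : S < ρ ^ 2 := by nlinarith [le_max_left S 0, le_max_right S 0]
    have hq : ∀ s : ℝ, HasDerivAt (fun s : ℝ => s / ρ ^ 2) (1 / ρ ^ 2) s := fun s =>
      (hasDerivAt_id s).div_const _
    have hX : ∀ s, HasDerivAt (fun s => χ (s / ρ ^ 2)) (χ₁ (s / ρ ^ 2) / (ρ ^ 2 : ℝ)) s := by
      intro s
      refine ((hχ _).scomp s (hq s)).congr_deriv ?_
      rw [Complex.real_smul]; push_cast; ring
    have hX' : ∀ s, HasDerivAt (fun s => χ₁ (s / ρ ^ 2) / ((ρ ^ 2 : ℝ) : ℂ))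
        (χ₂ (s / ρ ^ 2) / (ρ ^ 4 : ℝ)) s := by
      intro s
      refine (((hχ' _).scomp s (hq s)).div_const _).congr_deriv ?_
      rw [Complex.real_smul]; push_cast; field_simp
    set h : ℝ → ℂ := fun s => η s * χ (s / ρ ^ 2) with hh
    set h₁ : ℝ → ℂ := fun s => m s * χ (s / ρ ^ 2) + η s * (χ₁ (s / ρ ^ 2) / (ρ ^ 2 : ℝ)) with hh₁
    set h₂ : ℝ → ℂ := fun s => deriv m s * χ (s / ρ ^ 2) + m s * (χ₁ (s / ρ ^ 2) / (ρ ^ 2 : ℝ)) +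
      (m s * (χ₁ (s / ρ ^ 2) / (ρ ^ 2 : ℝ)) + η s * (χ₂ (s / ρ ^ 2) / (ρ ^ 4 : ℝ))) with hh₂
    have hd1 : ∀ s, HasDerivAt h (h₁ s) s := fun s => (hη s).mul (hX s)
    have hd2 : ∀ s, HasDerivAt h₁ (h₂ s) s := fun s =>
      ((hmd s).fun_mul (hX s)).fun_add ((hη s).fun_mul (hX' s))
    have hz : ∀ s < c, h s = 0 ∧ h₁ s = 0 ∧ h₂ s = 0 := fun s hs => by
      simp [hh, hh₁, hh₂, hηc s hs, hmc s hs, hm'c s hs]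
    have hhC : ContDiff ℝ 2 h := hη2.mul (hχ2.comp (contDiff_id.div_const _))
    have hF : IsTail (R ^ 2) (fun s => Y s * h s) := by
      refine ⟨contDiff_mul_of_eq_zero (fun s hs => hY.contDiffAt s (hc0.trans_le hs)) hhC
        fun s hs => (hz s hs).1, ⟨c, hRc, fun s hs => by simp [(hz s hs).1]⟩, 5 * ρ ^ 2,
        fun s hs => ?_⟩
      have : 4 < s / ρ ^ 2 := by rw [lt_div_iff₀ (by positivity)]; nlinarith
      simp [hh, (hχr _ this).1]
    obtain ⟨hDi, hD0⟩ := integral_helmholtz_radial hv hH a l IH hF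
      (F₁ := fun s => Y₁ s * h s + Y s * h₁ s)
      (F₂ := fun s => (Y₂ s * h s + Y₁ s * h₁ s) + (Y₁ s * h₁ s + Y s * h₂ s))
      (fun s _ => by
        rcases lt_or_ge s c with hs | hs
        · refine (hasDerivAt_zero_of_lt (c := c) (fun t ht => by simp [(hz t ht).1])
            hs).congr_deriv ?_
          simp [hz s hs]
        · exact (hY.hasDerivAt s (hc0.trans_le hs)).mul (hd1 s))
      (fun s _ => by
        rcases lt_or_ge s c with hs | hs
        · refine (hasDerivAt_zero_of_lt (c := c) (fun t ht => by simp [hz t ht])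
            hs).congr_deriv ?_
          simp [hz s hs]
        · exact ((hY.hasDerivAt₁ s (hc0.trans_le hs)).fun_mul (hd1 s)).fun_add
            ((hY.hasDerivAt s (hc0.trans_le hs)).fun_mul (hd2 s)))
    set D : E3 → ℂ := _
    change Integrable D at hDi
    change ∫ x, D x = 0 at hD0
    have hSm : MeasurableSet {x : E3 | ρ ≤ ‖x‖ ∧ ‖x‖ ≤ 2 * ρ} :=
      ((isClosed_le continuous_const continuous_norm).inter
        (isClosed_le continuous_norm continuous_const)).measurableSet
    have hbd : ∀ x, ‖Mn x - D x‖ ≤ {x : E3 | ρ ≤ ‖x‖ ∧ ‖x‖ ≤ 2 * ρ}.indicator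
        (fun x => K / ρ ^ 2 * ‖v x‖) x := by
      intro x
      have hnn : 0 ≤ {x : E3 | ρ ≤ ‖x‖ ∧ ‖x‖ ≤ 2 * ρ}.indicator
        (fun x => K / ρ ^ 2 * ‖v x‖) x := indicator_nonneg (fun y _ => by positivity) _
      rcases lt_or_ge (‖x‖ ^ 2) c with hs | hs
      · have : Mn x - D x = 0 := by
          simp only [hMn, D, hmc _ hs, hm'c _ hs, hz _ hs]
          ring
        rwa [this, norm_zero]
      have hs0 : 0 < ‖x‖ ^ 2 := hc0.trans_le hs
      have hode := hY.ode _ hs0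
      rcases lt_or_ge ‖x‖ ρ with hxρ | hxρ
      · have : ‖x‖ ^ 2 / ρ ^ 2 < 1 := by
          rw [div_lt_one (by positivity)]; gcongr
        obtain ⟨e1, e2, e3⟩ := hχl _ (by positivity) this
        have : Mn x - D x = 0 := by
          simp only [hMn, D, hh, hh₁, hh₂, e1, e2, e3]
          linear_combination (-v x * linForm a x ^ l * η (‖x‖ ^ 2)) * hode
        rwa [this, norm_zero]
      have hSs : S < ‖x‖ ^ 2 := hSρ.trans_le (by gcongr)
      have e4 := hS _ hSs.le
      have e5 := hm'S _ hSs
      have hdiff : Mn x - D x = -(v x * (η (‖x‖ ^ 2) * (4 * (‖x‖ ^ 2 : ℝ) *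
          (2 * Y₁ (‖x‖ ^ 2) * (χ₁ (‖x‖ ^ 2 / ρ ^ 2) / (ρ ^ 2 : ℝ)) +
            Y (‖x‖ ^ 2) * (χ₂ (‖x‖ ^ 2 / ρ ^ 2) / (ρ ^ 4 : ℝ)))
          + (6 + 4 * l) * Y (‖x‖ ^ 2) * (χ₁ (‖x‖ ^ 2 / ρ ^ 2) / (ρ ^ 2 : ℝ))) *
            linForm a x ^ l)) := by
        simp only [hMn, D, hh, hh₁, hh₂, e4, e5]
        linear_combination (-v x * linForm a x ^ l * η (‖x‖ ^ 2) * χ (‖x‖ ^ 2 / ρ ^ 2)) * hode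
      rcases lt_or_ge (2 * ρ) ‖x‖ with hx2 | hx2
      · have : 4 < ‖x‖ ^ 2 / ρ ^ 2 := by
          rw [lt_div_iff₀ (by positivity)]; nlinarith
        obtain ⟨e1, e2, e3⟩ := hχr _ this
        rw [hdiff, e2, e3]
        simpa using hnn
      have hCx := hC (‖x‖ ^ 2) (hRc.le.trans hs)
      rw [Real.sqrt_sq (norm_nonneg x)] at hCx
      rw [indicator_of_mem (show x ∈ {x : E3 | ρ ≤ ‖x‖ ∧ ‖x‖ ≤ 2 * ρ} from ⟨hxρ, hx2⟩), hdiff,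
        norm_neg]
      exact norm_radial_error_le hρ1 hxρ hx2 hCx.1 hCx.2 (hM _) (hMχ _).1 (hMχ _).2
        (norm_nonneg a) (norm_linForm_le a x)
    have hvi : IntegrableOn (fun x => K / ρ ^ 2 * ‖v x‖) {x : E3 | ρ ≤ ‖x‖ ∧ ‖x‖ ≤ 2 * ρ} := by
      refine ((continuous_const.mul hv.continuous.norm).continuousOn.integrableOn_compact
        (isCompact_closedBall (0 : E3) (2 * ρ))).mono_set fun x hx => ?_
      exact mem_closedBall_zero_iff.2 hx.2
    calc ‖∫ x, Mn x‖ = ‖∫ x, (Mn x - D x)‖ := by rw [integral_sub hMni hDi, hD0, sub_zero]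
      _ ≤ ∫ x, {x : E3 | ρ ≤ ‖x‖ ∧ ‖x‖ ≤ 2 * ρ}.indicator (fun x => K / ρ ^ 2 * ‖v x‖) x :=
          norm_integral_le_of_norm_le ((integrable_indicator_iff hSm).2 hvi)
            (Eventually.of_forall hbd)
      _ = _ := by rw [integral_indicator hSm, integral_const_mul]
  rw [← norm_le_zero_iff]
  refine le_of_forall_pos_le_add fun ε hε => ?_
  rw [zero_add]
  obtain ⟨ρ₀, hρ₀, hρ⟩ := hdec (ε / (K + 1)) (by positivity)
  set ρ := max ρ₀ (max 1 (max S 0 + 1))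
  have hρ1 : 1 ≤ ρ := (le_max_left _ _).trans (le_max_right _ _)
  have hρ0 : 0 < ρ := by linarith
  calc _ ≤ K / ρ ^ 2 * ∫ x in {x : E3 | ρ ≤ ‖x‖ ∧ ‖x‖ ≤ 2 * ρ}, ‖v x‖ :=
        hmain ρ hρ1 ((le_max_right _ _).trans (le_max_right _ _))
    _ ≤ K / ρ ^ 2 * (ε / (K + 1) * ρ ^ 2) := by
        gcongr; exact hρ ρ (le_max_left _ _)
    _ = K / (K + 1) * ε := by field_simp
    _ ≤ 1 * ε := by gcongr; rw [div_le_one (by positivity)]; linarith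
    _ = ε := one_mul ε

theorem isRadialWave_radialSol (k : ℝ) {c₀ : ℝ} (hc₀ : 0 < c₀) (l : ℕ) :
    IsRadialWave k c₀ l (radialSol k l) (radialSol k (l + 1)) (radialSol k (l + 2)) where
  hasDerivAt _ hs := hasDerivAt_radialSol k l hs
  hasDerivAt₁ _ hs := hasDerivAt_radialSol k (l + 1) hs
  contDiffAt _ hs := contDiffAt_radialSol k l hs
  ode s hs := radialSol_ode k l hs.ne'
  bound := by
    obtain ⟨C, hC⟩ := exists_norm_radialSol_le k hc₀ l
    obtain ⟨D, hD⟩ := exists_norm_radialSol_le k hc₀ (l + 1)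
    exact ⟨max C D, fun s hs => ⟨(hC s hs).trans (le_max_left _ _),
      (hD s hs).trans (le_max_right _ _)⟩⟩

theorem hasDerivAt_conj {f : ℝ → ℂ} {f' : ℂ} {s : ℝ} (h : HasDerivAt f f' s) :
    HasDerivAt (fun s => (starRingEnd ℂ) (f s)) ((starRingEnd ℂ) f') s :=
  (Complex.conjCLE.toContinuousLinearMap.hasFDerivAt.comp_hasDerivAt s h)

theorem contDiffAt_conj {f : ℝ → ℂ} {n : WithTop ℕ∞} {s : ℝ} (h : ContDiffAt ℝ n f s) :
    ContDiffAt ℝ n (fun s => (starRingEnd ℂ) (f s)) s :=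
  Complex.conjCLE.toContinuousLinearMap.contDiff.contDiffAt.comp s h

theorem IsRadialWave.conj {k c₀ : ℝ} {l : ℕ} {Y Y₁ Y₂ : ℝ → ℂ} (h : IsRadialWave k c₀ l Y Y₁ Y₂) :
    IsRadialWave k c₀ l (fun s => (starRingEnd ℂ) (Y s)) (fun s => (starRingEnd ℂ) (Y₁ s))
      (fun s => (starRingEnd ℂ) (Y₂ s)) where
  hasDerivAt s hs := hasDerivAt_conj (h.hasDerivAt s hs)
  hasDerivAt₁ s hs := hasDerivAt_conj (h.hasDerivAt₁ s hs)
  contDiffAt s hs := contDiffAt_conj (h.contDiffAt s hs)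
  ode s hs := by
    have := congrArg (starRingEnd ℂ) (h.ode s hs)
    simpa only [map_add, map_mul, map_pow, Complex.conj_ofReal, map_ofNat, map_zero,
      map_natCast] using this
  bound := by simpa using h.bound

theorem IsTail.mul_left {c₀ : ℝ} (hc₀ : 0 < c₀) {Y G : ℝ → ℂ} (hG : IsTail c₀ G)
    (hY : ∀ s, 0 < s → ContDiffAt ℝ 2 Y s) : IsTail c₀ (fun s => Y s * G s) := by
  obtain ⟨c, hc, h⟩ := hG.left
  obtain ⟨S, hS⟩ := hG.right
  exact ⟨contDiff_mul_of_eq_zero (fun s hs => hY s (hc₀.trans (hc.trans_le hs))) hG.contDiff h,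
    ⟨c, hc, fun s hs => by simp [h s hs]⟩, S, fun s hs => by simp [hS s hs]⟩

theorem contDiffAt_radialWronskian (k : ℝ) (l : ℕ) {s : ℝ} (hs : 0 < s) {n : WithTop ℕ∞} :
    ContDiffAt ℝ n (radialWronskian k l) s := by
  have h := fun l => contDiffAt_radialSol k l hs (n := n)
  exact ((h l).mul (contDiffAt_conj (h (l + 1)))).sub ((contDiffAt_conj (h l)).mul (h (l + 1)))

theorem integral_mul_radial_mul_pow_eq_zero {k R : ℝ} (hk : k ≠ 0) (hR : 0 < R) {v : E3 → ℂ}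
    (hv : ContDiff ℝ 2 v) (hH : ∀ x, R < ‖x‖ → lap v x + (k : ℂ) ^ 2 * v x = 0)
    (hdec : ShellDecay v) (a : E3) (l : ℕ) {G : ℝ → ℂ} (hG : IsTail (R ^ 2) G) :
    ∫ x, v x * (G (‖x‖ ^ 2) * linForm a x ^ l) = 0 := by
  induction l using Nat.strong_induction_on generalizing G with
  | _ l IH =>
  have hR2 : 0 < R ^ 2 := by positivity
  have hY := isRadialWave_radialSol k hR2 l
  set n : ℝ → ℂ := fun s => -(4 * s * radialWronskian k l s)⁻¹ * G s with hn
  have hne : ∀ s : ℝ, 0 < s → (4 * s * radialWronskian k l s : ℂ) ≠ 0 := fun s hs =>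
    mul_ne_zero (mul_ne_zero (by norm_num) (by exact_mod_cast hs.ne'))
      (radialWronskian_ne_zero hk l hs)
  have hnT : IsTail (R ^ 2) n := hG.mul_left hR2 fun s hs =>
    (((contDiffAt_const.mul Complex.ofRealCLM.contDiff.contDiffAt).mul
      (contDiffAt_radialWronskian k l hs)).inv (hne s hs)).neg
  obtain ⟨h1i, h1⟩ := integral_radial_step hR hv hH hdec a l (fun i hi G hG => IH i hi hG) hY
    (hnT.mul_left hR2 hY.conj.contDiffAt)
  obtain ⟨h2i, h2⟩ := integral_radial_step hR hv hH hdec a l (fun i hi G hG => IH i hi hG) hY.conj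
    (hnT.mul_left hR2 hY.contDiffAt)
  have h3 := integral_sub h1i h2i
  rw [h1, h2, sub_zero] at h3
  rw [← h3]
  congr 1
  ext x
  by_cases hx : ‖x‖ ^ 2 ≤ R ^ 2
  · obtain ⟨c, hc, h0⟩ := hnT.left
    have e : ∀ f : ℝ → ℂ, deriv (fun s => f s * n s) (‖x‖ ^ 2) = 0 := fun f =>
      (hasDerivAt_zero_of_lt (c := c) (fun t ht => by simp [h0 t ht]) (hx.trans_lt hc)).deriv
    rw [e, e, hnT.eq_zero hx, hG.eq_zero hx]
    ring
  · have hs : 0 < ‖x‖ ^ 2 := hR2.trans (not_le.1 hx)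
    have hnd := (hnT.contDiff.differentiable two_ne_zero (‖x‖ ^ 2)).hasDerivAt
    rw [((hY.conj.hasDerivAt _ hs).fun_mul hnd).deriv, ((hY.hasDerivAt _ hs).fun_mul hnd).deriv]
    have hGn : G (‖x‖ ^ 2) =
        -(4 * (‖x‖ ^ 2 : ℝ) * radialWronskian k l (‖x‖ ^ 2)) * n (‖x‖ ^ 2) := by
      simp only [hn, neg_mul, mul_neg, neg_neg]
      rw [mul_inv_cancel_left₀ (hne _ hs)]
    rw [hGn, radialWronskian]
    ring

theorem fourier_eq_zero_of_radial {k R : ℝ} (hk : k ≠ 0) (hR : 0 < R) {v : E3 → ℂ}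
    (hv : ContDiff ℝ 2 v) (hH : ∀ x, R < ‖x‖ → lap v x + (k : ℂ) ^ 2 * v x = 0)
    (hdec : ShellDecay v) (a : E3) {G : ℝ → ℂ} (hG : IsTail (R ^ 2) G) :
    ∫ x, Complex.exp (Complex.I * linForm a x) * (v x * G (‖x‖ ^ 2)) = 0 := by
  have hexp : ∀ x, Complex.exp (Complex.I * linForm a x) * (v x * G (‖x‖ ^ 2)) =
      ∑' l : ℕ, (Complex.I ^ l / l.factorial) * (v x * (G (‖x‖ ^ 2) * linForm a x ^ l)) := by
    intro x
    rw [Complex.exp_eq_exp_ℂ, NormedSpace.exp_eq_tsum_div, ← tsum_mul_right]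
    congr 1
    ext l
    rw [mul_pow]
    ring
  simp_rw [hexp]
  obtain ⟨S, hS⟩ := hG.right
  have hi : ∀ l, Integrable (fun x => v x * (G (‖x‖ ^ 2) * linForm a x ^ l)) := fun l =>
    hG.integrable hv.continuous ((contDiff_linForm a (n := 0)).continuous.pow l)
  have h0 : Integrable (fun x => v x * (G (‖x‖ ^ 2) * 1)) :=
    hG.integrable hv.continuous continuous_const
  rw [← integral_tsum_of_summable_integral_norm]
  · simp [integral_const_mul, integral_mul_radial_mul_pow_eq_zero hk hR hv hH hdec a _ hG]
  · exact fun l => (hi l).const_mul _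
  · set T := ‖a‖ * √(max S 0)
    refine Summable.of_nonneg_of_le (fun l => integral_nonneg fun x => norm_nonneg _) (fun l => ?_)
      ((Real.summable_pow_div_factorial T).mul_right (∫ x, ‖v x * (G (‖x‖ ^ 2) * 1)‖))
    rw [← integral_const_mul]
    refine integral_mono ((hi l).const_mul _).norm (h0.norm.const_mul _) fun x => ?_
    simp only [norm_mul, norm_div, norm_pow, Complex.norm_I, one_pow, Complex.norm_natCast,
      mul_one]
    by_cases hx : S ≤ ‖x‖ ^ 2
    · simp [hS _ hx]
    · have hle : ‖linForm a x‖ ≤ T := by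
        refine (norm_linForm_le a x).trans ?_
        refine mul_le_mul_of_nonneg_left (Real.le_sqrt_of_sq_le ?_) (norm_nonneg _)
        exact (not_le.1 hx).le.trans (le_max_left _ _)
      calc _ = ‖linForm a x‖ ^ l / (l.factorial : ℝ) * (‖v x‖ * ‖G (‖x‖ ^ 2)‖) := by ring
        _ ≤ _ := by gcongr

open scoped FourierTransform in
/-- Rellich's lemma. -/
theorem eq_zero_of_shellDecay {k R : ℝ} (hk : k ≠ 0) (hR : 0 < R) {v : E3 → ℂ}
    (hv : ContDiff ℝ 2 v) (hH : ∀ x, R < ‖x‖ → lap v x + (k : ℂ) ^ 2 * v x = 0)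
    (hdec : ShellDecay v) {x : E3} (hx : R < ‖x‖) : v x = 0 := by
  have hx2 : R ^ 2 < ‖x‖ ^ 2 := by gcongr
  set d := ‖x‖ ^ 2 - R ^ 2 with hd
  have hd0 : 0 < d := sub_pos.2 hx2
  let b : ContDiffBump (‖x‖ ^ 2 : ℝ) := ⟨d / 4, d / 2, by linarith, by linarith⟩
  have hb0 : ∀ s, b s ≠ 0 → ‖x‖ ^ 2 - d / 2 < s ∧ s < ‖x‖ ^ 2 + d / 2 := by
    intro s hs
    have : s ∈ Function.support b := hs
    rw [b.support_eq, Metric.mem_ball, Real.dist_eq, abs_lt] at this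
    change -(d / 2) < _ ∧ _ < d / 2 at this
    constructor <;> linarith
  have hG : IsTail (R ^ 2) (fun s => (b s : ℂ)) := by
    refine ⟨Complex.ofRealCLM.contDiff.comp b.contDiff, ⟨‖x‖ ^ 2 - d / 2, by linarith,
      fun s hs => ?_⟩, ‖x‖ ^ 2 + d / 2, fun s hs => ?_⟩
    · by_contra h
      linarith [(hb0 s (by simpa using h)).1]
    · by_contra h
      linarith [(hb0 s (by simpa using h)).2]
  set f : E3 → ℂ := fun x => v x * (b (‖x‖ ^ 2) : ℂ) with hf
  have hfc : Continuous f := hv.continuous.mul (hG.contDiff.continuous.comp (continuous_norm.pow 2))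
  have hfi : Integrable f := by
    have := hG.integrable hv.continuous (continuous_const (y := (1 : ℂ)))
    simpa using this
  have hF : 𝓕 f = 0 := by
    ext w
    rw [Real.fourier_eq']
    have := fourier_eq_zero_of_radial hk hR hv hH hdec ((-2 * π) • w) hG
    rw [Pi.zero_apply, ← this]
    congr 1
    ext y
    rw [smul_eq_mul]
    congr 2
    simp only [linForm, PiLp.inner_apply, PiLp.smul_apply, smul_eq_mul, Complex.ofReal_mul,
      Complex.ofReal_sum, Finset.mul_sum, Finset.sum_mul, RCLike.inner_apply, conj_trivial]
    refine Finset.sum_congr rfl fun i _ => ?_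
    push_cast
    ring
  have h := hfc.fourierInv_fourier_eq hfi (by rw [hF]; exact integrable_zero _ _ _)
  have : f x = 0 := by
    rw [← h, hF, Real.fourierInv_eq']
    simp
  have hb1 : b (‖x‖ ^ 2) = 1 := b.one_of_mem_closedBall (Metric.mem_closedBall_self (by
    change 0 ≤ d / 4; linarith))
  rw [hf] at this
  simpa [hb1] using this

theorem pder_pder_comm {f : E3 → ℂ} (hf : ContDiff ℝ 2 f) (i j : Fin 3) (x : E3) :
    pder i (pder j f) x = pder j (pder i f) x := by
  have hs : IsSymmSndFDerivAt ℝ f x := hf.contDiffAt.isSymmSndFDerivAt (by simp)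
  have hd : DifferentiableAt ℝ (fderiv ℝ f) x :=
    (hf.fderiv_right (m := 1) (by norm_num)).differentiable one_ne_zero x
  have h : ∀ i j, pder i (pder j f) x = fderiv ℝ (fderiv ℝ f) x (e3 i) (e3 j) := fun i j => by
    rw [pder, show pder j f = fun y => fderiv ℝ f y (e3 j) from rfl,
      fderiv_clm_apply hd (differentiableAt_const _)]
    simp
  rw [h, h, hs]

theorem contDiff_conj {f : E3 → ℂ} {n : WithTop ℕ∞} (hf : ContDiff ℝ n f) :
    ContDiff ℝ n (fun x => (starRingEnd ℂ) (f x)) :=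
  Complex.conjCLE.toContinuousLinearMap.contDiff.comp hf

theorem HasCompactSupport.conj {f : E3 → ℂ} (hf : HasCompactSupport f) :
    HasCompactSupport (fun x => (starRingEnd ℂ) (f x)) :=
  hf.comp_left (map_zero _)

theorem re_integral_mul_conj_pder {f : E3 → ℂ} (hf : ContDiff ℝ 1 f) (hc : HasCompactSupport f)
    (j : Fin 3) : (∫ x, f x * (starRingEnd ℂ) (pder j f x)).re = 0 := by
  have h := integral_mul_pder hf (contDiff_conj hf) hc.conj j
  simp_rw [fun x => pder_conj (hf.differentiable one_ne_zero x) j] at h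
  have h2 : ∫ x, pder j f x * (starRingEnd ℂ) (f x) =
      (starRingEnd ℂ) (∫ x, f x * (starRingEnd ℂ) (pder j f x)) := by
    rw [← integral_conj]
    simp [mul_comm]
  rw [h2] at h
  have := congrArg Complex.re h
  simp only [Complex.neg_re, Complex.conj_re] at this
  linarith

theorem integral_norm_sq_le {f : E3 → ℂ} (hf : ContDiff ℝ 1 f) {R : ℝ} (hR : 0 < R)
    (h0 : ∀ x, R < ‖x‖ → f x = 0) (j : Fin 3) :
    ∫ x, ‖f x‖ ^ 2 ≤ 4 * R ^ 2 * ∫ x, ‖pder j f x‖ ^ 2 := by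
  have hc : HasCompactSupport f := HasCompactSupport.intro (isCompact_closedBall 0 R) fun x hx =>
    h0 x (by simpa using hx)
  have hX := contDiff_coord j (n := 1)
  have hp : Continuous (pder j f) := (contDiff_pder (n := 0) hf (by norm_num) j).continuous
  have hi1 : Integrable fun x => ‖f x‖ ^ 2 :=
    (hf.continuous.norm.pow 2).integrable_of_hasCompactSupport (hc.mono fun x hx h => hx (by simp [h]))
  have hi2 : Integrable fun x => ‖pder j f x‖ ^ 2 :=
    (hp.norm.pow 2).integrable_of_hasCompactSupport
      ((hasCompactSupport_pder hc j).mono fun x hx h => hx (by simp [h]))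
  have h := integral_mul_pder (f := fun x : E3 => (x j : ℂ) * f x) (hX.mul hf)
    (g := fun x => (starRingEnd ℂ) (f x)) (contDiff_conj hf) hc.conj j
  have hcc := hc.conj
  have hfc := Complex.continuous_conj.comp hf.continuous
  have hpc := Complex.continuous_conj.comp hp
  have hi3 : Integrable fun x : E3 => (x j : ℂ) * f x * (starRingEnd ℂ) (pder j f x) :=
    ((hX.continuous.mul hf.continuous).mul hpc).integrable_of_hasCompactSupport
      (hasCompactSupport_pder hc j).conj.mul_left
  have hi4 : Integrable fun x : E3 => (f x + x j * pder j f x) * (starRingEnd ℂ) (f x) :=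
    ((hf.continuous.add (hX.continuous.mul hp)).mul hfc).integrable_of_hasCompactSupport
      hcc.mul_left
  have e1 : ∀ x, pder j (fun x => (starRingEnd ℂ) (f x)) x = (starRingEnd ℂ) (pder j f x) :=
    fun x => pder_conj (hf.differentiable one_ne_zero x) j
  have e2 : ∀ x, pder j (fun x : E3 => (x j : ℂ) * f x) x = f x + x j * pder j f x := fun x => by
    rw [pder_mul (hX.differentiable one_ne_zero x) (hf.differentiable one_ne_zero x), pder_coord,
      if_pos rfl, one_mul]
  simp_rw [e1, e2] at h
  obtain ⟨q, hq⟩ : ∃ q : E3 → ℂ, ∀ x, q x = (x j : ℂ) * f x * (starRingEnd ℂ) (pder j f x) +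
      (f x + x j * pder j f x) * (starRingEnd ℂ) (f x) := ⟨_, fun x => rfl⟩
  have hqi : Integrable q := (hi3.add hi4).congr (Eventually.of_forall fun x => (hq x).symm)
  have hs : ∫ x, q x = 0 := by
    simp_rw [hq]
    rw [integral_add hi3 hi4, h]
    ring
  have hre : ∫ x, (q x).re = 0 := by
    have := Complex.reCLM.integral_comp_comm hqi
    rw [hs] at this
    simpa using this
  have hqre : Integrable fun x => (q x).re := hqi.re
  have hpt : ∀ x : E3, ‖f x‖ ^ 2 / 2 - 2 * R ^ 2 * ‖pder j f x‖ ^ 2 ≤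
      (q x).re := by
    intro x
    rw [hq]
    have e3 : ((x j : ℂ) * f x * (starRingEnd ℂ) (pder j f x) +
      (f x + x j * pder j f x) * (starRingEnd ℂ) (f x)).re =
        ‖f x‖ ^ 2 + 2 * (x j * (f x * (starRingEnd ℂ) (pder j f x)).re) := by
      rw [← Complex.normSq_eq_norm_sq]
      simp [Complex.normSq_apply]
      ring
    rw [e3]
    have e4 : |(f x * (starRingEnd ℂ) (pder j f x)).re| ≤ ‖f x‖ * ‖pder j f x‖ :=
      (Complex.abs_re_le_norm _).trans (by rw [norm_mul, RCLike.norm_conj])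
    have e5 : |x j * (f x * (starRingEnd ℂ) (pder j f x)).re| ≤ R * (‖f x‖ * ‖pder j f x‖) := by
      by_cases hx : R < ‖x‖
      · simp [h0 x hx]
      · rw [abs_mul]
        gcongr
        exact (PiLp.norm_apply_le x j).trans (not_lt.1 hx)
    have := (abs_le.1 e5).1
    nlinarith [sq_nonneg (‖f x‖ - 2 * R * ‖pder j f x‖)]
  have hI := integral_mono ((hi1.div_const 2).sub (hi2.const_mul (2 * R ^ 2))) hqre hpt
  rw [hre, integral_sub' (hi1.div_const 2) (hi2.const_mul (2 * R ^ 2)), integral_div,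
    integral_const_mul] at hI
  linarith

theorem re_integral_lap_mul_conj_pder {w : E3 → ℂ} (hw : ContDiff ℝ 2 w)
    (hc : HasCompactSupport w) (i : Fin 3) :
    (∫ x, lap w x * (starRingEnd ℂ) (pder i w x)).re = 0 := by
  have h1 : ∀ j, ContDiff ℝ 1 (pder j w) := fun j => contDiff_pder hw (by norm_num) j
  have h2 : ∀ j, Continuous (pder j (pder j w)) := fun j =>
    (contDiff_pder (n := 0) (h1 j) (by norm_num) j).continuous
  have hi : ∀ j, Integrable fun x => pder j (pder j w) x * (starRingEnd ℂ) (pder i w x) := fun j =>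
    ((h2 j).mul (Complex.continuous_conj.comp (h1 i).continuous)).integrable_of_hasCompactSupport
      ((hasCompactSupport_pder hc i).conj.mul_left)
  have e : ∀ x, lap w x * (starRingEnd ℂ) (pder i w x) =
      ∑ j, pder j (pder j w) x * (starRingEnd ℂ) (pder i w x) := fun x => by
    rw [lap, Finset.sum_mul]
  simp_rw [e]
  rw [integral_finsetSum _ fun j _ => hi j, Complex.re_sum]
  refine Finset.sum_eq_zero fun j _ => ?_
  have h := integral_mul_pder (f := fun x => (starRingEnd ℂ) (pder i w x)) (contDiff_conj (h1 i))
    (h1 j) (hasCompactSupport_pder hc j) j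
  have e1 : ∀ x, pder j (fun x => (starRingEnd ℂ) (pder i w x)) x * pder j w x =
      pder j w x * (starRingEnd ℂ) (pder i (pder j w) x) := fun x => by
    rw [pder_conj ((h1 i).differentiable one_ne_zero x), pder_pder_comm hw, mul_comm]
  simp_rw [e1] at h
  simp_rw [mul_comm (pder j (pder j w) _)]
  rw [h, Complex.neg_re, re_integral_mul_conj_pder (h1 j) (hasCompactSupport_pder hc j), neg_zero]

/-- Unique continuation from infinity, by a Carleman estimate with a linear weight. -/
theorem eq_zero_of_norm_lap_le {v : E3 → ℂ} (hv : ContDiff ℝ 2 v) {R M : ℝ} (hR : 0 < R)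
    (h0 : ∀ x, R < ‖x‖ → v x = 0) (hM : ∀ x, ‖lap v x‖ ≤ M * ‖v x‖) (x : E3) : v x = 0 := by
  obtain ⟨τ, hτ0, hτ⟩ : ∃ τ : ℝ, 0 < τ ∧ M * R < τ := ⟨max (M * R) 0 + 1, by positivity, by
    linarith [le_max_left (M * R) 0]⟩
  set ex : E3 → ℂ := fun x => Complex.exp (τ * x 0) with hex
  have hexc : ContDiff ℝ 2 ex :=
    Complex.contDiff_exp.comp (contDiff_const.mul (contDiff_coord 0))
  have hexp : ∀ j x, pder j ex x = (if 0 = j then (τ : ℂ) else 0) * ex x := by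
    intro j x
    have hd : HasFDerivAt (fun y : E3 => (τ : ℂ) * ((y 0 : ℝ) : ℂ)) _ x :=
      ((contDiff_coord 0 (n := 1)).differentiable one_ne_zero x).hasFDerivAt.const_mul (τ : ℂ)
    have hc := pder_coord 0 j x
    rw [pder] at hc
    rw [pder, hex, (hd.cexp).fderiv]
    simp only [_root_.smul_apply, smul_eq_mul, hc]
    split_ifs  <;> simp_all [mul_comm]
  set w : E3 → ℂ := fun x => ex x * v x with hw
  have hwc : ContDiff ℝ 2 w := hexc.mul hv
  have hw0 : ∀ x, R < ‖x‖ → w x = 0 := fun x hx => by simp [hw, h0 x hx]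
  have hc : HasCompactSupport w := HasCompactSupport.intro (isCompact_closedBall 0 R) fun x hx =>
    hw0 x (by simpa using hx)
  have d2 : (2 : WithTop ℕ∞) ≠ 0 := by norm_num
  have hpw : ∀ j, pder j w = fun x => ex x * ((if 0 = j then (τ : ℂ) else 0) * v x + pder j v x) :=
    fun j => by
    ext x
    rw [hw, pder_mul (hexc.differentiable d2 x) (hv.differentiable d2 x), hexp]
    ring
  have hpp : ∀ j x, ex x * pder j (pder j v) x = pder j (pder j w) x -
      2 * (if 0 = j then (τ : ℂ) else 0) * pder j w x + (if 0 = j then (τ : ℂ) else 0) ^ 2 * w x := by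
    intro j x
    have hvj := (contDiff_pder (n := 1) hv (by norm_num) j).differentiable one_ne_zero x
    have hvd := hv.differentiable d2 x
    rw [hpw, pder_mul (hexc.differentiable d2 x) ((hvd.const_mul _).fun_add hvj),
      pder_add (hvd.const_mul _) hvj, pder_const_mul hvd, hexp]
    ring
  have hlap : ∀ x, ex x * lap v x = lap w x - 2 * τ * pder 0 w x + τ ^ 2 * w x := by
    intro x
    rw [lap, Finset.mul_sum, Finset.sum_congr rfl fun j _ => hpp j x, lap]
    simp [Fin.sum_univ_three]
    ring
  have hpc : Continuous (pder 0 w) :=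
    (contDiff_pder (n := 1) hwc (by norm_num) 0).continuous
  have hpcs := hasCompactSupport_pder hc 0
  have hpcc : Continuous fun x => (starRingEnd ℂ) (pder 0 w x) := Complex.continuous_conj.comp hpc
  have hint : ∀ f : E3 → ℂ, Continuous f →
      Integrable fun x => f x * (starRingEnd ℂ) (pder 0 w x) := fun f hf =>
    (hf.mul hpcc).integrable_of_hasCompactSupport hpcs.conj.mul_left
  have i1 := hint _ (continuous_lap hwc)
  have i2 := (hint _ hpc).const_mul (2 * (τ : ℂ))
  have i3 := (hint _ hwc.continuous).const_mul ((τ : ℂ) ^ 2)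
  have iL := hint (fun x => ex x * lap v x) (hexc.continuous.mul (continuous_lap hv))
  have hI : (∫ x, ex x * lap v x * (starRingEnd ℂ) (pder 0 w x)).re =
      -(2 * τ * ∫ x, ‖pder 0 w x‖ ^ 2) := by
    have e : ∀ x, ex x * lap v x * (starRingEnd ℂ) (pder 0 w x) =
        lap w x * (starRingEnd ℂ) (pder 0 w x) -
        2 * τ * (pder 0 w x * (starRingEnd ℂ) (pder 0 w x)) +
        τ ^ 2 * (w x * (starRingEnd ℂ) (pder 0 w x)) := fun x => by
      rw [hlap]; ring
    have e2 : ∫ x, pder 0 w x * (starRingEnd ℂ) (pder 0 w x) =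
        ((∫ x, ‖pder 0 w x‖ ^ 2 : ℝ) : ℂ) := by
      refine Eq.trans (integral_congr_ae (Eventually.of_forall fun x => ?_))
        (integral_complex_ofReal (f := fun x => ‖pder 0 w x‖ ^ 2))
      simp [Complex.mul_conj, Complex.normSq_eq_norm_sq]
    have e3 := re_integral_mul_conj_pder (hwc.of_le (by norm_num)) hc 0
    have e4 := re_integral_lap_mul_conj_pder hwc hc 0
    simp_rw [e]
    have e5 := (integral_add (i1.sub i2) i3).trans (congrArg (· + _) (integral_sub i1 i2))
    simp only [Pi.sub_apply] at e5
    rw [e5, integral_const_mul, integral_const_mul, e2,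
      Complex.add_re, Complex.sub_re, e4]
    rw [← Complex.ofReal_pow, Complex.re_ofReal_mul, e3, ← Complex.ofReal_ofNat,
      ← Complex.ofReal_mul, Complex.re_ofReal_mul, Complex.ofReal_re]
    ring
  have j1 : Integrable fun x => ‖w x‖ ^ 2 :=
    (hwc.continuous.norm.pow 2).integrable_of_hasCompactSupport
      (hc.mono fun x hx h => hx (by simp [h]))
  have j2 : Integrable fun x => ‖pder 0 w x‖ ^ 2 :=
    (hpc.norm.pow 2).integrable_of_hasCompactSupport (hpcs.mono fun x hx h => hx (by simp [h]))
  by_cases hM0 : M < 0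
  · have := (norm_nonneg _).trans (hM x)
    have h2 : ‖v x‖ ≤ 0 := by nlinarith [norm_nonneg (v x)]
    simpa using h2
  rw [not_lt] at hM0
  have hb : 2 * τ * ∫ x, ‖pder 0 w x‖ ^ 2 ≤
      M * ((4 * R)⁻¹ * (∫ x, ‖w x‖ ^ 2) + R * ∫ x, ‖pder 0 w x‖ ^ 2) := by
    calc 2 * τ * ∫ x, ‖pder 0 w x‖ ^ 2
        ≤ ‖∫ x, ex x * lap v x * (starRingEnd ℂ) (pder 0 w x)‖ := by
          have := (abs_le.1 (Complex.abs_re_le_norm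
            (∫ x, ex x * lap v x * (starRingEnd ℂ) (pder 0 w x)))).1
          linarith
      _ ≤ ∫ x, ‖ex x * lap v x * (starRingEnd ℂ) (pder 0 w x)‖ := norm_integral_le_integral_norm _
      _ ≤ ∫ x, M * ((4 * R)⁻¹ * ‖w x‖ ^ 2 + R * ‖pder 0 w x‖ ^ 2) := by
          refine integral_mono iL.norm (((j1.const_mul _).add (j2.const_mul _)).const_mul _)
            fun x => ?_
          have a1 : ‖ex x * lap v x * (starRingEnd ℂ) (pder 0 w x)‖ ≤
              M * (‖w x‖ * ‖pder 0 w x‖) := by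
            rw [norm_mul, norm_mul, RCLike.norm_conj, hw]
            calc _ ≤ ‖ex x‖ * (M * ‖v x‖) * ‖pder 0 w x‖ := by gcongr; exact hM x
              _ = _ := by rw [norm_mul]; ring
          refine a1.trans ?_
          gcongr
          have : (4 * R)⁻¹ * ‖w x‖ ^ 2 + R * ‖pder 0 w x‖ ^ 2 - ‖w x‖ * ‖pder 0 w x‖ =
            (4 * R)⁻¹ * (‖w x‖ - 2 * R * ‖pder 0 w x‖) ^ 2 := by field_simp; ring
          nlinarith [show 0 ≤ (4 * R)⁻¹ * (‖w x‖ - 2 * R * ‖pder 0 w x‖) ^ 2 by positivity]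
      _ = _ := by
          rw [integral_const_mul, integral_add (j1.const_mul _) (j2.const_mul _),
            integral_const_mul, integral_const_mul]
  have hP := integral_norm_sq_le (hwc.of_le (by norm_num)) hR hw0 0
  have hD0 : 0 ≤ ∫ x, ‖pder 0 w x‖ ^ 2 := integral_nonneg fun x => by positivity
  have h5 : (4 * R)⁻¹ * (∫ x, ‖w x‖ ^ 2) ≤ R * ∫ x, ‖pder 0 w x‖ ^ 2 := by
    calc _ ≤ (4 * R)⁻¹ * (4 * R ^ 2 * ∫ x, ‖pder 0 w x‖ ^ 2) := by gcongr
      _ = _ := by field_simp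
  have h6 := mul_le_mul_of_nonneg_left h5 hM0
  have hD : ∫ x, ‖pder 0 w x‖ ^ 2 = 0 := by nlinarith
  rw [hD, mul_zero] at hP
  have hw2 : ∫ x, ‖w x‖ ^ 2 = 0 := le_antisymm hP (integral_nonneg fun x => by positivity)
  have := (Continuous.ae_eq_iff_eq (volume : Measure E3) (hwc.continuous.norm.pow 2)
    continuous_zero).1 ((integral_eq_zero_iff_of_nonneg (fun x => by positivity) j1).1 hw2)
  have hx := congrFun this x
  have : w x = 0 := by simpa using hx
  exact (mul_eq_zero.1 this).resolve_left (Complex.exp_ne_zero _)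

theorem eq_zero_of_radCond {k : ℝ} (hk : 0 < k) {R : ℝ} (hR : 0 < R) {v : E3 → ℂ}
    (hv : ContDiff ℝ 2 v) {β : E3 → ℝ} (hβ : Continuous β) (hβ0 : ∀ x, R < ‖x‖ → β x = 0)
    (hH : ∀ x, lap v x + (k : ℂ) ^ 2 * (1 + β x) * v x = 0) (hrad : RadCond k v) (x : E3) :
    v x = 0 := by
  have hdec : ShellDecay v := fun ε hε => exists_shell_integral_le hk hv hH hrad hε
  have hext : ∀ x, R < ‖x‖ → v x = 0 := fun x hx =>
    eq_zero_of_shellDecay hk.ne' hR hv (fun y hy => by simpa [hβ0 y hy] using hH y) hdec hx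
  obtain ⟨B, hB⟩ := (isCompact_closedBall (0 : E3) R).exists_bound_of_continuousOn hβ.continuousOn
  refine eq_zero_of_norm_lap_le (M := k ^ 2 * (1 + max B 0)) hv hR hext (fun y => ?_) x
  rw [eq_neg_of_add_eq_zero_left (hH y), norm_neg, norm_mul, norm_mul, norm_pow,
    Complex.norm_real, norm_of_nonneg hk.le]
  gcongr
  refine (norm_add_le _ _).trans ?_
  rw [norm_one, Complex.norm_real]
  gcongr
  by_cases hy : R < ‖y‖
  · simp [hβ0 y hy]
  · exact (hB y (by simpa using hy)).trans (le_max_left _ _)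

theorem locallyIntegrable_inv_norm_pow {m : ℕ} (hm : m ≤ 2) :
    LocallyIntegrable (fun z : E3 => (‖z‖ ^ m)⁻¹) := by
  refine locallyIntegrable_of_norm_le_rpow (C := 1) (α := m) (by simp) ?_ ?_ ?_
  · simp only [finrank_euclideanSpace, Fintype.card_fin]
    exact_mod_cast (by omega : m < 3)
  · refine Eventually.of_forall fun x => ?_
    rw [one_mul, rpow_neg (norm_nonneg x), rpow_natCast, norm_of_nonneg (by positivity)]
  · exact (measurable_norm.pow_const m).inv.aestronglyMeasurable

theorem exists_norm_le_of_hasCompactSupport {F : Type*} [NormedAddCommGroup F] {f : E3 → F}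
    (hf : Continuous f) (hc : HasCompactSupport f) :
    ∃ R B : ℝ, 0 < R ∧ 0 ≤ B ∧ (∀ x, ‖f x‖ ≤ B) ∧ ∀ x, R < ‖x‖ → f x = 0 := by
  obtain ⟨R, hR0, hR⟩ := hc.isBounded.exists_pos_norm_le
  obtain ⟨B, hB⟩ := hc.exists_bound_of_continuous hf
  exact ⟨R, B, hR0, (norm_nonneg _).trans (hB 0), hB, fun x hx =>
    image_eq_zero_of_notMem_tsupport fun h => hx.not_ge (hR x h)⟩

theorem hasFDerivAt_integral_mul_of_contDiff {N f : E3 → ℂ} (hN : ContDiff ℝ 1 N)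
    (hf : Continuous f) (hc : HasCompactSupport f) (x : E3) :
    HasFDerivAt (fun x => ∫ z, N z * f (x - z)) (∫ z, f (x - z) • fderiv ℝ N z) x := by
  have hN' : Continuous (fderiv ℝ N) := hN.continuous_fderiv one_ne_zero
  obtain ⟨R, B, hR, hB0, hB, hR0⟩ := exists_norm_le_of_hasCompactSupport hf hc
  obtain ⟨C, hC⟩ := (isCompact_closedBall (0 : E3) (‖x‖ + 1 + R)).exists_bound_of_continuousOn
    hN'.continuousOn
  have e1 : ∀ x, ∫ z, N z * f (x - z) = ∫ z, N (x - z) * f z := fun x => by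
    rw [← integral_sub_left_eq_self _ volume x]
    simp
  have e2 : ∫ z, f (x - z) • fderiv ℝ N z = ∫ z, f z • fderiv ℝ N (x - z) := by
    rw [← integral_sub_left_eq_self _ volume x]
    simp
  simp_rw [e1]
  rw [e2]
  refine hasFDerivAt_integral_of_dominated_of_fderiv_le (𝕜 := ℝ)
    (F := fun x z => N (x - z) * f z) (F' := fun x z => f z • fderiv ℝ N (x - z))
    (bound := fun z => ‖f z‖ * C)
    (Metric.ball_mem_nhds x one_pos) (Eventually.of_forall fun y => ?_) ?_ ?_
    (Eventually.of_forall fun z y hy => ?_) ?_ (Eventually.of_forall fun z y hy => ?_)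
  · exact ((hN.continuous.comp (continuous_const.sub continuous_id)).mul hf).aestronglyMeasurable
  · exact ((hN.continuous.comp (continuous_const.sub continuous_id)).mul
      hf).integrable_of_hasCompactSupport hc.mul_left
  · exact (hf.smul (hN'.comp (continuous_const.sub continuous_id))).aestronglyMeasurable
  · rw [norm_smul]
    by_cases hz : R < ‖z‖
    · simp [hR0 z hz]
    · refine mul_le_mul_of_nonneg_left (hC _ ?_) (norm_nonneg _)
      have h1 : ‖y - x‖ < 1 := by simpa [dist_eq_norm] using hy
      have h2 : ‖y - z‖ ≤ ‖y - x‖ + ‖x‖ + ‖z‖ := by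
        calc ‖y - z‖ = ‖(y - x) + x - z‖ := by rw [sub_add_cancel]
          _ ≤ _ := (norm_sub_le _ _).trans (by gcongr; exact norm_add_le _ _)
      rw [mem_closedBall_zero_iff]
      linarith [not_lt.1 hz]
  · exact (hf.norm.mul continuous_const).integrable_of_hasCompactSupport hc.norm.mul_right
  · have h1 := ((hN.differentiable one_ne_zero (y - z)).hasFDerivAt.comp y
      ((hasFDerivAt_id y).sub_const z)).mul_const (f z)
    exact h1

/-- Differentiation of the convolution of a singular kernel with a continuous function. -/
theorem hasFDerivAt_integral_mul {N : E3 → ℂ} {D : E3 → E3 →L[ℝ] ℂ} {Nn : ℕ → E3 → ℂ}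
    (hNn : ∀ n, ContDiff ℝ 1 (Nn n)) {b b' : E3 → ℝ} (hb : LocallyIntegrable b)
    (hb' : LocallyIntegrable b') (hNb : ∀ n z, z ≠ 0 → ‖Nn n z‖ ≤ b z)
    (hDb : ∀ n z, z ≠ 0 → ‖fderiv ℝ (Nn n) z‖ ≤ b' z)
    (hN : ∀ z ≠ 0, Tendsto (fun n => Nn n z) atTop (nhds (N z)))
    (hD : ∀ z ≠ 0, Tendsto (fun n => fderiv ℝ (Nn n) z) atTop (nhds (D z)))
    {f : E3 → ℂ} (hf : Continuous f) (hc : HasCompactSupport f) (x : E3) :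
    HasFDerivAt (fun x => ∫ z, N z * f (x - z)) (∫ z, f (x - z) • D z) x := by
  obtain ⟨R, B, hR, hB0, hB, hR0⟩ := exists_norm_le_of_hasCompactSupport hf hc
  have h0 : ∀ᵐ z : E3, z ≠ 0 := by simp [ae_iff]
  have hDn : ∀ n, Continuous (fderiv ℝ (Nn n)) := fun n => (hNn n).continuous_fderiv one_ne_zero
  have hDm : AEStronglyMeasurable D :=
    aestronglyMeasurable_of_tendsto_ae atTop (fun n => (hDn n).aestronglyMeasurable)
      (h0.mono hD)
  have hDle : ∀ z ≠ 0, ‖D z‖ ≤ b' z := fun z hz =>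
    le_of_tendsto (hD z hz).norm (Eventually.of_forall fun n => hDb n z hz)
  have hsupp : ∀ x z, ‖x‖ + R < ‖z‖ → f (x - z) = 0 := fun x z h => hR0 _ (by
    have := norm_sub_norm_le z x
    rw [norm_sub_rev] at this
    linarith)
  have hfx : ∀ x, Continuous fun z => f (x - z) := fun x =>
    hf.comp (continuous_const.sub continuous_id)
  have hball : ∀ {b : E3 → ℝ} (_ : LocallyIntegrable b) (S : ℝ),
      IntegrableOn b (Metric.closedBall 0 S) := fun hb S =>
    hb.integrableOn_isCompact (isCompact_closedBall _ _)
  have hint : ∀ {b : E3 → ℝ} (_ : LocallyIntegrable b) (x : E3),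
      Integrable ((Metric.closedBall 0 (‖x‖ + R)).indicator fun z => B * b z) := fun hb x =>
    (integrable_indicator_iff measurableSet_closedBall).2 ((hball hb _).const_mul B)
  have hind : ∀ {G : Type} [NormedAddCommGroup G] (g : E3 → G) {b : E3 → ℝ} (x z : E3),
      (‖g z‖ ≤ ‖f (x - z)‖ * b z) → 0 ≤ b z →
      ‖g z‖ ≤ (Metric.closedBall 0 (‖x‖ + R)).indicator (fun z => B * b z) z := by
    intro G _ g b x z h hb0
    by_cases hz : z ∈ Metric.closedBall (0 : E3) (‖x‖ + R)
    · rw [indicator_of_mem hz]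
      exact h.trans (mul_le_mul_of_nonneg_right (hB _) hb0)
    · rw [indicator_of_notMem hz]
      rw [hsupp x z (by simpa using hz), norm_zero, zero_mul] at h
      exact h
  have hfD : ∀ x, Integrable fun z => f (x - z) • D z := fun x =>
    (hint hb' x).mono' ((hfx x).aestronglyMeasurable.smul hDm) (h0.mono fun z hz =>
      hind (fun z => f (x - z) • D z) x z (by simp only [norm_smul]; gcongr; exact hDle z hz)
        ((norm_nonneg _).trans (hDle z hz)))
  have hfDn : ∀ n x, Integrable fun z => f (x - z) • fderiv ℝ (Nn n) z := fun n x =>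
    (hint hb' x).mono' ((hfx x).smul (hDn n)).aestronglyMeasurable (h0.mono fun z hz =>
      hind (fun z => f (x - z) • fderiv ℝ (Nn n) z) x z
        (by simp only [norm_smul]; gcongr; exact hDb n z hz)
        ((norm_nonneg _).trans (hDle z hz)))
  set s : Set E3 := Metric.ball 0 (‖x‖ + 1)
  set L : Set E3 := Metric.closedBall 0 (‖x‖ + 1 + R)
  have hδ : Tendsto (fun n => ∫ z in L, ‖fderiv ℝ (Nn n) z - D z‖) atTop (nhds 0) := by
    have h1 := tendsto_integral_of_dominated_convergence (μ := volume.restrict L)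
      (F := fun n z => ‖fderiv ℝ (Nn n) z - D z‖) (f := fun _ => (0 : ℝ)) (fun z => 2 * b' z)
      (fun n => ((hDn n).aestronglyMeasurable.sub hDm.restrict).norm) ((hball hb' _).const_mul 2)
      (fun n => ae_restrict_of_ae (h0.mono fun z hz => by
        rw [norm_norm]
        refine (norm_sub_le _ _).trans ?_
        linarith [hDb n z hz, hDle z hz]))
      (ae_restrict_of_ae (h0.mono fun z hz => by
        simpa using ((hD z hz).sub_const (D z)).norm))
    simpa using h1
  refine hasFDerivAt_of_tendstoUniformlyOn (l := atTop) (s := s)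
    (f := fun n x => ∫ z, Nn n z * f (x - z)) (g' := fun x => ∫ z, f (x - z) • D z)
    (f' := fun n x => ∫ z, f (x - z) • fderiv ℝ (Nn n) z) Metric.isOpen_ball ?_
    (fun n y _ => hasFDerivAt_integral_mul_of_contDiff (hNn n) hf hc y) (fun y _ => ?_)
    (by simp [s])
  · rw [Metric.tendstoUniformlyOn_iff]
    intro ε hε
    have h2 := (hδ.const_mul B).eventually_lt_const (show B * 0 < ε by simpa using hε)
    filter_upwards [h2] with n hn y hy
    have hyn : ‖y‖ < ‖x‖ + 1 := by simpa [s] using hy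
    rw [dist_comm, dist_eq_norm, ← integral_sub (hfDn n y) (hfD y)]
    have e1 : ∀ z, z ∉ L → f (y - z) • fderiv ℝ (Nn n) z - f (y - z) • D z = 0 := fun z hz => by
      have : ‖x‖ + 1 + R < ‖z‖ := by simpa [L] using hz
      rw [hsupp y z (by linarith)]
      ext v
      simp
    rw [← setIntegral_eq_integral_of_forall_compl_eq_zero (s := L) e1]
    refine lt_of_le_of_lt ?_ hn
    rw [← integral_const_mul]
    refine norm_integral_le_of_norm_le ?_ (Eventually.of_forall fun z => ?_)
    · refine Integrable.const_mul ?_ _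
      refine ((hball hb' _).const_mul 2).mono'
        ((hDn n).aestronglyMeasurable.sub hDm.restrict).norm
        (ae_restrict_of_ae (h0.mono fun z hz => ?_))
      rw [norm_norm]
      refine (norm_sub_le _ _).trans ?_
      linarith [hDb n z hz, hDle z hz]
    · have e2 : f (y - z) • fderiv ℝ (Nn n) z - f (y - z) • D z =
          f (y - z) • (fderiv ℝ (Nn n) z - D z) := by
        ext v
        simp [mul_sub]
      rw [e2, norm_smul]
      gcongr
      exact hB _
  · refine tendsto_integral_of_dominated_convergence
      ((Metric.closedBall 0 (‖y‖ + R)).indicator fun z => B * b z)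
      (fun n => ((hNn n).continuous.mul (hfx y)).aestronglyMeasurable) (hint hb y)
      (fun n => h0.mono fun z hz => hind (fun z => Nn n z * f (y - z)) y z ?_ ?_)
      (h0.mono fun z hz => (hN z hz).mul_const _)
    · simp only [norm_mul]
      rw [mul_comm]
      gcongr
      exact hNb n z hz
    · exact (norm_nonneg _).trans (hNb n z hz)

theorem hasDerivAt_radialSol_add (κ : ℝ) (l : ℕ) {δ s : ℝ} (h : 0 < s + δ) :
    HasDerivAt (fun s => radialSol κ l (s + δ)) (radialSol κ (l + 1) (s + δ)) s := by
  have := (hasDerivAt_radialSol κ l h).scomp s ((hasDerivAt_id s).add_const δ)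
  rw [one_smul] at this
  exact this

/-- The kernel `exp(-ik|z|)/|z|`, regularised for `δ > 0`. -/
def regKernel (k δ : ℝ) (z : E3) : ℂ := radialSol (-k) 0 (‖z‖ ^ 2 + δ)

theorem contDiff_regKernel (k : ℝ) {δ : ℝ} (hδ : 0 < δ) {n : WithTop ℕ∞} :
    ContDiff ℝ n (regKernel k δ) := by
  rw [contDiff_iff_contDiffAt]
  intro z
  have h : 0 < ‖z‖ ^ 2 + δ := by positivity
  exact (contDiffAt_radialSol (-k) 0 h).comp z
    (contDiff_norm_sq ℝ |>.add contDiff_const).contDiffAt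

theorem hasFDerivAt_regKernel (k : ℝ) {δ : ℝ} {z : E3} (h : 0 < ‖z‖ ^ 2 + δ) :
    HasFDerivAt (regKernel k δ)
      ((2 * radialSol (-k) 1 (‖z‖ ^ 2 + δ)) • (Complex.ofRealCLM.comp (innerSL ℝ z))) z :=
  hasFDerivAt_comp_norm_sq (hasDerivAt_radialSol_add (-k) 0 h)

theorem norm_regKernel_le (k : ℝ) {δ : ℝ} (hδ : 0 ≤ δ) {z : E3} (hz : z ≠ 0) :
    ‖regKernel k δ z‖ ≤ (‖z‖ ^ 1)⁻¹ := by
  have hz0 : 0 < ‖z‖ := norm_pos_iff.2 hz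
  rw [regKernel, radialSol, norm_div, norm_exp_I_mul_mul, pow_one, one_div, Complex.norm_real,
    norm_of_nonneg (Real.sqrt_nonneg _)]
  gcongr
  exact Real.le_sqrt_of_sq_le (by linarith)

theorem norm_fderiv_regKernel_le (k : ℝ) {δ : ℝ} (hδ : 0 ≤ δ) {z : E3} (hz : z ≠ 0) :
    ‖fderiv ℝ (regKernel k δ) z‖ ≤ |k| * (‖z‖ ^ 1)⁻¹ + (‖z‖ ^ 2)⁻¹ := by
  have hz0 : 0 < ‖z‖ := norm_pos_iff.2 hz
  have h : 0 < ‖z‖ ^ 2 + δ := by positivity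
  have h1 : ‖z‖ ≤ √(‖z‖ ^ 2 + δ) := Real.le_sqrt_of_sq_le (by linarith)
  rw [(hasFDerivAt_regKernel k h).fderiv, norm_smul, norm_mul]
  have h2 : ‖Complex.ofRealCLM.comp (innerSL ℝ z)‖ ≤ ‖z‖ :=
    (ContinuousLinearMap.opNorm_comp_le _ _).trans (by simp)
  calc _ ≤ 2 * (|k| / (2 * ‖z‖ ^ 2) + 1 / (2 * ‖z‖ ^ 2 * ‖z‖)) * ‖z‖ := by
        gcongr
        · simp
        · refine (norm_radialSol_one_le (-k) h).trans ?_
          rw [abs_neg]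
          gcongr <;> linarith
    _ = _ := by field_simp

theorem lap_regKernel_add (k : ℝ) {δ : ℝ} (hδ : 0 < δ) (z : E3) :
    lap (regKernel k δ) z + k ^ 2 * regKernel k δ z =
      -(4 * δ * radialSol (-k) 2 (‖z‖ ^ 2 + δ)) := by
  have h := lap_radial_mul_pow (G := fun s => radialSol (-k) 0 (s + δ))
    (fun s hs => hasDerivAt_radialSol_add (-k) 0 (by linarith))
    (fun s hs => hasDerivAt_radialSol_add (-k) 1 (by linarith)) 0 0 z
  simp only [pow_zero, mul_one, Nat.cast_zero, mul_zero, add_zero, zero_mul] at h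
  have h2 := radialSol_ode (-k) 0 (s := ‖z‖ ^ 2 + δ) (by positivity)
  simp only [Nat.cast_zero, mul_zero, add_zero, zero_add] at h2
  rw [show lap (regKernel k δ) z = _ from h, regKernel]
  push_cast at h2 ⊢
  linear_combination h2

/-- The kernel `exp(-ik|z|)/|z|`. -/
def helmKernel (k : ℝ) (z : E3) : ℂ := regKernel k 0 z

theorem helmKernel_eq (k : ℝ) (z : E3) :
    helmKernel k z = Complex.exp (-Complex.I * k * ‖z‖) / ‖z‖ := by
  simp [helmKernel, regKernel, radialSol, Real.sqrt_sq]

theorem norm_helmKernel_le (k : ℝ) (z : E3) : ‖helmKernel k z‖ ≤ (‖z‖ ^ 1)⁻¹ := by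
  rcases eq_or_ne z 0 with rfl | hz
  · simp [helmKernel_eq]
  · exact norm_regKernel_le k le_rfl hz

theorem measurable_helmKernel (k : ℝ) : Measurable (helmKernel k) := by
  rw [funext (helmKernel_eq k)]
  fun_prop

theorem locallyIntegrable_helmKernel (k : ℝ) : LocallyIntegrable (helmKernel k) :=
  (locallyIntegrable_inv_norm_pow one_le_two).mono (measurable_helmKernel k).aestronglyMeasurable
    (Eventually.of_forall fun z => (norm_helmKernel_le k z).trans (le_abs_self _))

/-- The volume potential with kernel `exp(-ik|z|)/|z|`. -/
def helmPot (k : ℝ) (f : E3 → ℂ) (x : E3) : ℂ := ∫ z, helmKernel k z * f (x - z)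

/-- Regularisation parameters tending to zero. -/
def regSeq (n : ℕ) : ℝ := 1 / ((n : ℝ) + 1)

theorem regSeq_pos (n : ℕ) : 0 < regSeq n := Nat.one_div_pos_of_nat

theorem regSeq_le_one (n : ℕ) : regSeq n ≤ 1 :=
  div_le_one_of_le₀ (by linarith [n.cast_nonneg (α := ℝ)]) (by positivity)

theorem tendsto_regSeq : Tendsto regSeq atTop (nhds 0) := tendsto_one_div_add_atTop_nhds_zero_nat

theorem tendsto_regKernel (k : ℝ) {z : E3} (hz : z ≠ 0) :
    Tendsto (fun n => regKernel k (regSeq n ^ 2) z) atTop (nhds (helmKernel k z)) := by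
  have hz0 : 0 < ‖z‖ := norm_pos_iff.2 hz
  have h1 : Tendsto (fun n => ‖z‖ ^ 2 + regSeq n ^ 2) atTop (nhds (‖z‖ ^ 2 + 0)) := by
    simpa using (tendsto_regSeq.pow 2).const_add (‖z‖ ^ 2)
  exact ((contDiffAt_radialSol (-k) 0 (n := 0)
    (show 0 < ‖z‖ ^ 2 + 0 by positivity)).continuousAt.tendsto).comp h1

theorem tendsto_fderiv_regKernel (k : ℝ) {z : E3} (hz : z ≠ 0) :
    Tendsto (fun n => fderiv ℝ (regKernel k (regSeq n ^ 2)) z) atTop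
      (nhds (fderiv ℝ (helmKernel k) z)) := by
  have hz0 : 0 < ‖z‖ := norm_pos_iff.2 hz
  have h1 : Tendsto (fun n => ‖z‖ ^ 2 + regSeq n ^ 2) atTop (nhds (‖z‖ ^ 2 + 0)) := by
    simpa using (tendsto_regSeq.pow 2).const_add (‖z‖ ^ 2)
  have h2 := ((contDiffAt_radialSol (-k) 1 (n := 0)
    (show 0 < ‖z‖ ^ 2 + 0 by positivity)).continuousAt.tendsto).comp h1
  rw [show fderiv ℝ (helmKernel k) z = _ from
    (hasFDerivAt_regKernel k (δ := 0) (z := z) (by positivity)).fderiv]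
  simp_rw [fun n => (hasFDerivAt_regKernel k (δ := regSeq n ^ 2) (z := z) (by positivity)).fderiv]
  exact (h2.const_mul 2).smul_const _

theorem hasFDerivAt_helmPot (k : ℝ) {f : E3 → ℂ} (hf : Continuous f) (hc : HasCompactSupport f)
    (x : E3) :
    HasFDerivAt (helmPot k f) (∫ z, f (x - z) • fderiv ℝ (helmKernel k) z) x :=
  hasFDerivAt_integral_mul (Nn := fun n => regKernel k (regSeq n ^ 2))
    (fun n => contDiff_regKernel k (pow_pos (regSeq_pos n) 2))
    (locallyIntegrable_inv_norm_pow one_le_two)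
    (((locallyIntegrable_inv_norm_pow one_le_two).smul |k|).add
      (locallyIntegrable_inv_norm_pow le_rfl))
    (fun _ _ hz => norm_regKernel_le k (sq_nonneg _) hz)
    (fun _ _ hz => norm_fderiv_regKernel_le k (sq_nonneg _) hz)
    (fun _ hz => tendsto_regKernel k hz) (fun _ hz => tendsto_fderiv_regKernel k hz) hf hc x

theorem helmPot_eq_convolution (k : ℝ) (f : E3 → ℂ) :
    helmPot k f = convolution (helmKernel k) f (ContinuousLinearMap.mul ℝ ℂ) volume := rfl

theorem contDiff_helmPot (k : ℝ) {n : ℕ} {f : E3 → ℂ} (hf : ContDiff ℝ n f)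
    (hc : HasCompactSupport f) : ContDiff ℝ n (helmPot k f) := by
  rw [helmPot_eq_convolution]
  exact hc.contDiff_convolution_right _ (locallyIntegrable_helmKernel k) hf

theorem pder_helmPot (k : ℝ) {f : E3 → ℂ} (hf : ContDiff ℝ 1 f) (hc : HasCompactSupport f)
    (j : Fin 3) : pder j (helmPot k f) = helmPot k (pder j f) := by
  ext x
  have h := hc.hasFDerivAt_convolution_right (ContinuousLinearMap.mul ℝ ℂ)
    (locallyIntegrable_helmKernel k) hf x
  rw [pder, helmPot_eq_convolution, h.fderiv]
  rw [convolution_precompR_apply _ (locallyIntegrable_helmKernel k) (hc.fderiv ℝ)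
    (hf.continuous_fderiv one_ne_zero)]
  rfl

theorem integrable_inv_sqrt_one_add_pow :
    Integrable fun z : E3 => (√(1 + ‖z‖ ^ 2) ^ 5)⁻¹ := by
  have h := integrable_rpow_neg_one_add_norm_sq (E := E3) (μ := volume) (r := 5)
    (by simp; norm_num)
  refine h.congr (Eventually.of_forall fun z => ?_)
  have h0 : (0 : ℝ) ≤ 1 + ‖z‖ ^ 2 := by positivity
  simp only [neg_div]
  rw [rpow_neg h0, Real.sqrt_eq_rpow, ← rpow_natCast ((1 + ‖z‖ ^ 2) ^ (1 / 2 : ℝ)) 5,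
    ← rpow_mul h0]
  norm_num

/-- The normalising constant (equal to `4π`) of the fundamental solution. -/
def helmConst : ℝ := 3 * ∫ z : E3, (√(1 + ‖z‖ ^ 2) ^ 5)⁻¹

theorem helmConst_pos : 0 < helmConst := by
  refine mul_pos three_pos ?_
  rw [integral_pos_iff_support_of_nonneg (fun z => by positivity) integrable_inv_sqrt_one_add_pow]
  have : (Function.support fun z : E3 => (√(1 + ‖z‖ ^ 2) ^ 5)⁻¹) = univ := by
    ext z
    have : 0 < (√(1 + ‖z‖ ^ 2) ^ 5)⁻¹ := by positivity
    simp only [Function.mem_support, mem_univ, iff_true]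
    exact this.ne'
  rw [this]
  exact Measure.measure_univ_pos.2 (NeZero.ne _)

/-- The rescaled source of the regularised kernel. -/
theorem scaled_radialSol_two (κ : ℝ) {ε : ℝ} (hε : 0 < ε) (z : E3) :
    (ε : ℂ) ^ 3 * (4 * (ε ^ 2 : ℝ) * radialSol κ 2 (‖ε • z‖ ^ 2 + ε ^ 2)) =
      Complex.exp (Complex.I * κ * (ε * √(1 + ‖z‖ ^ 2) : ℝ)) *
        ((3 - 3 * Complex.I * κ * (ε * √(1 + ‖z‖ ^ 2) : ℝ) -
          κ ^ 2 * (ε * √(1 + ‖z‖ ^ 2) : ℝ) ^ 2) * ((√(1 + ‖z‖ ^ 2) ^ 5)⁻¹ : ℝ)) := by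
  have hσ : 0 < 1 + ‖z‖ ^ 2 := by positivity
  set r := √(1 + ‖z‖ ^ 2) with hr
  have hr0 : 0 < r := Real.sqrt_pos.2 hσ
  have h1 : ‖ε • z‖ ^ 2 + ε ^ 2 = (ε * r) ^ 2 := by
    rw [norm_smul, mul_pow, mul_pow, hr, Real.sq_sqrt hσ.le, norm_of_nonneg hε.le]
    ring
  have h2 : √((ε * r) ^ 2) = ε * r := Real.sqrt_sq (by positivity)
  have hε' : (ε : ℂ) ≠ 0 := by exact_mod_cast hε.ne'
  have hr' : (r : ℂ) ≠ 0 := by exact_mod_cast hr0.ne'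
  rw [h1]
  simp only [radialSol, h2]
  push_cast
  field_simp
  ring

theorem tendsto_integral_regKernel_source (k : ℝ) {g : E3 → ℂ} (hg : Continuous g)
    (hc : HasCompactSupport g) :
    Tendsto (fun n => ∫ z, (lap (regKernel k (regSeq n ^ 2)) z +
      k ^ 2 * regKernel k (regSeq n ^ 2) z) * g z) atTop (nhds (-helmConst * g 0)) := by
  obtain ⟨R, B, hR, hB0, hB, hR0⟩ := exists_norm_le_of_hasCompactSupport hg hc
  set r : E3 → ℝ := fun z => √(1 + ‖z‖ ^ 2) with hr
  have hrc : Continuous r := by fun_prop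
  have hr1 : ∀ z, 1 ≤ r z := fun z => Real.one_le_sqrt.2 (by nlinarith [sq_nonneg ‖z‖])
  set Ψ : ℕ → E3 → ℂ := fun n z => Complex.exp (Complex.I * (-k : ℝ) * (regSeq n * r z : ℝ)) *
        ((3 - 3 * Complex.I * (-k : ℝ) * (regSeq n * r z : ℝ) -
          (-k : ℝ) ^ 2 * (regSeq n * r z : ℝ) ^ 2) * ((r z ^ 5)⁻¹ : ℝ)) with hΨ
  have e1 : ∀ n, ∫ z, (lap (regKernel k (regSeq n ^ 2)) z +
      k ^ 2 * regKernel k (regSeq n ^ 2) z) * g z = ∫ z, -(Ψ n z * g (regSeq n • z)) := by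
    intro n
    have hε := regSeq_pos n
    have hε' : (regSeq n : ℂ) ≠ 0 := by exact_mod_cast hε.ne'
    have h := Measure.integral_comp_smul (volume : Measure E3)
      (fun z => (lap (regKernel k (regSeq n ^ 2)) z +
      k ^ 2 * regKernel k (regSeq n ^ 2) z) * g z) (regSeq n)
    rw [finrank_euclideanSpace, Fintype.card_fin, abs_of_pos (by positivity),
      Complex.real_smul, Complex.ofReal_inv, Complex.ofReal_pow,
      eq_inv_mul_iff_mul_eq₀ (pow_ne_zero 3 hε')] at h
    rw [← h, ← integral_const_mul]
    refine integral_congr_ae (Eventually.of_forall fun z => ?_)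
    simp only
    rw [lap_regKernel_add k (pow_pos hε 2), hΨ]
    simp only [hr]
    rw [← scaled_radialSol_two (-k) hε z]
    ring
  simp_rw [e1]
  have e2 : -(helmConst : ℂ) * g 0 = ∫ z, -(3 * ((r z ^ 5)⁻¹ : ℝ) * g 0) := by
    rw [integral_neg, integral_mul_const, integral_const_mul, integral_complex_ofReal, helmConst]
    push_cast
    ring
  rw [e2]
  have hQ : ∀ n z, ‖regSeq n • z‖ ≤ R → regSeq n * r z ≤ 1 + R := by
    intro n z h
    have h3 : r z ≤ 1 + ‖z‖ := Real.sqrt_le_iff.2 ⟨by positivity, by nlinarith [norm_nonneg z]⟩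
    rw [norm_smul, norm_of_nonneg (regSeq_pos n).le] at h
    nlinarith [regSeq_pos n, regSeq_le_one n]
  refine tendsto_integral_of_dominated_convergence
    (fun z => (3 + 3 * |k| * (1 + R) + k ^ 2 * (1 + R) ^ 2) * B * (r z ^ 5)⁻¹) (fun n => ?_)
    (integrable_inv_sqrt_one_add_pow.const_mul _) (fun n => Eventually.of_forall fun z => ?_)
    (Eventually.of_forall fun z => ?_)
  · have : Continuous fun z => ((r z ^ 5)⁻¹ : ℝ) := (hrc.pow 5).inv₀ fun z =>
      (pow_pos (one_pos.trans_le (hr1 z)) 5).ne'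
    refine Continuous.aestronglyMeasurable ?_
    simp only [hΨ]
    fun_prop
  · rw [norm_neg, norm_mul]
    by_cases hz : R < ‖regSeq n • z‖
    · rw [hR0 _ hz, norm_zero, mul_zero]
      have := hr1 z
      positivity
    · have hq := hQ n z (not_lt.1 hz)
      have hq0 : 0 ≤ regSeq n * r z :=
        mul_nonneg (regSeq_pos n).le (zero_le_one.trans (hr1 z))
      have h5 : ‖Ψ n z‖ ≤ (3 + 3 * |k| * (1 + R) + k ^ 2 * (1 + R) ^ 2) * (r z ^ 5)⁻¹ := by
        rw [hΨ]
        simp only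
        rw [norm_mul, norm_exp_I_mul_mul, one_mul, norm_mul, Complex.norm_real,
          norm_of_nonneg (inv_nonneg.2 (pow_nonneg (zero_le_one.trans (hr1 z)) 5))]
        have := hr1 z
        gcongr
        refine (norm_sub_le _ _).trans (add_le_add ((norm_sub_le _ _).trans (add_le_add ?_ ?_)) ?_)
        · simp
        · simp only [norm_mul, Complex.norm_I, Complex.norm_real, norm_neg, norm_eq_abs, mul_one]
          rw [show ‖(3 : ℂ)‖ = 3 by simp]
          rw [← abs_mul, abs_of_nonneg hq0]
          gcongr
        · simp only [norm_mul, norm_pow, Complex.norm_real, norm_neg, norm_eq_abs, sq_abs]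
          gcongr
          rwa [← abs_mul, abs_of_nonneg hq0]
      calc _ ≤ (3 + 3 * |k| * (1 + R) + k ^ 2 * (1 + R) ^ 2) * (r z ^ 5)⁻¹ * B := by
            gcongr
            · exact hB _
        _ = _ := by ring
  · refine Tendsto.neg ?_
    have hε : Tendsto (fun n => regSeq n * r z) atTop (nhds 0) := by
      simpa using tendsto_regSeq.mul_const (r z)
    have hε2 : Tendsto (fun n => g (regSeq n • z)) atTop (nhds (g 0)) := by
      refine (hg.tendsto 0).comp ?_
      simpa using tendsto_regSeq.smul_const z
    have hF : Continuous fun t : ℝ => Complex.exp (Complex.I * (-k : ℝ) * (t : ℂ)) *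
        ((3 - 3 * Complex.I * (-k : ℝ) * (t : ℂ) -
          (-k : ℝ) ^ 2 * (t : ℂ) ^ 2) * ((r z ^ 5)⁻¹ : ℝ)) := by fun_prop
    have h6 := ((hF.tendsto 0).comp hε).mul hε2
    simpa [hΨ] using h6

theorem integral_helmKernel_mul_helmholtz (k : ℝ) {g : E3 → ℂ} (hg : ContDiff ℝ 2 g)
    (hc : HasCompactSupport g) :
    ∫ z, helmKernel k z * (lap g z + k ^ 2 * g z) = -helmConst * g 0 := by
  have h0 : ∀ᵐ z : E3, z ≠ 0 := by simp [ae_iff]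
  have hq : Continuous fun z => lap g z + k ^ 2 * g z :=
    (continuous_lap hg).add (continuous_const.mul hg.continuous)
  have hlc : HasCompactSupport (lap g) := by
    have : lap g = fun x => ∑ j, pder j (pder j g) x := rfl
    rw [this]
    simp only [Fin.sum_univ_three]
    have h := fun j => hasCompactSupport_pder (hasCompactSupport_pder hc j) j
    exact ((h 0).add (h 1)).add (h 2)
  have hqc : HasCompactSupport fun z => lap g z + k ^ 2 * g z := hlc.add hc.mul_left
  have hA : ∀ n, ContDiff ℝ 2 (regKernel k (regSeq n ^ 2)) := fun n =>
    contDiff_regKernel k (pow_pos (regSeq_pos n) 2)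
  refine tendsto_nhds_unique (f := fun n => ∫ z, regKernel k (regSeq n ^ 2) z *
    (lap g z + k ^ 2 * g z)) (l := atTop) ?_ ?_
  · have hb : Integrable fun z => (‖z‖ ^ 1)⁻¹ * ‖lap g z + k ^ 2 * g z‖ :=
      (locallyIntegrable_inv_norm_pow one_le_two).integrable_smul_right_of_hasCompactSupport
        hq.norm hqc.norm
    refine tendsto_integral_of_dominated_convergence _
      (fun n => ((hA n).continuous.mul hq).aestronglyMeasurable) hb
      (fun n => h0.mono fun z hz => ?_) (h0.mono fun z hz => (tendsto_regKernel k hz).mul_const _)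
    rw [norm_mul]
    gcongr
    exact norm_regKernel_le k (sq_nonneg _) hz
  · convert tendsto_integral_regKernel_source k hg.continuous hc using 2 with n
    have hi1 : Integrable fun z => regKernel k (regSeq n ^ 2) z * lap g z :=
      ((hA n).continuous.mul (continuous_lap hg)).integrable_of_hasCompactSupport hlc.mul_left
    have hi2 : Integrable fun z => regKernel k (regSeq n ^ 2) z * (k ^ 2 * g z) :=
      ((hA n).continuous.mul (continuous_const.mul hg.continuous)).integrable_of_hasCompactSupport
        (hc.mul_left (f := fun _ => (k : ℂ) ^ 2)).mul_left
    have hi3 : Integrable fun z => lap (regKernel k (regSeq n ^ 2)) z * g z :=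
      ((continuous_lap (hA n)).mul hg.continuous).integrable_of_hasCompactSupport hc.mul_left
    simp_rw [mul_add, add_mul]
    rw [integral_add hi1 hi2, integral_mul_lap (hA n) hg hc, integral_add hi3]
    · congr 2
      ext z
      ring
    · refine hi2.congr (Eventually.of_forall fun z => ?_)
      simp only
      ring

theorem lap_helmPot (k : ℝ) {f : E3 → ℂ} (hf : ContDiff ℝ 2 f) (hc : HasCompactSupport f)
    (x : E3) : lap (helmPot k f) x + k ^ 2 * helmPot k f x = -helmConst * f x := by
  have hpp : ∀ j x, pder j (pder j (helmPot k f)) x = helmPot k (pder j (pder j f)) x := by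
    intro j x
    rw [pder_helmPot k (hf.of_le one_le_two) hc, pder_helmPot k
      (contDiff_pder (n := 1) hf (by norm_num) j) (hasCompactSupport_pder hc j)]
  have hg : ContDiff ℝ 2 fun z => f (x - z) := hf.comp (contDiff_const.sub contDiff_id)
  have hgc : HasCompactSupport fun z => f (x - z) :=
    hc.comp_homeomorph (Homeomorph.subLeft x)
  have hrefl : ∀ (j : Fin 3) (h : E3 → ℂ) (_ : Differentiable ℝ h) (z : E3),
      pder j (fun z => h (x - z)) z = -pder j h (x - z) := by
    intro j h hh z
    have := ((hh (x - z)).hasFDerivAt.comp z ((hasFDerivAt_id z).const_sub x)).fderiv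
    simp only [pder]
    rw [show fderiv ℝ (fun z => h (x - z)) z = _ from this]
    simp
  have hl : ∀ z, lap (fun z => f (x - z)) z = lap f (x - z) := by
    intro z
    simp only [lap]
    refine Finset.sum_congr rfl fun j _ => ?_
    have h1 := contDiff_pder (n := 1) hf (by norm_num) j
    rw [funext (hrefl j f (hf.differentiable two_ne_zero))]
    have h2 := pder_const_mul (f := fun z => pder j f (x - z)) (x := z)
      (((h1.comp (contDiff_const.sub contDiff_id)).differentiable one_ne_zero) z) (-1) j
    simp only [neg_one_mul] at h2
    rw [h2, hrefl j _ (h1.differentiable one_ne_zero), neg_neg]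
  have h := integral_helmKernel_mul_helmholtz k hg hgc
  simp only [hl, sub_zero] at h
  rw [← h]
  have hi : ∀ (g : E3 → ℂ), Continuous g → HasCompactSupport g →
      Integrable fun z => helmKernel k z * g (x - z) := fun g hg hgc =>
    (locallyIntegrable_helmKernel k).integrable_smul_right_of_hasCompactSupport
      (hg.comp (continuous_const.sub continuous_id)) (hgc.comp_homeomorph (Homeomorph.subLeft x))
  have hcp : ∀ j, Continuous (pder j (pder j f)) := fun j =>
    (contDiff_pder (n := 0) (contDiff_pder (n := 1) hf (by norm_num) j) (by norm_num) j).continuous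
  have hip := fun j => hi _ (hcp j) (hasCompactSupport_pder (hasCompactSupport_pder hc j) j)
  simp only [lap, hpp, helmPot, mul_add, Finset.mul_sum]
  rw [integral_add (integrable_finsetSum _ fun j _ => hip j)
    (((hi f hf.continuous hc).const_mul (k ^ 2)).congr (Eventually.of_forall fun z => by
      simp only; ring)), integral_finsetSum _ fun j _ => hip j, ← integral_const_mul]
  congr 2
  ext z
  ring

theorem contDiff_succ_of_pder {n : ℕ} {f : E3 → ℂ} (hf : Differentiable ℝ f)
    (h : ∀ j, ContDiff ℝ n (pder j f)) : ContDiff ℝ (n + 1 : ℕ) f := by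
  push_cast
  rw [contDiff_succ_iff_fderiv_apply]
  refine ⟨hf, by simp, fun y => ?_⟩
  simp_rw [fderiv_apply_eq_sum]
  exact ContDiff.sum fun j _ => contDiff_const.mul (h j)

theorem locallyIntegrable_pder_helmKernel (k : ℝ) (v : E3) :
    LocallyIntegrable fun z => fderiv ℝ (helmKernel k) z v := by
  have h0 : ∀ᵐ z : E3, z ≠ 0 := by simp [ae_iff]
  have hb : LocallyIntegrable fun z : E3 => ‖v‖ * (|k| * (‖z‖ ^ 1)⁻¹ + (‖z‖ ^ 2)⁻¹) :=
    (((locallyIntegrable_inv_norm_pow one_le_two).smul |k|).add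
      (locallyIntegrable_inv_norm_pow le_rfl)).smul ‖v‖
  refine hb.mono (measurable_fderiv_apply_const ℝ _ v).aestronglyMeasurable
    (h0.mono fun z hz => ?_)
  refine ((fderiv ℝ (helmKernel k) z).le_opNorm v).trans ?_
  rw [mul_comm]
  exact (mul_le_mul_of_nonneg_left (norm_fderiv_regKernel_le k le_rfl hz)
    (norm_nonneg v)).trans (le_abs_self _)

theorem integrable_smul_fderiv_helmKernel (k : ℝ) {f : E3 → ℂ} (hf : Continuous f)
    (hc : HasCompactSupport f) (x : E3) :
    Integrable fun z => f (x - z) • fderiv ℝ (helmKernel k) z := by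
  have h0 : ∀ᵐ z : E3, z ≠ 0 := by simp [ae_iff]
  have hb : LocallyIntegrable fun z : E3 => |k| * (‖z‖ ^ 1)⁻¹ + (‖z‖ ^ 2)⁻¹ :=
    ((locallyIntegrable_inv_norm_pow one_le_two).smul |k|).add
      (locallyIntegrable_inv_norm_pow le_rfl)
  have hl : LocallyIntegrable (fderiv ℝ (helmKernel k)) :=
    hb.mono (measurable_fderiv ℝ _).aestronglyMeasurable (h0.mono fun z hz =>
      (norm_fderiv_regKernel_le k le_rfl hz).trans (le_abs_self _))
  exact hl.integrable_smul_left_of_hasCompactSupport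
    (hf.comp (continuous_const.sub continuous_id)) (hc.comp_homeomorph (Homeomorph.subLeft x))

theorem fderiv_helmPot_apply (k : ℝ) {f : E3 → ℂ} (hf : Continuous f) (hc : HasCompactSupport f)
    (x v : E3) : fderiv ℝ (helmPot k f) x v =
      ∫ z, fderiv ℝ (helmKernel k) z v * f (x - z) := by
  rw [(hasFDerivAt_helmPot k hf hc x).fderiv, ContinuousLinearMap.integral_apply
    (integrable_smul_fderiv_helmKernel k hf hc x)]
  refine integral_congr_ae (Eventually.of_forall fun z => ?_)
  simp [mul_comm]

theorem contDiff_helmPot_succ (k : ℝ) (n : ℕ) : ∀ {f : E3 → ℂ}, ContDiff ℝ n f →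
    HasCompactSupport f → ContDiff ℝ (n + 1 : ℕ) (helmPot k f) := by
  induction n with
  | zero =>
    intro f hf hc
    have hf0 := hf.continuous
    refine contDiff_succ_of_pder (fun x => (hasFDerivAt_helmPot k hf0 hc x).differentiableAt)
      fun j => contDiff_zero.2 ?_
    have : pder j (helmPot k f) = convolution (fun z => fderiv ℝ (helmKernel k) z (e3 j)) f
        (ContinuousLinearMap.mul ℝ ℂ) volume := by
      ext x
      exact fderiv_helmPot_apply k hf0 hc x _
    rw [this]
    exact hc.continuous_convolution_right _ (locallyIntegrable_pder_helmKernel k _) hf0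
  | succ n ih =>
    intro f hf hc
    have h1 : ContDiff ℝ 1 f := hf.of_le (by norm_cast; omega)
    refine contDiff_succ_of_pder
      (fun x => (hasFDerivAt_helmPot k hf.continuous hc x).differentiableAt) fun j => ?_
    rw [pder_helmPot k h1 hc]
    exact ih (contDiff_pder hf (by push_cast; rfl) j) (hasCompactSupport_pder hc j)

theorem norm_helmKernel_rad_le (k : ℝ) {z x : E3} (hz : z ≠ 0) (hx : x ≠ 0) :
    ‖fderiv ℝ (helmKernel k) z (‖x‖⁻¹ • x) + Complex.I * k * helmKernel k z‖ ≤
      (‖z‖ ^ 2)⁻¹ * (2 * |k| * ‖x - z‖ + 1) := by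
  have hz0 : 0 < ‖z‖ := norm_pos_iff.2 hz
  have hx0 : 0 < ‖x‖ := norm_pos_iff.2 hx
  set v := ‖x‖⁻¹ • x with hv
  have hv1 : ‖v‖ = 1 := by
    rw [hv, norm_smul, norm_inv, norm_norm, inv_mul_cancel₀ hx0.ne']
  have hxv : inner ℝ x v = ‖x‖ := by
    rw [hv, real_inner_smul_right, real_inner_self_eq_norm_sq]
    field_simp
  set t : ℝ := inner ℝ z v with ht
  have ht1 : |t| ≤ ‖z‖ := by simpa [hv1] using abs_real_inner_le_norm z v
  have ht2 : |‖z‖ - t| ≤ 2 * ‖x - z‖ := by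
    have h1 : inner ℝ (x - z) v = ‖x‖ - t := by rw [inner_sub_left, hxv]
    have h2 : |‖x‖ - t| ≤ ‖x - z‖ := by
      rw [← h1]
      simpa [hv1] using abs_real_inner_le_norm (x - z) v
    have h3 := abs_norm_sub_norm_le x z
    calc |‖z‖ - t| = |(‖x‖ - t) - (‖x‖ - ‖z‖)| := by ring_nf
      _ ≤ |‖x‖ - t| + |‖x‖ - ‖z‖| := abs_sub _ _
      _ ≤ _ := by linarith
  have e : fderiv ℝ (helmKernel k) z v + Complex.I * k * helmKernel k z =
      Complex.exp (Complex.I * (-k : ℝ) * (‖z‖ : ℝ)) * (((‖z‖ ^ 2)⁻¹ : ℝ) *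
        (Complex.I * k * ((‖z‖ - t : ℝ) : ℂ) - ((t / ‖z‖ : ℝ) : ℂ))) := by
    rw [show fderiv ℝ (helmKernel k) z = _ from
      (hasFDerivAt_regKernel k (δ := 0) (z := z) (by positivity)).fderiv]
    have hzc : (‖z‖ : ℂ) ≠ 0 := by exact_mod_cast hz0.ne'
    simp only [helmKernel, regKernel, add_zero, radialSol, Real.sqrt_sq hz0.le,
      _root_.smul_apply, ContinuousLinearMap.comp_apply, innerSL_apply_apply, ← ht,
      Complex.ofRealCLM_apply, smul_eq_mul]
    push_cast
    field_simp
    ring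
  rw [e, norm_mul, norm_exp_I_mul_mul, one_mul, norm_mul, Complex.norm_real,
    norm_of_nonneg (by positivity)]
  gcongr
  refine (norm_sub_le _ _).trans (add_le_add ?_ ?_)
  · rw [norm_mul, norm_mul, Complex.norm_I, one_mul, Complex.norm_real, Complex.norm_real,
      norm_eq_abs, norm_eq_abs]
    nlinarith [abs_nonneg k]
  · rw [Complex.norm_real, norm_eq_abs, abs_div, abs_norm]
    exact div_le_one_of_le₀ ht1 hz0.le

theorem radCond_helmPot (k : ℝ) {f : E3 → ℂ} (hf : Continuous f) (hc : HasCompactSupport f) :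
    RadCond k (helmPot k f) := by
  obtain ⟨R, B, hR, hB0, hB, hR0⟩ := exists_norm_le_of_hasCompactSupport hf hc
  set M := 4 * (2 * |k| * R + 1) * ∫ z, ‖f z‖ with hM
  have hfi : Integrable fun z => ‖f z‖ := hf.norm.integrable_of_hasCompactSupport hc.norm
  have hM0 : 0 ≤ M := mul_nonneg (by positivity) (integral_nonneg fun _ => norm_nonneg _)
  have key : ∀ x : E3, 2 * R < ‖x‖ → ‖fderiv ℝ (helmPot k f) x (‖x‖⁻¹ • x) +
      Complex.I * k * helmPot k f x‖ ≤ M / ‖x‖ ^ 2 := by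
    intro x hx
    have hx0 : 0 < ‖x‖ := by linarith
    rw [fderiv_helmPot_apply k hf hc, helmPot, ← integral_const_mul, ← integral_add]
    · have e : M / ‖x‖ ^ 2 = ∫ z, 4 * (2 * |k| * R + 1) / ‖x‖ ^ 2 * ‖f (x - z)‖ := by
        rw [integral_const_mul, integral_sub_left_eq_self (fun z => ‖f z‖) volume x, hM]
        ring
      rw [e]
      refine norm_integral_le_of_norm_le ((hfi.comp_sub_left x).const_mul _)
        (Eventually.of_forall fun z => ?_)
      by_cases hz : R < ‖x - z‖
      · simp [hR0 _ hz]
      · have hz' := not_lt.1 hz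
        have h1 : ‖x‖ / 2 ≤ ‖z‖ := by
          have := norm_sub_norm_le x z
          linarith
        have hz0 : z ≠ 0 := norm_pos_iff.1 (by linarith)
        rw [← mul_assoc, ← add_mul, norm_mul]
        refine mul_le_mul_of_nonneg_right ((norm_helmKernel_rad_le k hz0
          (norm_pos_iff.1 hx0)).trans ?_) (norm_nonneg _)
        calc _ ≤ ((‖x‖ / 2) ^ 2)⁻¹ * (2 * |k| * R + 1) := by gcongr
          _ = _ := by field_simp; norm_num
    · exact (locallyIntegrable_pder_helmKernel k _).integrable_smul_right_of_hasCompactSupport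
        (hf.comp (continuous_const.sub continuous_id)) (hc.comp_homeomorph (Homeomorph.subLeft x))
    · exact ((locallyIntegrable_helmKernel k).integrable_smul_right_of_hasCompactSupport
        (hf.comp (continuous_const.sub continuous_id))
        (hc.comp_homeomorph (Homeomorph.subLeft x))).const_mul _
  intro ε hε
  refine ⟨max (2 * R + 1) (M / ε), fun x hx => ?_⟩
  have h1 : 2 * R < ‖x‖ := by linarith [(le_max_left _ _).trans hx]
  have h2 : M / ε ≤ ‖x‖ := (le_max_right _ _).trans hx
  have hx0 : 0 < ‖x‖ := by linarith
  calc _ ≤ ‖x‖ * (M / ‖x‖ ^ 2) := by gcongr; exact key x h1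
    _ = M / ‖x‖ := by field_simp
    _ ≤ ε := by rwa [div_le_iff₀ hx0, ← div_le_iff₀' hε]

theorem helmPot_add (k : ℝ) {f g : E3 → ℂ} (hf : Continuous f) (hfc : HasCompactSupport f)
    (hg : Continuous g) (hgc : HasCompactSupport g) (x : E3) :
    helmPot k (fun z => f z + g z) x = helmPot k f x + helmPot k g x := by
  simp only [helmPot, mul_add]
  have hi : ∀ {g : E3 → ℂ}, Continuous g → HasCompactSupport g →
      Integrable fun z => helmKernel k z * g (x - z) := fun hg hgc =>
    (locallyIntegrable_helmKernel k).integrable_smul_right_of_hasCompactSupport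
      (hg.comp (continuous_const.sub continuous_id)) (hgc.comp_homeomorph (Homeomorph.subLeft x))
  exact integral_add (hi hf hfc) (hi hg hgc)

theorem contDiff_planeWave (k : ℝ) {n : WithTop ℕ∞} : ContDiff ℝ n (planeWave k) :=
  (contDiff_const.mul (contDiff_coord 2)).cexp

theorem pder_planeWave (k : ℝ) (j : Fin 3) (x : E3) :
    pder j (planeWave k) x = (if (2 : Fin 3) = j then -Complex.I * k else 0) * planeWave k x := by
  have h1 := (((contDiff_coord 2 (n := 1)).differentiable one_ne_zero x).hasFDerivAt.const_mul
    (-Complex.I * k)).cexp.fderiv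
  have h2 := pder_coord 2 j x
  simp only [pder] at h2 ⊢
  rw [show fderiv ℝ (planeWave k) x = _ from h1]
  simp only [_root_.smul_apply, h2, smul_eq_mul, planeWave]
  split_ifs <;> ring

theorem lap_planeWave (k : ℝ) (x : E3) : lap (planeWave k) x + k ^ 2 * planeWave k x = 0 := by
  have h : ∀ j, pder j (pder j (planeWave k)) x =
      (if (2 : Fin 3) = j then -Complex.I * k else 0) ^ 2 * planeWave k x := by
    intro j
    rw [funext (pder_planeWave k j), pder_const_mul ((contDiff_planeWave k (n := 1)).differentiable
      one_ne_zero x), pder_planeWave]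
    ring
  simp only [lap, h, Fin.sum_univ_three]
  simp [mul_pow]

theorem RadCond.sub {k : ℝ} {v w : E3 → ℂ} (hv : RadCond k v) (hw : RadCond k w)
    (hvd : Differentiable ℝ v) (hwd : Differentiable ℝ w) :
    RadCond k fun x => v x - w x := by
  intro ε hε
  obtain ⟨R₁, h₁⟩ := hv (ε / 2) (by positivity)
  obtain ⟨R₂, h₂⟩ := hw (ε / 2) (by positivity)
  refine ⟨max R₁ R₂, fun x hx => ?_⟩
  have h3 := h₁ x ((le_max_left _ _).trans hx)
  have h4 := h₂ x ((le_max_right _ _).trans hx)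
  rw [fderiv_fun_sub (hvd x) (hwd x)]
  have e : (fderiv ℝ v x - fderiv ℝ w x) (‖x‖⁻¹ • x) + Complex.I * k * (v x - w x) =
      (fderiv ℝ v x (‖x‖⁻¹ • x) + Complex.I * k * v x) -
        (fderiv ℝ w x (‖x‖⁻¹ • x) + Complex.I * k * w x) := by
    simp only [_root_.sub_apply]
    ring
  rw [e]
  calc _ ≤ ‖x‖ * (_ + _) := mul_le_mul_of_nonneg_left (norm_sub_le _ _) (norm_nonneg x)
    _ ≤ ε := by rw [mul_add]; linarith

theorem RadCond.const_mul {k : ℝ} {v : E3 → ℂ} (hv : RadCond k v) (hvd : Differentiable ℝ v)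
    (c : ℂ) : RadCond k fun x => c * v x := by
  intro ε hε
  obtain ⟨R, h⟩ := hv (ε / (‖c‖ + 1)) (by positivity)
  refine ⟨R, fun x hx => ?_⟩
  have h1 := h x hx
  rw [fderiv_const_mul (hvd x)]
  have e : (c • fderiv ℝ v x) (‖x‖⁻¹ • x) + Complex.I * k * (c * v x) =
      c * (fderiv ℝ v x (‖x‖⁻¹ • x) + Complex.I * k * v x) := by
    simp only [_root_.smul_apply, smul_eq_mul]
    ring
  rw [le_div_iff₀ (by positivity)] at h1
  rw [e, norm_mul]
  nlinarith [mul_nonneg (norm_nonneg x)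
    (norm_nonneg (fderiv ℝ v x (‖x‖⁻¹ • x) + Complex.I * k * v x))]

/-- The Lippmann–Schwinger coefficient. -/
def lsCoef (k : ℝ) : ℂ := k ^ 2 / helmConst

theorem lsCoef_mul_helmConst (k : ℝ) : lsCoef k * helmConst = k ^ 2 :=
  div_mul_cancel₀ _ (by exact_mod_cast helmConst_pos.ne')

theorem lippmannSchwinger {k : ℝ} (hk : 0 < k) {b : E3 → ℝ} (hb : ContDiff ℝ 2 b)
    (hbc : HasCompactSupport b) {u : E3 → ℂ} (hu : ContDiff ℝ 2 u)
    (hH : ∀ x, lap u x + (k : ℂ) ^ 2 * (1 + b x) * u x = 0)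
    (hrad : RadCond k fun x => u x - planeWave k x) (x : E3) :
    u x = planeWave k x + lsCoef k * helmPot k (fun z => b z * u z) x := by
  have hbu : ContDiff ℝ 2 fun z => (b z : ℂ) * u z := (Complex.ofRealCLM.contDiff.comp hb).mul hu
  have hbuc : HasCompactSupport fun z => (b z : ℂ) * u z :=
    (hbc.comp_left (g := fun t : ℝ => (t : ℂ)) Complex.ofReal_zero).mul_right
  have hN : ContDiff ℝ 2 (helmPot k fun z => b z * u z) := contDiff_helmPot k hbu hbuc
  have hI := contDiff_planeWave k (n := 2)
  have h2 : (2 : WithTop ℕ∞) ≠ 0 := two_ne_zero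
  have hw := hu.sub hI
  have hcN : ContDiff ℝ 2 fun x => lsCoef k * helmPot k (fun z => b z * u z) x :=
    contDiff_const.mul hN
  have := eq_zero_of_radCond hk one_pos (hw.sub hcN) (β := fun _ => 0) continuous_const
    (fun _ _ => rfl) (fun x => ?_) (hrad.sub ((radCond_helmPot k hbu.continuous hbuc).const_mul
      (hN.differentiable h2) (lsCoef k)) (hw.differentiable h2) (hcN.differentiable h2)) x
  · linear_combination this
  · have e : lap (fun x => lsCoef k * helmPot k (fun z => b z * u z) x) x =
        lsCoef k * lap (helmPot k fun z => b z * u z) x := by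
      simp only [lap, Finset.mul_sum]
      refine Finset.sum_congr rfl fun j _ => ?_
      rw [funext fun y => pder_const_mul (hN.differentiable h2 y) (lsCoef k) j]
      exact pder_const_mul ((contDiff_pder (n := 1) hN (by norm_num) j).differentiable
        one_ne_zero x) _ _
    have h3 := lap_helmPot k hbu hbuc x
    have h4 := lap_planeWave k x
    have h5 := lsCoef_mul_helmConst k
    rw [lap_sub hw hcN x, lap_sub hu hI x, e]
    push_cast
    linear_combination hH x - h4 - lsCoef k * h3 + b x * u x * h5

theorem eq_zero_of_eq_helmPot {k : ℝ} (hk : 0 < k) {b : E3 → ℝ} (hb : ContDiff ℝ 2 b)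
    (hbc : HasCompactSupport b) {f : E3 → ℂ} (hf : Continuous f)
    (hfb : ∀ x, f x = b x * (lsCoef k * helmPot k f x)) : f = 0 := by
  have hbC : ContDiff ℝ 2 fun x => (b x : ℂ) := Complex.ofRealCLM.contDiff.comp hb
  have hfc : HasCompactSupport f := by
    have h : HasCompactSupport fun x => (b x : ℂ) * (lsCoef k * helmPot k f x) :=
      (hbc.comp_left (g := fun t : ℝ => (t : ℂ)) Complex.ofReal_zero).mul_right
    rwa [← funext hfb] at h
  have hstep : ∀ n : ℕ, n ≤ 2 → ContDiff ℝ n (helmPot k f) → ContDiff ℝ n f := by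
    intro n hn h
    have : ContDiff ℝ n fun x => (b x : ℂ) * (lsCoef k * helmPot k f x) :=
      (hbC.of_le (by exact_mod_cast hn)).mul (contDiff_const.mul h)
    rwa [← funext hfb] at this
  have hf1 : ContDiff ℝ 1 f :=
    hstep 1 one_le_two (contDiff_helmPot_succ k 0 (contDiff_zero.2 hf) hfc)
  have hf2 : ContDiff ℝ 2 f := hstep 2 le_rfl (contDiff_helmPot_succ k 1 hf1 hfc)
  have hN : ContDiff ℝ 2 (helmPot k f) := contDiff_helmPot k hf2 hfc
  obtain ⟨R, -, hR, -, -, hR0⟩ := exists_norm_le_of_hasCompactSupport hb.continuous hbc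
  have hz := eq_zero_of_radCond hk hR hN hb.continuous hR0 (fun x => ?_)
    (radCond_helmPot k hf hfc)
  · ext x
    rw [hfb x, hz x]
    simp
  · have h3 := lap_helmPot k hf2 hfc x
    have h5 := lsCoef_mul_helmConst k
    linear_combination h3 - helmConst * hfb x - b x * helmPot k f x * h5

/-- The closed ball of radius `ρ` about the origin, as a type. -/
abbrev CBall (ρ : ℝ) : Type := Metric.closedBall (0 : E3) ρ

instance (ρ : ℝ) : CompactSpace (CBall ρ) := isCompact_iff_compactSpace.1 (isCompact_closedBall 0 ρ)

/-- The Banach space of continuous functions on the closed ball of radius `ρ`. -/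
abbrev BallFun (ρ : ℝ) : Type := BoundedContinuousFunction (CBall ρ) ℂ

/-- The Banach algebra of continuous kernels on the closed ball of radius `ρ`. -/
abbrev BallKer (ρ : ℝ) : Type := C(CBall ρ × CBall ρ, ℂ)

instance (ρ : ℝ) : MeasureSpace (CBall ρ) := Measure.Subtype.measureSpace

theorem integrableOn_inv_norm_sub_pow {m : ℕ} (hm : m ≤ 2) (ρ : ℝ) (x : E3) :
    IntegrableOn (fun z : E3 => (‖x - z‖ ^ m)⁻¹) (Metric.closedBall 0 ρ) := by
  have h := ((locallyIntegrable_inv_norm_pow hm).integrableOn_isCompact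
    (isCompact_closedBall x ρ)).integrable_indicator Metric.isClosed_closedBall.measurableSet
  rw [← integrable_indicator_iff Metric.isClosed_closedBall.measurableSet]
  refine (h.comp_sub_left x).congr (Eventually.of_forall fun z => ?_)
  simp only [indicator, mem_closedBall_iff_norm, sub_zero, sub_sub_cancel_left,
    norm_neg]

theorem integrable_inv_norm_sub_pow {m : ℕ} (hm : m ≤ 2) (ρ : ℝ) (x : E3) :
    Integrable fun z : CBall ρ => (‖x - z‖ ^ m)⁻¹ :=
  (integrableOn_iff_comap_subtypeVal Metric.isClosed_closedBall.measurableSet).1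
    (integrableOn_inv_norm_sub_pow hm ρ x)

/-- A bound for the integrals of `|x - z|⁻ᵐ` over the ball of radius `ρ`. -/
def singBound (m : ℕ) (ρ : ℝ) : ℝ := ∫ z in Metric.closedBall (0 : E3) (2 * ρ), (‖z‖ ^ m)⁻¹

theorem singBound_nonneg (m : ℕ) (ρ : ℝ) : 0 ≤ singBound m ρ :=
  integral_nonneg fun _ => by positivity

theorem integral_inv_norm_sub_pow_le {m : ℕ} (hm : m ≤ 2) {ρ : ℝ} (x : CBall ρ) :
    ∫ z : CBall ρ, (‖(x : E3) - z‖ ^ m)⁻¹ ≤ singBound m ρ := by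
  have hx : ‖(x : E3)‖ ≤ ρ := mem_closedBall_zero_iff.1 x.2
  have hB := fun r : ℝ => (Metric.isClosed_closedBall (x := (0 : E3)) (ε := r)).measurableSet
  rw [show ∫ z : CBall ρ, (‖(x : E3) - z‖ ^ m)⁻¹ = _ from
    integral_subtype_comap (hB ρ) (fun z => (‖(x : E3) - z‖ ^ m)⁻¹), singBound,
    ← integral_indicator (hB _), ← integral_indicator (hB _),
    ← integral_sub_left_eq_self (indicator (Metric.closedBall 0 (2 * ρ)) _) volume (x : E3)]
  refine integral_mono ((integrableOn_inv_norm_sub_pow hm ρ x).integrable_indicator (hB _))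
    ((((locallyIntegrable_inv_norm_pow hm).integrableOn_isCompact
    (isCompact_closedBall 0 (2 * ρ))).integrable_indicator (hB _)).comp_sub_left _) fun z => ?_
  simp only [indicator, mem_closedBall_zero_iff]
  split_ifs with h1 h2
  · exact le_rfl
  · exact absurd ((norm_sub_le _ _).trans (by linarith)) h2
  · positivity
  · exact le_rfl

theorem abs_inv_sub_inv_le {r s d : ℝ} (hr : 0 ≤ r) (hs : 0 ≤ s) (h : |r - s| ≤ d) :
    |r⁻¹ - s⁻¹| ≤ d * ((r ^ 2)⁻¹ + (s ^ 2)⁻¹) := by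
  have hd : 0 ≤ d := (abs_nonneg _).trans h
  rcases hr.eq_or_lt with rfl | hr
  · rcases hs.eq_or_lt with rfl | hs
    · simp
    · have h1 : s ≤ d := by simpa [abs_of_pos hs] using h
      have h2 : |(0 : ℝ)⁻¹ - s⁻¹| = s * (s ^ 2)⁻¹ := by
        simp [abs_of_pos hs]
        field_simp
      rw [h2]
      simpa using mul_le_mul_of_nonneg_right h1 (by positivity : 0 ≤ (s ^ 2)⁻¹)
  · rcases hs.eq_or_lt with rfl | hs
    · have h1 : r ≤ d := by simpa [abs_of_pos hr] using h
      have h2 : |r⁻¹ - (0 : ℝ)⁻¹| = r * (r ^ 2)⁻¹ := by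
        simp [abs_of_pos hr]
        field_simp
      rw [h2]
      simpa using mul_le_mul_of_nonneg_right h1 (by positivity : 0 ≤ (r ^ 2)⁻¹)
    · have h1 : |r⁻¹ - s⁻¹| = |r - s| * (r⁻¹ * s⁻¹) := by
        rw [inv_sub_inv hr.ne' hs.ne', abs_div, abs_of_pos (mul_pos hr hs), abs_sub_comm]
        field_simp
      rw [h1, ← inv_pow, ← inv_pow]
      have : 0 < r⁻¹ := inv_pos.2 hr
      have : 0 < s⁻¹ := inv_pos.2 hs
      gcongr
      nlinarith [sq_nonneg (r⁻¹ - s⁻¹), sq_nonneg (r⁻¹ + s⁻¹)]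

/-- The weakly singular integral with kernel `φ(x, z) / |x - z|`. -/
def singInt {ρ : ℝ} (φ : BallKer ρ) (g : BallFun ρ) (x : CBall ρ) : ℂ :=
  ∫ z : CBall ρ, ((‖(x : E3) - z‖ ^ 1)⁻¹ : ℝ) * (φ (x, z) * g z)

theorem integrable_singInt {ρ : ℝ} (φ : BallKer ρ) (g : BallFun ρ) (x : CBall ρ) :
    Integrable fun z : CBall ρ => (((‖(x : E3) - z‖ ^ 1)⁻¹ : ℝ) : ℂ) * (φ (x, z) * g z) := by
  refine (integrable_inv_norm_sub_pow one_le_two ρ (x : E3)).ofReal.mul_bdd (c := ‖φ‖ * ‖g‖) ?_ ?_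
  · exact Continuous.aestronglyMeasurable (by fun_prop)
  · refine Eventually.of_forall fun z => ?_
    rw [norm_mul]
    exact mul_le_mul (φ.norm_coe_le_norm _) (g.norm_coe_le_norm _) (norm_nonneg _) (norm_nonneg _)

theorem norm_singInt_le {ρ : ℝ} (φ : BallKer ρ) (g : BallFun ρ) (x : CBall ρ) :
    ‖singInt φ g x‖ ≤ singBound 1 ρ * ‖φ‖ * ‖g‖ := by
  refine (norm_integral_le_of_norm_le ((integrable_inv_norm_sub_pow one_le_two ρ
    (x : E3)).mul_const (‖φ‖ * ‖g‖)) (Eventually.of_forall fun z => ?_)).trans ?_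
  · rw [norm_mul, norm_mul, Complex.norm_real, norm_of_nonneg (by positivity)]
    gcongr
    · exact φ.norm_coe_le_norm _
    · exact g.norm_coe_le_norm _
  · rw [integral_mul_const, mul_assoc]
    gcongr
    exact integral_inv_norm_sub_pow_le one_le_two x

/-- A modulus of continuity for weakly singular integrals. -/
def singModulus {ρ : ℝ} (φ : BallKer ρ) (x y : CBall ρ) : ℝ :=
  singBound 1 ρ * ‖φ.curry x - φ.curry y‖ + 2 * singBound 2 ρ * ‖φ‖ * dist x y

theorem norm_singInt_sub_le {ρ : ℝ} (φ : BallKer ρ) (g : BallFun ρ) (x y : CBall ρ) :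
    ‖singInt φ g x - singInt φ g y‖ ≤ singModulus φ x y * ‖g‖ := by
  rw [singInt, singInt, ← integral_sub (integrable_singInt φ g x) (integrable_singInt φ g y)]
  have i1 := integrable_inv_norm_sub_pow one_le_two ρ (x : E3)
  have i2 := fun x : CBall ρ => integrable_inv_norm_sub_pow (m := 2) le_rfl ρ (x : E3)
  refine (norm_integral_le_of_norm_le (((i1.mul_const (‖φ.curry x - φ.curry y‖ * ‖g‖))).add
    (((i2 x).add (i2 y)).mul_const (dist x y * ‖φ‖ * ‖g‖)))
    (Eventually.of_forall fun z => ?_)).trans ?_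
  · have e : (((‖(x : E3) - z‖ ^ 1)⁻¹ : ℝ) : ℂ) * (φ (x, z) * g z) -
        (((‖(y : E3) - z‖ ^ 1)⁻¹ : ℝ) : ℂ) * (φ (y, z) * g z) =
        (((‖(x : E3) - z‖ ^ 1)⁻¹ : ℝ) : ℂ) * ((φ.curry x - φ.curry y) z * g z) +
        (((‖(x : E3) - z‖)⁻¹ - (‖(y : E3) - z‖)⁻¹ : ℝ) : ℂ) * (φ (y, z) * g z) := by
      simp only [ContinuousMap.sub_apply, ContinuousMap.curry_apply, pow_one]
      push_cast
      ring
    rw [e]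
    refine (norm_add_le _ _).trans (add_le_add ?_ ?_)
    · rw [norm_mul, norm_mul, Complex.norm_real, norm_of_nonneg (by positivity)]
      exact mul_le_mul_of_nonneg_left (mul_le_mul ((φ.curry x - φ.curry y).norm_coe_le_norm z)
        (g.norm_coe_le_norm _) (norm_nonneg _) (norm_nonneg _)) (by positivity)
    · rw [norm_mul, norm_mul, Complex.norm_real, norm_eq_abs]
      have h1 := abs_inv_sub_inv_le (norm_nonneg ((x : E3) - z)) (norm_nonneg ((y : E3) - z))
        (d := dist x y) (by
          refine (abs_norm_sub_norm_le _ _).trans (le_of_eq ?_)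
          rw [Subtype.dist_eq, dist_eq_norm]
          congr 1
          abel)
      calc _ ≤ (dist x y * ((‖(x : E3) - z‖ ^ 2)⁻¹ + (‖(y : E3) - z‖ ^ 2)⁻¹)) * (‖φ‖ * ‖g‖) := by
            gcongr
            · exact φ.norm_coe_le_norm _
            · exact g.norm_coe_le_norm _
        _ = _ := by simp only [Pi.add_apply]; ring
  · rw [integral_add' (i1.mul_const _) (((i2 x).add (i2 y)).mul_const _), integral_mul_const,
      integral_mul_const, integral_add' (i2 x) (i2 y), singModulus]
    have h1 := integral_inv_norm_sub_pow_le one_le_two x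
    have h2 := fun x : CBall ρ => integral_inv_norm_sub_pow_le (m := 2) le_rfl x
    calc _ ≤ singBound 1 ρ * (‖φ.curry x - φ.curry y‖ * ‖g‖) +
          (singBound 2 ρ + singBound 2 ρ) * (dist x y * ‖φ‖ * ‖g‖) := by
          gcongr
          · exact h2 x
          · exact h2 y
      _ = _ := by ring

theorem tendsto_singModulus {ρ : ℝ} (φ : BallKer ρ) (x : CBall ρ) :
    Tendsto (fun y => singModulus φ x y) (nhds x) (nhds 0) := by
  have : Continuous fun y => singModulus φ x y := by
    unfold singModulus
    fun_prop
  simpa [singModulus] using this.tendsto x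

theorem continuous_singInt {ρ : ℝ} (φ : BallKer ρ) (g : BallFun ρ) : Continuous (singInt φ g) := by
  rw [continuous_iff_continuousAt]
  intro x
  rw [ContinuousAt, tendsto_iff_norm_sub_tendsto_zero]
  refine squeeze_zero (fun _ => norm_nonneg _) (fun y => ?_)
    (by simpa using (tendsto_singModulus φ x).mul_const ‖g‖)
  rw [norm_sub_rev]
  exact norm_singInt_sub_le φ g x y

/-- The weakly singular integral operators, linear in the kernel. -/
def singOp (ρ : ℝ) : BallKer ρ →L[ℂ] BallFun ρ →L[ℂ] BallFun ρ :=
  LinearMap.mkContinuous₂ (LinearMap.mk₂ ℂ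
    (fun φ g => BoundedContinuousFunction.ofNormedAddCommGroup (singInt φ g)
      (continuous_singInt φ g) _ (norm_singInt_le φ g))
    (fun φ ψ g => by
      ext x
      simp only [BoundedContinuousFunction.coe_ofNormedAddCommGroup,
        BoundedContinuousFunction.add_apply]
      rw [singInt, singInt, singInt, ← integral_add (integrable_singInt φ g x)
        (integrable_singInt ψ g x)]
      congr 1
      ext z
      simp only [ContinuousMap.add_apply]
      ring)
    (fun c φ g => by
      ext x
      simp only [BoundedContinuousFunction.coe_ofNormedAddCommGroup,
        BoundedContinuousFunction.coe_smul]
      rw [singInt, singInt, smul_eq_mul, ← integral_const_mul]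
      congr 1
      ext z
      simp only [ContinuousMap.smul_apply, smul_eq_mul]
      ring)
    (fun φ g h => by
      ext x
      simp only [BoundedContinuousFunction.coe_ofNormedAddCommGroup,
        BoundedContinuousFunction.add_apply]
      rw [singInt, singInt, singInt, ← integral_add (integrable_singInt φ g x)
        (integrable_singInt φ h x)]
      congr 1
      ext z
      simp only [BoundedContinuousFunction.add_apply]
      ring)
    (fun c φ g => by
      ext x
      simp only [BoundedContinuousFunction.coe_ofNormedAddCommGroup,
        BoundedContinuousFunction.coe_smul]
      rw [singInt, singInt, smul_eq_mul, ← integral_const_mul]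
      congr 1
      ext z
      simp only [BoundedContinuousFunction.coe_smul, smul_eq_mul]
      ring)) (singBound 1 ρ) fun φ g =>
    BoundedContinuousFunction.norm_ofNormedAddCommGroup_le (continuous_singInt φ g)
      (mul_nonneg (mul_nonneg (singBound_nonneg 1 ρ) (norm_nonneg _)) (norm_nonneg _))
      (norm_singInt_le φ g)

theorem singOp_apply {ρ : ℝ} (φ : BallKer ρ) (g : BallFun ρ) (x : CBall ρ) :
    singOp ρ φ g x = singInt φ g x := rfl

theorem isCompactOperator_singOp {ρ : ℝ} (φ : BallKer ρ) : IsCompactOperator (singOp ρ φ) := by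
  refine ⟨closure (singOp ρ φ '' Metric.closedBall 0 1), ?_, ?_⟩
  · refine BoundedContinuousFunction.arzela_ascoli
      (Metric.closedBall 0 (singBound 1 ρ * ‖φ‖ * 1)) (isCompact_closedBall _ _) _ ?_ ?_
    · rintro _ x ⟨g, hg, rfl⟩
      have hg' : ‖g‖ ≤ 1 := by simpa using hg
      rw [mem_closedBall_zero_iff, singOp_apply]
      refine (norm_singInt_le φ g x).trans (mul_le_mul_of_nonneg_left hg' ?_)
      exact mul_nonneg (singBound_nonneg 1 ρ) (norm_nonneg _)
    · intro x
      refine Metric.equicontinuousAt_of_continuity_modulus (fun y => singModulus φ x y)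
        (tendsto_singModulus φ x) _ (Eventually.of_forall fun y => ?_)
      rintro ⟨_, g, hg, rfl⟩
      have hg' : ‖g‖ ≤ 1 := by simpa using hg
      rw [dist_eq_norm]
      refine (norm_singInt_sub_le φ g x y).trans (mul_le_of_le_one_right ?_ hg')
      have := singBound_nonneg 1 ρ
      have := singBound_nonneg 2 ρ
      unfold singModulus
      positivity
  · exact mem_of_superset (Metric.closedBall_mem_nhds 0 one_pos) fun g hg =>
      subset_closure (mem_image_of_mem _ hg)

theorem contDiff_exp_smul {A : Type*} [NormedRing A] [NormedAlgebra ℂ A] [CompleteSpace A]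
    {n : WithTop ℕ∞} (a : A) : ContDiff ℝ n fun k : ℝ => NormedSpace.exp ((k : ℂ) • a) := by
  let _ : NormedAlgebra ℝ A := NormedAlgebra.restrictScalars ℝ ℂ A
  have h : ContDiff ℝ n (NormedSpace.exp : A → A) := contDiff_iff_contDiffAt.2 fun x =>
    (NormedSpace.exp_analytic (𝕂 := ℝ) x).contDiffAt
  exact h.comp (Complex.ofRealCLM.contDiff.smul contDiff_const)

/-- The kernel `exp(-ik|x - z|)`, as an exponential in the Banach algebra of kernels. -/
def expKer (ρ k : ℝ) : BallKer ρ :=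
  NormedSpace.exp ((k : ℂ) • (⟨fun p => -Complex.I * ‖(p.1 : E3) - p.2‖, by fun_prop⟩ : BallKer ρ))

theorem expKer_apply (ρ k : ℝ) (x z : CBall ρ) :
    expKer ρ k (x, z) = Complex.exp (-Complex.I * k * ‖(x : E3) - z‖) := by
  have h := NormedSpace.map_exp (ContinuousMap.evalAlgHom ℂ ℂ (x, z)) (continuous_eval_const (x, z))
    ((k : ℂ) • (⟨fun p => -Complex.I * ‖(p.1 : E3) - p.2‖, by fun_prop⟩ : BallKer ρ))
  rw [← Complex.exp_eq_exp_ℂ] at h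
  refine h.trans ?_
  simp
  ring_nf

theorem contDiff_expKer (ρ : ℝ) {n : WithTop ℕ∞} : ContDiff ℝ n (expKer ρ) := contDiff_exp_smul _

/-- The restriction of a continuous function to the ball. -/
def ballRestrict (ρ : ℝ) {f : E3 → ℂ} (hf : Continuous f) : BallFun ρ :=
  BoundedContinuousFunction.mkOfCompact ⟨fun x => f x, hf.comp continuous_subtype_val⟩

theorem ballRestrict_apply (ρ : ℝ) {f : E3 → ℂ} (hf : Continuous f) (x : CBall ρ) :
    ballRestrict ρ hf x = f x := rfl

/-- The incident plane wave on the ball. -/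
def ballWave (ρ k : ℝ) : BallFun ρ :=
  NormedSpace.exp ((k : ℂ) • ballRestrict ρ (f := fun x => -Complex.I * (x 2 : ℝ)) (by fun_prop))

theorem ballWave_apply (ρ k : ℝ) (x : CBall ρ) : ballWave ρ k x = planeWave k x := by
  let φ : BallFun ρ →+* ℂ :=
    { toFun := fun f => f x
      map_one' := rfl
      map_mul' := fun _ _ => rfl
      map_zero' := rfl
      map_add' := fun _ _ => rfl }
  have h := NormedSpace.map_exp φ (BoundedContinuousFunction.evalCLM ℂ x).continuous
    ((k : ℂ) • ballRestrict ρ (f := fun x => -Complex.I * (x 2 : ℝ)) (by fun_prop))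
  rw [← Complex.exp_eq_exp_ℂ] at h
  refine h.trans ?_
  change Complex.exp ((k : ℂ) * (-Complex.I * ((x : E3) 2 : ℝ))) = _
  rw [planeWave]
  congr 1
  ring

theorem contDiff_ballWave (ρ : ℝ) {n : WithTop ℕ∞} : ContDiff ℝ n (ballWave ρ) :=
  contDiff_exp_smul _

theorem singOp_expKer_apply {ρ k : ℝ} {f : E3 → ℂ} {g : BallFun ρ} (hfg : ∀ x : CBall ρ, g x = f x)
    (hf : ∀ x, ρ < ‖x‖ → f x = 0) (x : CBall ρ) :
    singOp ρ (expKer ρ k) g x = helmPot k f x := by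
  have e1 : helmPot k f x = ∫ z, helmKernel k ((x : E3) - z) * f z := by
    rw [helmPot, ← integral_sub_left_eq_self _ volume (x : E3)]
    simp
  have e2 : ∫ z, helmKernel k ((x : E3) - z) * f z =
      ∫ z in Metric.closedBall (0 : E3) ρ, helmKernel k ((x : E3) - z) * f z := by
    refine (setIntegral_eq_integral_of_forall_compl_eq_zero fun z hz => ?_).symm
    rw [hf z (by simpa using hz), mul_zero]
  rw [e1, e2, ← integral_subtype_comap Metric.isClosed_closedBall.measurableSet, singOp_apply,
    singInt]
  refine integral_congr_ae (Eventually.of_forall fun z => ?_)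
  simp only
  rw [expKer_apply, helmKernel_eq, hfg]
  push_cast
  ring

/-- The Lippmann–Schwinger operator on the ball. -/
def lsOp (ρ : ℝ) {b : E3 → ℝ} (hb : Continuous b) (k : ℝ) : BallFun ρ →L[ℂ] BallFun ρ :=
  lsCoef k • (singOp ρ (expKer ρ k)).comp (ContinuousLinearMap.mul ℂ (BallFun ρ)
    (ballRestrict ρ (Complex.continuous_ofReal.comp hb)))

theorem contDiff_lsCoef {n : WithTop ℕ∞} : ContDiff ℝ n lsCoef :=
  (Complex.ofRealCLM.contDiff.pow 2).div_const _

theorem contDiff_singOp_expKer (ρ : ℝ) {n : WithTop ℕ∞} :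
    ContDiff ℝ n fun k => singOp ρ (expKer ρ k) := by
  have h : ContDiff ℝ n fun φ => singOp ρ φ :=
    (singOp ρ).isBoundedLinearMap.contDiff.restrict_scalars ℝ
  exact h.comp (contDiff_expKer ρ)

theorem contDiff_lsOp (ρ : ℝ) {b : E3 → ℝ} (hb : Continuous b) {n : WithTop ℕ∞} :
    ContDiff ℝ n (lsOp ρ hb) := by
  refine contDiff_lsCoef.smul ?_
  exact ((((ContinuousLinearMap.compL ℂ (BallFun ρ) (BallFun ρ) (BallFun ρ)).flip
    (ContinuousLinearMap.mul ℂ (BallFun ρ)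
    (ballRestrict ρ (Complex.continuous_ofReal.comp hb)))).restrictScalars ℝ).contDiff).comp
    (contDiff_singOp_expKer ρ)

theorem lsOp_apply {ρ k : ℝ} {b : E3 → ℝ} (hb : Continuous b) (hbρ : ∀ x, ρ < ‖x‖ → b x = 0)
    {w : E3 → ℂ} {g : BallFun ρ} (hg : ∀ x : CBall ρ, g x = w x) (x : CBall ρ) :
    lsOp ρ hb k g x = lsCoef k * helmPot k (fun z => b z * w z) x := by
  rw [← singOp_expKer_apply (g := ballRestrict ρ (Complex.continuous_ofReal.comp hb) * g) (fun z => ?_)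
    fun z hz => ?_]
  · rfl
  · rw [BoundedContinuousFunction.mul_apply, hg]
    rfl
  · simp [hbρ z hz]

theorem isUnit_one_sub_lsOp {ρ k : ℝ} (hk : 0 < k) {b : E3 → ℝ} (hb : ContDiff ℝ 2 b)
    (hbρ : ∀ x, ρ < ‖x‖ → b x = 0) : IsUnit (1 - lsOp ρ hb.continuous k) := by
  have hc : IsCompactOperator (lsOp ρ hb.continuous k) :=
    ((isCompactOperator_singOp (expKer ρ k)).comp_clm _).smul (lsCoef k)
  have hbc : HasCompactSupport b := HasCompactSupport.intro (isCompact_closedBall 0 ρ)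
    fun x hx => hbρ x (by simpa using hx)
  rcases hc.hasEigenvalue_or_mem_resolventSet one_ne_zero with h | h
  · exfalso
    obtain ⟨g, hg⟩ := h.exists_hasEigenvector
    have hg0 := hg.2
    have hge : lsOp ρ hb.continuous k g = g := by simpa using hg.apply_eq_smul
    obtain ⟨G, hG⟩ := ContinuousMap.exists_restrict_eq (Metric.isClosed_closedBall (x := (0 : E3))
      (ε := ρ)) g.toContinuousMap
    have hG' : ∀ x : CBall ρ, g x = G x := fun x => (DFunLike.congr_fun hG x).symm
    have hgx : ∀ x : CBall ρ, g x = lsCoef k * helmPot k (fun z => b z * G z) x := fun x => by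
      rw [← lsOp_apply hb.continuous hbρ hG', hge]
    have hf := eq_zero_of_eq_helmPot hk hb hbc (f := fun z => b z * G z)
      ((Complex.continuous_ofReal.comp hb.continuous).mul G.continuous) fun x => by
        by_cases hx : ρ < ‖x‖
        · simp [hbρ x hx]
        · have h1 := hgx ⟨x, by simpa using hx⟩
          rw [hG'] at h1
          rw [← h1]
    refine hg0 ?_
    ext x
    rw [hgx, hf]
    simp [helmPot]
  · simpa [resolventSet] using h

theorem ContDiffOn.complex_clm_apply {V W : Type*} [NormedAddCommGroup V] [NormedSpace ℂ V]
    [NormedAddCommGroup W] [NormedSpace ℂ W] {T : ℝ → V →L[ℂ] W} {f : ℝ → V} {s : Set ℝ}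
    {n : WithTop ℕ∞} (hT : ContDiffOn ℝ n T s) (hf : ContDiffOn ℝ n f s) :
    ContDiffOn ℝ n (fun k => T k (f k)) s :=
  ((ContinuousLinearMap.restrictScalarsL ℂ V W ℝ ℝ).contDiff.comp_contDiffOn hT).clm_apply hf

theorem ContDiffAt.ring_inverse {A : Type*} [NormedRing A] [NormedAlgebra ℂ A] [CompleteSpace A]
    {n : WithTop ℕ∞} {f : ℝ → A} {k : ℝ} (hf : ContDiffAt ℝ n f k) (hu : IsUnit (f k)) :
    ContDiffAt ℝ n (fun k => Ring.inverse (f k)) k := by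
  let _ : NormedAlgebra ℝ A := NormedAlgebra.restrictScalars ℝ ℂ A
  obtain ⟨v, hv⟩ := hu
  have h := contDiffAt_ringInverse ℝ (n := n) v
  rw [hv] at h
  exact h.comp k hf

/-- A family of functions whose restriction to the ball depends smoothly on `k > 0`, as a map into
the continuous functions. -/
def SmoothFam (ρ : ℝ) (F : ℝ → E3 → ℂ) : Prop :=
  ∃ U : ℝ → BallFun ρ, ContDiffOn ℝ (⊤ : ℕ∞) U (Ioi 0) ∧
    ∀ k, 0 < k → ∀ x : CBall ρ, U k x = F k x

section
variable {ρ : ℝ} {F G : ℝ → E3 → ℂ}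

theorem SmoothFam.congr (hF : SmoothFam ρ F) (h : ∀ k, 0 < k → F k = G k) : SmoothFam ρ G := by
  obtain ⟨U, hU, hUF⟩ := hF
  exact ⟨U, hU, fun k hk x => by rw [hUF k hk, h k hk]⟩

theorem SmoothFam.add (hF : SmoothFam ρ F) (hG : SmoothFam ρ G) :
    SmoothFam ρ fun k x => F k x + G k x := by
  obtain ⟨U, hU, hUF⟩ := hF
  obtain ⟨V, hV, hVG⟩ := hG
  exact ⟨fun k => U k + V k, hU.add hV, fun k hk x => by
    rw [BoundedContinuousFunction.add_apply, hUF k hk, hVG k hk]⟩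

theorem SmoothFam.mul_left {b : E3 → ℂ} (hb : Continuous b) (hF : SmoothFam ρ F) :
    SmoothFam ρ fun k x => b x * F k x := by
  obtain ⟨U, hU, hUF⟩ := hF
  refine ⟨fun k => ballRestrict ρ hb * U k, contDiffOn_const.mul hU, fun k hk x => ?_⟩
  rw [BoundedContinuousFunction.mul_apply, hUF k hk, ballRestrict_apply]

theorem SmoothFam.const_mul {c : ℝ → ℂ} (hc : ContDiff ℝ (⊤ : ℕ∞) c) (hF : SmoothFam ρ F) :
    SmoothFam ρ fun k x => c k * F k x := by
  obtain ⟨U, hU, hUF⟩ := hF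
  refine ⟨fun k => c k • U k, hc.contDiffOn.smul hU, fun k hk x => ?_⟩
  rw [BoundedContinuousFunction.smul_apply, hUF k hk, smul_eq_mul]

theorem smoothFam_planeWave : SmoothFam ρ planeWave :=
  ⟨ballWave ρ, (contDiff_ballWave ρ).contDiffOn, fun k _ x => ballWave_apply ρ k x⟩

theorem SmoothFam.pot (hF : SmoothFam ρ F) (hF0 : ∀ k, 0 < k → ∀ x, ρ < ‖x‖ → F k x = 0) :
    SmoothFam ρ fun k => helmPot k (F k) := by
  obtain ⟨U, hU, hUF⟩ := hF
  exact ⟨fun k => singOp ρ (expKer ρ k) (U k),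
    (contDiff_singOp_expKer ρ).contDiffOn.complex_clm_apply hU,
    fun k hk x => singOp_expKer_apply (hUF k hk) (hF0 k hk) x⟩

theorem SmoothFam.of_eq_add_pot {b : E3 → ℝ} (hb : ContDiff ℝ 2 b)
    (hbρ : ∀ x, ρ < ‖x‖ → b x = 0) (hF : SmoothFam ρ F) (hG : ∀ k, 0 < k → Continuous (G k))
    (h : ∀ k, 0 < k → ∀ x, G k x = F k x + lsCoef k * helmPot k (fun z => b z * G k z) x) :
    SmoothFam ρ G := by
  obtain ⟨U, hU, hUF⟩ := hF
  refine ⟨fun k => Ring.inverse (1 - lsOp ρ hb.continuous k) (U k), ContDiffOn.complex_clm_apply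
    (fun k hk => ((contDiffAt_const.sub (contDiff_lsOp ρ hb.continuous).contDiffAt).ring_inverse
      (isUnit_one_sub_lsOp hk hb hbρ)).contDiffWithinAt) hU, fun k hk x => ?_⟩
  · have h1 : (1 - lsOp ρ hb.continuous k) (ballRestrict ρ (hG k hk)) = U k := by
      ext y
      rw [hUF k hk]
      have := lsOp_apply (k := k) hb.continuous hbρ (fun z => ballRestrict_apply ρ (hG k hk) z) y
      rw [_root_.sub_apply, BoundedContinuousFunction.sub_apply, this]
      change G k y - _ = _
      rw [h k hk y]
      ring
    have h2 : Ring.inverse (1 - lsOp ρ hb.continuous k) (U k) = ballRestrict ρ (hG k hk) := by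
      rw [← h1, ← mul_apply_eq_comp, Ring.inverse_mul_cancel _
        (isUnit_one_sub_lsOp hk hb hbρ)]
      rfl
    simp only [h2, ballRestrict_apply]
end

/-- Families of functions of class `C^m` whose partial derivatives of order at most `m` depend
smoothly on `k > 0`, uniformly on the ball. -/
def SmoothFamReg (ρ : ℝ) : ℕ → (ℝ → E3 → ℂ) → Prop
  | 0, F => SmoothFam ρ F ∧ ∀ k, 0 < k → Continuous (F k)
  | m + 1, F => SmoothFam ρ F ∧ (∀ k, 0 < k → ContDiff ℝ (m + 1 : ℕ) (F k)) ∧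
      ∀ j, SmoothFamReg ρ m fun k => pder j (F k)

namespace SmoothFamReg
variable {ρ : ℝ} {m : ℕ} {F G : ℝ → E3 → ℂ}

theorem smoothFam (h : SmoothFamReg ρ m F) : SmoothFam ρ F := by
  cases m <;> exact h.1

theorem contDiff (h : SmoothFamReg ρ m F) {k : ℝ} (hk : 0 < k) : ContDiff ℝ m (F k) := by
  cases m with
  | zero => exact contDiff_zero.2 (h.2 k hk)
  | succ m => exact h.2.1 k hk

theorem differentiable (h : SmoothFamReg ρ (m + 1) F) {k : ℝ} (hk : 0 < k) :
    Differentiable ℝ (F k) :=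
  (h.contDiff hk).differentiable (by simp)

theorem congr (hF : SmoothFamReg ρ m F) (h : ∀ k, 0 < k → F k = G k) : SmoothFamReg ρ m G := by
  induction m generalizing F G with
  | zero => exact ⟨hF.1.congr h, fun k hk => h k hk ▸ hF.2 k hk⟩
  | succ m ih => exact ⟨hF.1.congr h, fun k hk => h k hk ▸ hF.2.1 k hk,
      fun j => ih (hF.2.2 j) fun k hk => by rw [h k hk]⟩

theorem of_succ (hF : SmoothFamReg ρ (m + 1) F) : SmoothFamReg ρ m F := by
  induction m generalizing F with
  | zero => exact ⟨hF.1, fun k hk => (hF.contDiff hk).continuous⟩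
  | succ m ih => exact ⟨hF.1, fun k hk => (hF.2.1 k hk).of_le (by norm_cast; omega),
      fun j => ih (hF.2.2 j)⟩

theorem add (hF : SmoothFamReg ρ m F) (hG : SmoothFamReg ρ m G) :
    SmoothFamReg ρ m fun k x => F k x + G k x := by
  induction m generalizing F G with
  | zero => exact ⟨hF.1.add hG.1, fun k hk => (hF.2 k hk).add (hG.2 k hk)⟩
  | succ m ih =>
    refine ⟨hF.1.add hG.1, fun k hk => (hF.2.1 k hk).add (hG.2.1 k hk), fun j => ?_⟩
    refine (ih (hF.2.2 j) (hG.2.2 j)).congr fun k hk => funext fun x => ?_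
    exact (pder_add (hF.differentiable hk x) (hG.differentiable hk x) j).symm

theorem mul_left {b : E3 → ℂ} (hb : ContDiff ℝ m b) (hF : SmoothFamReg ρ m F) :
    SmoothFamReg ρ m fun k x => b x * F k x := by
  induction m generalizing F b with
  | zero => exact ⟨hF.1.mul_left hb.continuous, fun k hk => hb.continuous.mul (hF.2 k hk)⟩
  | succ m ih =>
    refine ⟨hF.1.mul_left hb.continuous, fun k hk => hb.mul (hF.2.1 k hk), fun j => ?_⟩
    refine ((ih (contDiff_pder hb (by norm_cast) j) hF.of_succ).add (ih (hb.of_le (by norm_cast; omega)) (hF.2.2 j))).congr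
      fun k hk => funext fun x => ?_
    exact (pder_mul (hb.differentiable (by simp) x) (hF.differentiable hk x) j).symm

theorem const_mul {c : ℝ → ℂ} (hc : ContDiff ℝ (⊤ : ℕ∞) c) (hF : SmoothFamReg ρ m F) :
    SmoothFamReg ρ m fun k x => c k * F k x := by
  induction m generalizing F with
  | zero => exact ⟨hF.1.const_mul hc, fun k hk => continuous_const.mul (hF.2 k hk)⟩
  | succ m ih =>
    refine ⟨hF.1.const_mul hc, fun k hk => contDiff_const.mul (hF.2.1 k hk), fun j => ?_⟩
    refine (ih (hF.2.2 j)).congr fun k hk => funext fun x => ?_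
    exact (pder_const_mul (hF.differentiable hk x) _ j).symm

theorem planeWave : SmoothFamReg ρ m planeWave := by
  induction m with
  | zero => exact ⟨smoothFam_planeWave, fun k _ => (contDiff_planeWave k (n := 0)).continuous⟩
  | succ m ih =>
    refine ⟨smoothFam_planeWave, fun k _ => contDiff_planeWave k, fun j => ?_⟩
    refine (ih.const_mul (c := fun k => if (2 : Fin 3) = j then -Complex.I * k else 0)
      ?_).congr fun k hk => funext fun x => (pder_planeWave k j x).symm
    split_ifs
    · exact contDiff_const.mul Complex.ofRealCLM.contDiff
    · exact contDiff_const

theorem pot (hF : SmoothFamReg ρ m F) (hF0 : ∀ k, 0 < k → ∀ x, ρ < ‖x‖ → F k x = 0) :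
    SmoothFamReg ρ m fun k => helmPot k (F k) := by
  have hc : ∀ k, 0 < k → HasCompactSupport (F k) := fun k hk =>
    HasCompactSupport.intro (isCompact_closedBall 0 ρ) fun x hx => hF0 k hk x (by simpa using hx)
  induction m generalizing F with
  | zero => exact ⟨hF.1.pot hF0, fun k hk =>
      (contDiff_helmPot k (n := 0) (hF.contDiff hk) (hc k hk)).continuous⟩
  | succ m ih =>
    refine ⟨hF.1.pot hF0, fun k hk => contDiff_helmPot k (hF.2.1 k hk) (hc k hk), fun j => ?_⟩
    refine (ih (hF.2.2 j) (fun k hk x hx => ?_) fun k hk => hasCompactSupport_pder (hc k hk) j).congr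
      fun k hk => (pder_helmPot k ((hF.2.1 k hk).of_le (by norm_cast; omega)) (hc k hk) j).symm
    have h0 : F k =ᶠ[nhds x] fun _ => 0 := by
      filter_upwards [(isOpen_lt continuous_const continuous_norm).mem_nhds hx] with y hy
      exact hF0 k hk y hy
    rw [pder, h0.fderiv_eq]
    simp

theorem of_eq_add_pot {b : E3 → ℝ} (hb : ContDiff ℝ (m + 2 : ℕ) b)
    (hbρ : ∀ x, ρ < ‖x‖ → b x = 0) (hF : SmoothFamReg ρ m F)
    (hG : ∀ k, 0 < k → ContDiff ℝ m (G k))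
    (h : ∀ k, 0 < k → ∀ x, G k x = F k x + lsCoef k * helmPot k (fun z => b z * G k z) x) :
    SmoothFamReg ρ m G := by
  have hb2 : ContDiff ℝ 2 b := hb.of_le (by norm_cast; omega)
  have hbc : ContDiff ℝ (m + 2 : ℕ) fun x => (b x : ℂ) := Complex.ofRealCLM.contDiff.comp hb
  induction m generalizing F G with
  | zero => exact ⟨hF.1.of_eq_add_pot hb2 hbρ (fun k hk => (hG k hk).continuous) h,
      fun k hk => (hG k hk).continuous⟩
  | succ m ih =>
    have hGm : SmoothFamReg ρ m G := ih (hb.of_le (by norm_cast; omega)) hF.of_succ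
      (fun k hk => (hG k hk).of_le (by norm_cast; omega)) h (hbc.of_le (by norm_cast; omega))
    refine ⟨hGm.smoothFam, hG, fun j => ?_⟩
    have hb' : ContDiff ℝ m (pder j fun x => (b x : ℂ)) :=
      contDiff_pder hbc (by norm_cast; omega) j
    have hb0 : ∀ x, ρ < ‖x‖ → pder j (fun x => (b x : ℂ)) x = 0 := fun x hx => by
      have h0 : (fun x => (b x : ℂ)) =ᶠ[nhds x] fun _ => 0 := by
        filter_upwards [(isOpen_lt continuous_const continuous_norm).mem_nhds hx] with y hy
        simp [hbρ y hy]
      rw [pder, h0.fderiv_eq]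
      simp
    have hcs : HasCompactSupport fun x => (b x : ℂ) :=
      HasCompactSupport.intro (isCompact_closedBall 0 ρ) fun x hx => by
        simp [hbρ x (by simpa using hx)]
    have hR := (hF.2.2 j).add (((hGm.mul_left hb').pot
      fun k hk x hx => by rw [hb0 x hx, zero_mul]).const_mul contDiff_lsCoef)
    refine ih (hb.of_le (by norm_cast; omega)) hR
      (fun k hk => contDiff_pder (hG k hk) (by norm_cast) j) (fun k hk x => ?_)
      (hbc.of_le (by norm_cast; omega))
    have hGk : ContDiff ℝ 1 (G k) := (hG k hk).of_le (by norm_cast; omega)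
    have hbG : ContDiff ℝ 1 fun z => (b z : ℂ) * G k z :=
      (hbc.of_le (by norm_cast; omega)).mul hGk
    have hbGc : HasCompactSupport fun z => (b z : ℂ) * G k z := hcs.mul_right
    have e1 : pder j (fun z => (b z : ℂ) * G k z) =
        fun z => pder j (fun x => (b x : ℂ)) z * G k z + b z * pder j (G k) z := funext fun z =>
      pder_mul (hbc.differentiable (by simp) z) (hGk.differentiable (by simp) z) j
    have hp : Differentiable ℝ (helmPot k fun z => (b z : ℂ) * G k z) :=
      (contDiff_helmPot k (n := 1) hbG hbGc).differentiable (by simp)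
    refine (congrArg (fun g => pder j g x) (funext (h k hk))).trans ?_
    rw [pder_add (hF.differentiable hk x) ((hp x).const_mul _),
      pder_const_mul (hp x), pder_helmPot k hbG hbGc, e1, helmPot_add]
    · ring
    · exact hb'.continuous.mul hGk.continuous
    · exact (hasCompactSupport_pder hcs j).mul_right
    · exact (hbc.continuous).mul (contDiff_pder (n := 0) hGk (by norm_num) j).continuous
    · exact hcs.mul_right

end SmoothFamReg

theorem SmoothFamReg.pderList {ρ : ℝ} {m : ℕ} {F : ℝ → E3 → ℂ} (l : List (Fin 3))
    (hF : SmoothFamReg ρ (m + l.length) F) : SmoothFamReg ρ m fun k => pderList l (F k) := by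
  induction l generalizing m with
  | nil => exact hF
  | cons j l ih =>
    refine (ih (m := m + 1) ?_).2.2 j
    convert hF using 1
    simp only [List.length_cons]
    omega

/-- Extension by zero of a function on the ball. -/
def ballExt {ρ : ℝ} (g : BallFun ρ) (x : E3) : ℂ :=
  open Classical in if h : x ∈ Metric.closedBall (0 : E3) ρ then g ⟨x, h⟩ else 0

/-- The real linear form on `ℝ³` with coefficients `v`. -/
def gradForm (v : Fin 3 → ℂ) : E3 →L[ℝ] ℂ :=
  ∑ j, (EuclideanSpace.proj j : E3 →L[ℝ] ℝ).smulRight (v j)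

theorem gradForm_apply (v : Fin 3 → ℂ) (y : E3) : gradForm v y = ∑ j, (y j : ℂ) * v j := by
  simp [gradForm]

theorem norm_gradForm_le (v : Fin 3 → ℂ) : ‖gradForm v‖ ≤ ∑ j, ‖v j‖ := by
  refine (norm_sum_le _ _).trans (Finset.sum_le_sum fun j _ => ?_)
  rw [ContinuousLinearMap.norm_smulRight_apply]
  refine mul_le_of_le_one_left (norm_nonneg _) ?_
  exact ContinuousLinearMap.opNorm_le_bound _ zero_le_one fun y => by
    simpa using PiLp.norm_apply_le y j

theorem gradForm_sub (v w : Fin 3 → ℂ) : gradForm (fun j => v j - w j) = gradForm v - gradForm w := by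
  ext y
  simp [gradForm_apply, mul_sub, Finset.sum_sub_distrib]

theorem gradForm_const_mul (c : ℂ) (v : Fin 3 → ℂ) :
    gradForm (fun j => c * v j) = c • gradForm v := by
  ext y
  simp [gradForm_apply, Finset.mul_sum, mul_left_comm]

theorem fderiv_eq_gradForm (f : E3 → ℂ) (x : E3) : fderiv ℝ f x = gradForm fun j => pder j f x := by
  ext y
  rw [fderiv_apply_eq_sum, gradForm_apply]

section
variable {ρ : ℝ}

theorem ballExt_coe (g : BallFun ρ) (x : CBall ρ) : ballExt g x = g x := dif_pos x.2

theorem ballExt_of_mem (g : BallFun ρ) {x : E3} (h : x ∈ Metric.closedBall (0 : E3) ρ) :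
    ballExt g x = g ⟨x, h⟩ := dif_pos h

theorem norm_ballExt_le (g : BallFun ρ) (x : E3) : ‖ballExt g x‖ ≤ ‖g‖ := by
  rw [ballExt]
  split_ifs
  · exact g.norm_coe_le_norm _
  · simp

theorem ballExt_sub (f g : BallFun ρ) (x : E3) : ballExt (f - g) x = ballExt f x - ballExt g x := by
  simp only [ballExt]
  split_ifs <;> simp

theorem ballExt_smul (c : ℂ) (g : BallFun ρ) (x : E3) : ballExt (c • g) x = c * ballExt g x := by
  simp only [ballExt]
  split_ifs <;> simp

theorem continuousOn_ballExt (g : BallFun ρ) : ContinuousOn (ballExt g) (Metric.closedBall 0 ρ) := by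
  rw [continuousOn_iff_continuous_domRestrict]
  exact g.continuous.congr fun x => (ballExt_coe g x).symm

/-- The functions `h j` are the partial derivatives of `g` in the open ball. -/
def IsGrad (g : BallFun ρ) (h : Fin 3 → BallFun ρ) : Prop :=
  ∀ x ∈ Metric.ball (0 : E3) ρ, HasFDerivAt (ballExt g) (gradForm fun j => ballExt (h j) x) x

namespace IsGrad
variable {g g' : BallFun ρ} {h h' : Fin 3 → BallFun ρ}

theorem sub (hg : IsGrad g h) (hg' : IsGrad g' h') : IsGrad (g - g') fun j => h j - h' j := by
  intro x hx
  have := (hg x hx).fun_sub (hg' x hx)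
  simp only [funext (ballExt_sub g g'), ballExt_sub, gradForm_sub]
  exact this

theorem smul (c : ℂ) (hg : IsGrad g h) : IsGrad (c • g) fun j => c • h j := by
  intro x hx
  have := (hg x hx).const_mul c
  simp only [funext (ballExt_smul c g), ballExt_smul, gradForm_const_mul]
  exact this

theorem of_tendsto {ι : Type*} {L : Filter ι} [L.NeBot] {G : ι → BallFun ρ}
    {H : ι → Fin 3 → BallFun ρ} (hGH : ∀ᶠ i in L, IsGrad (G i) (H i))
    (hG : Tendsto G L (nhds g)) (hH : ∀ j, Tendsto (fun i => H i j) L (nhds (h j))) :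
    IsGrad g h := by
  intro x hx
  refine hasFDerivAt_of_tendstoUniformlyOnFilter (l := L) (f := fun i => ballExt (G i))
    (f' := fun i x => gradForm fun j => ballExt (H i j) x) (g := ballExt g)
    (g' := fun x => gradForm fun j => ballExt (h j) x) ?_ ?_ ?_
  · have hT : Tendsto (fun i => ∑ j, ‖h j - H i j‖) L (nhds 0) := by
      have := tendsto_finsetSum (Finset.univ : Finset (Fin 3)) fun j _ =>
        ((tendsto_const_nhds (x := h j)).sub (hH j)).norm
      simpa using this
    rw [Metric.tendstoUniformlyOnFilter_iff]
    intro ε hε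
    refine ((hT.eventually (gt_mem_nhds hε)).prod_inl _).mono fun p hp => ?_
    rw [dist_eq_norm, ← gradForm_sub]
    refine (norm_gradForm_le _).trans_lt (lt_of_le_of_lt (Finset.sum_le_sum fun j _ => ?_) hp)
    rw [← ballExt_sub]
    exact norm_ballExt_le _ _
  · exact (hGH.prod_mk (Metric.isOpen_ball.mem_nhds hx)).mono fun p hp => hp.1 p.2 hp.2
  · refine Eventually.of_forall fun y => ?_
    refine tendsto_iff_norm_sub_tendsto_zero.2 ?_
    refine squeeze_zero (fun _ => norm_nonneg _) (fun i => ?_)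
      (tendsto_iff_norm_sub_tendsto_zero.1 hG)
    rw [← ballExt_sub]
    exact norm_ballExt_le _ _

theorem deriv {U : ℝ → BallFun ρ} {V : Fin 3 → ℝ → BallFun ρ} {k : ℝ}
    (hUV : ∀ᶠ s in nhds k, IsGrad (U s) fun j => V j s) (hU : DifferentiableAt ℝ U k)
    (hV : ∀ j, DifferentiableAt ℝ (V j) k) : IsGrad (deriv U k) fun j => deriv (V j) k := by
  have hk := hUV.self_of_nhds
  refine of_tendsto (L := nhdsWithin k {k}ᶜ) (G := slope U k) (H := fun s j => slope (V j) k s) ?_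
    hU.hasDerivAt.tendsto_slope fun j => (hV j).hasDerivAt.tendsto_slope
  filter_upwards [hUV.filter_mono nhdsWithin_le_nhds] with s hs
  have := (hs.sub hk).smul ((s - k : ℝ)⁻¹ : ℂ)
  simpa [slope_def_module, ← Complex.ofReal_inv, ← Complex.ofReal_sub] using this

theorem iterate_deriv {U : ℝ → BallFun ρ} {V : Fin 3 → ℝ → BallFun ρ}
    (hUV : ∀ k, 0 < k → IsGrad (U k) fun j => V j k) (hU : ContDiffOn ℝ (⊤ : ℕ∞) U (Ioi 0))
    (hV : ∀ j, ContDiffOn ℝ (⊤ : ℕ∞) (V j) (Ioi 0)) (n : ℕ) {k : ℝ} (hk : 0 < k) :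
    IsGrad (_root_.deriv^[n] U k) fun j => _root_.deriv^[n] (V j) k := by
  induction n generalizing U V with
  | zero => exact hUV k hk
  | succ n ih =>
    have hd : ∀ {W : ℝ → BallFun ρ}, ContDiffOn ℝ (⊤ : ℕ∞) W (Ioi 0) → ∀ s, 0 < s →
        DifferentiableAt ℝ W s := fun hW s hs =>
      (hW.differentiableOn (by simp)).differentiableAt (Ioi_mem_nhds hs)
    have hd' : ∀ {W : ℝ → BallFun ρ}, ContDiffOn ℝ (⊤ : ℕ∞) W (Ioi 0) →
        ContDiffOn ℝ (⊤ : ℕ∞) (_root_.deriv W) (Ioi 0) := fun hW =>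
      ((contDiffOn_infty_iff_deriv_of_isOpen isOpen_Ioi).1 hW).2
    simp only [Function.iterate_succ_apply]
    refine ih (fun s hs => deriv ?_ (hd hU s hs) fun j => hd (hV j) s hs) (hd' hU)
      fun j => hd' (hV j)
    filter_upwards [Ioi_mem_nhds hs] with t ht using hUV t ht

end IsGrad
end

section
variable {ρ : ℝ} {f : E3 → ℂ} {h : List (Fin 3) → BallFun ρ}

/-- The functions `h l` with `|l| ≤ 3` are the partial derivatives of `f` on the ball. -/
structure IsJet (f : E3 → ℂ) (h : List (Fin 3) → BallFun ρ) : Prop where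
  eq_ballExt : ∀ x ∈ Metric.closedBall (0 : E3) ρ, f x = ballExt (h []) x
  isGrad : ∀ l, l.length ≤ 2 → IsGrad (h l) fun j => h (j :: l)

namespace IsJet

theorem sub {g : E3 → ℂ} {h' : List (Fin 3) → BallFun ρ} (hf : IsJet f h) (hg : IsJet g h') :
    IsJet (fun x => f x - g x) fun l => h l - h' l where
  eq_ballExt x hx := by rw [hf.eq_ballExt x hx, hg.eq_ballExt x hx, ballExt_sub]
  isGrad l hl := (hf.isGrad l hl).sub (hg.isGrad l hl)

theorem pderList_eq (hf : IsJet f h) {l : List (Fin 3)} (hl : l.length ≤ 3) :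
    ∀ x ∈ Metric.ball (0 : E3) ρ, pderList l f x = ballExt (h l) x := by
  induction l with
  | nil => exact fun x hx => hf.eq_ballExt x (Metric.ball_subset_closedBall hx)
  | cons j l ih =>
    intro x hx
    have hl' : l.length ≤ 2 := by
      rw [List.length_cons] at hl
      omega
    have h1 : pderList l f =ᶠ[nhds x] ballExt (h l) := by
      filter_upwards [Metric.isOpen_ball.mem_nhds hx] with y hy using ih (by omega) y hy
    change fderiv ℝ (pderList l f) x (e3 j) = _
    rw [h1.fderiv_eq, (hf.isGrad l hl' x hx).fderiv, gradForm_apply, Finset.sum_eq_single j]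
    · simp [e3]
    · intro i _ hi
      simp [e3, hi]
    · simp

theorem contDiffOn_ballExt (hf : IsJet f h) {m : ℕ} (l : List (Fin 3)) (hl : l.length + m ≤ 3) :
    ContDiffOn ℝ m (ballExt (h l)) (Metric.ball 0 ρ) := by
  induction m generalizing l with
  | zero => exact contDiffOn_zero.2 ((continuousOn_ballExt _).mono Metric.ball_subset_closedBall)
  | succ m ih =>
    have hg := hf.isGrad l (by omega)
    push_cast
    rw [contDiffOn_succ_iff_fderiv_of_isOpen Metric.isOpen_ball]
    refine ⟨fun x hx => (hg x hx).differentiableAt.differentiableWithinAt, by simp, ?_⟩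
    have hc : ContDiffOn ℝ m (fun x => gradForm fun j => ballExt (h (j :: l)) x)
        (Metric.ball 0 ρ) := by
      simp only [gradForm]
      refine ContDiffOn.sum fun j _ => contDiffOn_const.smulRight (ih (j :: l) ?_)
      simp only [List.length_cons]
      omega
    exact hc.congr fun x hx => (hg x hx).fderiv

variable {S : Set E3} {α : ℝ}

theorem supSet_le (hf : IsJet f h) (hS : S ⊆ Metric.ball 0 ρ) {l : List (Fin 3)}
    (hl : l.length ≤ 3) : ∀ r ∈ supSet (pderList l f) S, r ≤ ‖h l‖ := by
  rintro _ ⟨x, hx, rfl⟩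
  simp only [hf.pderList_eq hl x (hS hx)]
  exact norm_ballExt_le _ _

theorem holderSet_le (hf : IsJet f h) (hS : S ⊆ Metric.ball 0 ρ) (hα : α ∈ Ioo (0 : ℝ) 1)
    {l : List (Fin 3)} (hl : l.length ≤ 2) :
    ∀ r ∈ holderSet α (pderList l f) S, r ≤ (∑ j, ‖h (j :: l)‖) * (2 * ρ) ^ (1 - α) := by
  rintro _ ⟨x, hx, y, hy, hxy, rfl⟩
  have hn : 0 < ‖x - y‖ := norm_pos_iff.2 (sub_ne_zero.2 hxy)
  have hρ : ‖x - y‖ ≤ 2 * ρ := by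
    have h1 := mem_ball_zero_iff.1 (hS hx)
    have h2 := mem_ball_zero_iff.1 (hS hy)
    linarith [norm_sub_le x y]
  have hC : 0 ≤ ∑ j, ‖h (j :: l)‖ := Finset.sum_nonneg fun _ _ => norm_nonneg _
  have hmv : ‖ballExt (h l) x - ballExt (h l) y‖ ≤ (∑ j, ‖h (j :: l)‖) * ‖x - y‖ :=
    (convex_ball (0 : E3) ρ).norm_image_sub_le_of_norm_hasFDerivWithin_le
      (fun z hz => (hf.isGrad l hl z hz).hasFDerivWithinAt)
      (fun z _ => (norm_gradForm_le _).trans (Finset.sum_le_sum fun j _ => norm_ballExt_le _ _))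
      (hS hy) (hS hx)
  rw [hf.pderList_eq (by omega) x (hS hx), hf.pderList_eq (by omega) y (hS hy),
    div_le_iff₀ (rpow_pos_of_pos hn α)]
  refine hmv.trans ?_
  rw [mul_assoc]
  refine mul_le_mul_of_nonneg_left ?_ hC
  calc ‖x - y‖ = ‖x - y‖ ^ (1 - α) * ‖x - y‖ ^ α := by
        rw [← rpow_add hn, sub_add_cancel, rpow_one]
    _ ≤ (2 * ρ) ^ (1 - α) * ‖x - y‖ ^ α := by
        gcongr
        linarith [hα.2]

theorem inHolder (hf : IsJet f h) (hS : S ⊆ Metric.ball 0 ρ) (hSc : IsClosed S)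
    (hα : α ∈ Ioo (0 : ℝ) 1) : InHolder 2 α f S := by
  have hfe : EqOn f (ballExt (h [])) (Metric.ball 0 ρ) := fun x hx =>
    hf.eq_ballExt x (Metric.ball_subset_closedBall hx)
  have hc : ContDiffOn ℝ (2 : ℕ) f S :=
    ((hf.contDiffOn_ballExt [] (by simp)).congr hfe).mono hS
  refine ⟨hSc.closure_eq.symm ▸ hc.continuousOn, hc, fun k hk γ => ?_⟩
  have hl : (List.ofFn γ).length ≤ 2 := by simpa using hk
  exact ⟨⟨_, hf.supSet_le hS (by omega)⟩, ⟨_, hf.holderSet_le hS hα hl⟩⟩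

theorem cNorm_le (hf : IsJet f h) (hS : S ⊆ Metric.ball 0 ρ) (hρ : 0 ≤ ρ)
    (hα : α ∈ Ioo (0 : ℝ) 1) :
    cNorm 2 α f S ≤ ∑ k ∈ Finset.range 3, ∑ γ : Fin k → Fin 3,
      (‖h (List.ofFn γ)‖ + (∑ j, ‖h (j :: List.ofFn γ)‖) * (2 * ρ) ^ (1 - α)) := by
  refine Finset.sum_le_sum fun k hk => Finset.sum_le_sum fun γ _ => ?_
  have hk' : (List.ofFn γ).length ≤ 2 := by
    rw [List.length_ofFn]
    have := Finset.mem_range.1 hk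
    omega
  exact add_le_add (Real.sSup_le (hf.supSet_le hS (by omega)) (norm_nonneg _))
    (Real.sSup_le (hf.holderSet_le hS hα hk') (by positivity))

end IsJet
end

theorem cNorm_nonneg (m : ℕ) (α : ℝ) (f : E3 → ℂ) (S : Set E3) : 0 ≤ cNorm m α f S := by
  refine Finset.sum_nonneg fun k _ => Finset.sum_nonneg fun γ _ => add_nonneg ?_ ?_
  · refine Real.sSup_nonneg ?_
    rintro _ ⟨x, _, rfl⟩
    exact norm_nonneg _
  · refine Real.sSup_nonneg ?_
    rintro _ ⟨x, _, y, _, _, rfl⟩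
    positivity

section
variable {ρ : ℝ} {U : ℝ → BallFun ρ} {n : ℕ}

theorem contDiffOn_iterate_deriv (hU : ContDiffOn ℝ (⊤ : ℕ∞) U (Ioi 0)) :
    ContDiffOn ℝ (⊤ : ℕ∞) (deriv^[n] U) (Ioi 0) := by
  induction n with
  | zero => exact hU
  | succ n ih =>
    rw [Function.iterate_succ_apply']
    exact ((contDiffOn_infty_iff_deriv_of_isOpen isOpen_Ioi).1 ih).2

theorem iterate_deriv_eval (hU : ContDiffOn ℝ (⊤ : ℕ∞) U (Ioi 0)) {g : ℝ → ℂ} (x : CBall ρ)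
    (hg : ∀ k, 0 < k → g k = U k x) {k : ℝ} (hk : 0 < k) : deriv^[n] g k = deriv^[n] U k x := by
  induction n generalizing k with
  | zero => exact hg k hk
  | succ n ih =>
    simp only [Function.iterate_succ_apply']
    have h1 : deriv^[n] g =ᶠ[nhds k] fun s =>
        BoundedContinuousFunction.evalCLM ℝ x (deriv^[n] U s) := by
      filter_upwards [Ioi_mem_nhds hk] with s hs using ih hs
    have h2 : DifferentiableAt ℝ (deriv^[n] U) k :=
      ((contDiffOn_iterate_deriv hU).differentiableOn (by simp)).differentiableAt (Ioi_mem_nhds hk)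
    rw [h1.deriv_eq]
    exact ((BoundedContinuousFunction.evalCLM ℝ x).hasFDerivAt.comp_hasDerivAt k
      h2.hasDerivAt).deriv

end

/-- A family of class `SmoothFamReg ρ 3` has jets on the ball of radius `ρ` which depend smoothly
on `k > 0`. -/
theorem SmoothFamReg.exists_isJet {ρ : ℝ} {F : ℝ → E3 → ℂ} (hF : SmoothFamReg ρ 3 F) :
    ∃ U : List (Fin 3) → ℝ → BallFun ρ,
      (∀ l, l.length ≤ 3 → ContDiffOn ℝ (⊤ : ℕ∞) (U l) (Ioi 0)) ∧
      (∀ k, 0 < k → ∀ x : CBall ρ, F k x = U [] k x) ∧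
      ∀ n : ℕ, ∀ k, 0 < k →
        IsJet (fun x => deriv^[n] (fun k => F k x) k) fun l => deriv^[n] (U l) k := by
  have hex : ∀ l : List (Fin 3), ∃ U : ℝ → BallFun ρ, l.length ≤ 3 →
      ContDiffOn ℝ (⊤ : ℕ∞) U (Ioi 0) ∧
      ∀ k, 0 < k → ∀ x : CBall ρ, U k x = _root_.pderList l (F k) x := fun l => by
    by_cases hl : l.length ≤ 3
    · obtain ⟨m, hm⟩ := Nat.exists_eq_add_of_le' hl
      rw [hm] at hF
      obtain ⟨U, hU⟩ := (hF.pderList l).smoothFam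
      exact ⟨U, fun _ => hU⟩
    · exact ⟨0, fun h => absurd h hl⟩
  choose U hU using hex
  have hU0 : ∀ k, 0 < k → ∀ x : CBall ρ, F k x = U [] k x := fun k hk x =>
    ((hU [] (by simp)).2 k hk x).symm
  refine ⟨U, fun l hl => (hU l hl).1, hU0, fun n k hk => ⟨fun x hx => ?_, fun l hl => ?_⟩⟩
  · rw [ballExt_of_mem _ hx]
    exact iterate_deriv_eval (hU [] (by simp)).1 ⟨x, hx⟩ (fun s hs => hU0 s hs ⟨x, hx⟩) hk
  · have hl' : ∀ j : Fin 3, (j :: l).length ≤ 3 := fun j => by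
      rw [List.length_cons]
      omega
    refine IsGrad.iterate_deriv (fun s hs x hx => ?_) (hU l (by omega)).1
      (fun j => (hU (j :: l) (hl' j)).1) n hk
    have hx' := Metric.ball_subset_closedBall hx
    obtain ⟨m, hm⟩ := Nat.exists_eq_add_of_le' hl
    have hF' : SmoothFamReg ρ (m + 1 + l.length) F := by
      convert hF using 1
      omega
    have hd := ((hF'.pderList l).differentiable hs x).hasFDerivAt
    rw [fderiv_eq_gradForm] at hd
    have e1 : (fun j => ballExt (U (j :: l) s) x) = fun j => pder j (_root_.pderList l (F s)) x :=
      funext fun j => by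
        rw [ballExt_of_mem _ hx', (hU (j :: l) (hl' j)).2 s hs]
        rfl
    rw [e1]
    refine hd.congr_of_eventuallyEq ?_
    filter_upwards [Metric.isOpen_ball.mem_nhds hx] with y hy
    rw [ballExt_of_mem _ (Metric.ball_subset_closedBall hy), (hU l (by omega)).2 s hs]

/-- The solutions of the scattering problem form a family of class `SmoothFamReg ρ 3`. -/
theorem smoothFamReg_of_scattering {ρ : ℝ} {b : E3 → ℝ} (hb : ContDiff ℝ 5 b)
    (hbρ : ∀ x, ρ < ‖x‖ → b x = 0) {F : ℝ → E3 → ℂ} (hF : ∀ k, 0 < k → ContDiff ℝ 2 (F k))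
    (hH : ∀ k, 0 < k → ∀ x, lap (F k) x + (k : ℂ) ^ 2 * ((1 : ℂ) + (b x : ℂ)) * F k x = 0)
    (hrad : ∀ k, 0 < k → RadCond k fun x => F k x - planeWave k x) : SmoothFamReg ρ 3 F := by
  have hbc : HasCompactSupport b := HasCompactSupport.intro (isCompact_closedBall 0 ρ)
    fun x hx => hbρ x (by simpa using hx)
  have hb2 : ContDiff ℝ 2 b := hb.of_le (by norm_num)
  have hLS := fun k (hk : 0 < k) =>
    lippmannSchwinger hk hb2 hbc (hF k hk) (hH k hk) (hrad k hk)
  refine SmoothFamReg.of_eq_add_pot hb hbρ SmoothFamReg.planeWave (fun k hk => ?_) hLS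
  rw [funext (hLS k hk)]
  refine (contDiff_planeWave k).add (contDiff_const.mul (contDiff_helmPot_succ k 2 ?_ ?_))
  · exact (Complex.ofRealCLM.contDiff.comp hb2).mul (hF k hk)
  · exact HasCompactSupport.intro hbc fun x hx => by simp [image_eq_zero_of_notMem_tsupport hx]

/-- Lemma 4.3. For `c = 1 + β ∈ C^{15}(ℝ³)` and the solutions `u(·,k)` of the
scattering problem, `u(x,·)` is infinitely differentiable in `k > 0`, each `∂ₖⁿu(·,k)` lies in
`C^{2+α}(Ω̄)`, and `|∂ₖⁿu(·,k+ω) − ∂ₖⁿu(·,k)|_{2+α} → 0` as `ω → 0`. -/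
theorem statement7 (α : ℝ) (hα : α ∈ Set.Ioo (0 : ℝ) 1)
    (Ω₁ Ω : Set E3) (hΩ₁o : IsOpen Ω₁) (hΩo : IsOpen Ω)
    (hΩ₁conn : IsConnected Ω₁) (hΩconn : IsConnected Ω)
    (hΩb : Bornology.IsBounded Ω) (hΩconv : Convex ℝ Ω)
    (hsub : closure Ω₁ ⊆ Ω)
    (hbdry : HolderBoundary 2 α Ω) (hbdry₁ : HolderBoundary 2 α Ω₁)
    (β : E3 → ℝ) (hc15 : ContDiff ℝ 15 (fun x => (1 : ℝ) + β x))
    (hβpos : ∀ x, 0 ≤ β x) (hβ0 : ∀ x ∉ Ω₁, β x = 0)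
    (u : E3 → ℝ → ℂ)
    (hsol : ∀ k : ℝ, 0 < k →
      InHolder 2 α (fun x => u x k) Set.univ ∧
      (∀ x : E3, lap (fun y => u y k) x + (k : ℂ) ^ 2 * ((1 : ℂ) + (β x : ℂ)) * u x k = 0) ∧
      RadCond k (fun x => u x k - planeWave k x)) :
    (∀ x ∈ closure Ω, ContDiffOn ℝ (⊤ : ℕ∞) (u x) (Set.Ioi (0 : ℝ))) ∧
    (∀ n : ℕ, ∀ k : ℝ, 0 < k →
      InHolder 2 α (fun x => deriv^[n] (u x) k) (closure Ω)) ∧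
    (∀ n : ℕ, ∀ k : ℝ, 0 < k →
      Filter.Tendsto
        (fun ω : ℝ => cNorm 2 α
          (fun x => deriv^[n] (u x) (k + ω) - deriv^[n] (u x) k) (closure Ω))
        (nhds 0) (nhds 0)) := by
  obtain ⟨ρ, hρ0, hρ⟩ := hΩb.closure.subset_ball_lt 0 0
  have hΩ₁ρ : Ω₁ ⊆ Metric.ball 0 ρ := subset_closure.trans (hsub.trans (subset_closure.trans hρ))
  have hβ : ContDiff ℝ 5 β := by
    have h := (hc15.sub (contDiff_const (c := (1 : ℝ)))).of_le (m := 5) (by norm_num)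
    simpa using h
  have hβρ : ∀ x, ρ < ‖x‖ → β x = 0 := fun x hx => hβ0 x fun hx' => by
    have := mem_ball_zero_iff.1 (hΩ₁ρ hx')
    linarith
  have hreg : SmoothFamReg ρ 3 fun k x => u x k := smoothFamReg_of_scattering hβ hβρ
    (fun k hk => contDiffOn_univ.1 (hsol k hk).1.2.1) (fun k hk => (hsol k hk).2.1)
    fun k hk => (hsol k hk).2.2
  obtain ⟨U, hU, hU0, hjet⟩ := hreg.exists_isJet
  refine ⟨fun x hx => ?_, fun n k hk => (hjet n k hk).inHolder hρ isClosed_closure hα,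
    fun n k hk => ?_⟩
  · have hx' := Metric.ball_subset_closedBall (hρ hx)
    have h := (BoundedContinuousFunction.evalCLM ℝ (⟨x, hx'⟩ : CBall ρ)).contDiff.comp_contDiffOn
      (hU [] (by simp))
    exact h.congr fun k hk => hU0 k hk ⟨x, hx'⟩
  · have hlim : ∀ l : List (Fin 3), l.length ≤ 3 →
        Tendsto (fun ω => ‖deriv^[n] (U l) (k + ω) - deriv^[n] (U l) k‖) (nhds 0) (nhds 0) :=
      fun l hl => by
        have hc : Tendsto (deriv^[n] (U l)) (nhds k) (nhds (deriv^[n] (U l) k)) :=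
          (contDiffOn_iterate_deriv (hU l hl)).continuousOn.continuousAt (Ioi_mem_nhds hk)
        have ht : Tendsto (fun ω => k + ω) (nhds 0) (nhds k) :=
          (continuous_const_add k).tendsto' 0 k (add_zero k)
        exact tendsto_iff_norm_sub_tendsto_zero.1 (hc.comp ht)
    refine squeeze_zero' (Eventually.of_forall fun ω => cNorm_nonneg _ _ _ _)
      (g := fun ω => ∑ m ∈ Finset.range 3, ∑ γ : Fin m → Fin 3,
        (‖deriv^[n] (U (List.ofFn γ)) (k + ω) - deriv^[n] (U (List.ofFn γ)) k‖ +
          (∑ j, ‖deriv^[n] (U (j :: List.ofFn γ)) (k + ω) - deriv^[n] (U (j :: List.ofFn γ)) k‖) *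
            (2 * ρ) ^ (1 - α))) ?_ ?_
    · filter_upwards [Ioi_mem_nhds (show -k < 0 by linarith)] with ω hω
      have hkω : 0 < k + ω := by
        have := mem_Ioi.1 hω
        linarith
      exact ((hjet n (k + ω) hkω).sub (hjet n k hk)).cNorm_le hρ hρ0.le hα
    · have h0 : (0 : ℝ) = ∑ m ∈ Finset.range 3, ∑ γ : Fin m → Fin 3,
          (0 + (∑ _j : Fin 3, 0) * (2 * ρ) ^ (1 - α)) := by simp
      conv => arg 3; rw [h0]
      refine tendsto_finsetSum _ fun m hm => tendsto_finsetSum _ fun γ _ => ?_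
      have hm' : (List.ofFn γ).length ≤ 2 := by
        rw [List.length_ofFn]
        have := Finset.mem_range.1 hm
        omega
      refine (hlim (List.ofFn γ) (by omega)).add ((tendsto_finsetSum _ fun j _ => hlim (j :: List.ofFn γ) ?_).mul_const _)
      rw [List.length_cons]
      omega

end
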